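/- Let R be a standard bigraded K-algebra with irrelevant bigraded ideals P and Q, where P is minimally generated by m homogeneous elements, and let M be a finitely generated bigraded generalized Cohen-Macaulay R-module of dimension s. Then there is a long exact sequence of bigraded R-modules 0 → H^1_P(H^s_{R_+}(M)^∨) → H^{s-1}_Q(M)^∨ → H^{s-1}_{R_+}(M)^∨ → H^2_P(H^s_{R_+}(M)^∨) → H^{s-2}_Q(M)^∨ → H^{s-2}_{R_+}(M)^∨ → ⋯ → H^{s-m}_Q(M)^∨ → H^{s-m}_{R_+}(M)^∨ → 0; moreover H^i_{R_+}(M) ≅ H^i_Q(M) for all i < s - m. -/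

import Mathlib

/-!
Common framework: standard bigraded algebras, bigraded modules, bigraded Matlis duals
(characterized by a perfect pairing), and `ℤ`-indexed local cohomology.
-/

open CategoryTheory

universe u

noncomputable section

/-- `ℤ`-indexed local cohomology: `H^k_I(M)` for `k : ℤ`, zero for negative `k`. -/
noncomputable def LC (R : Type u) [CommRing R] (I : Ideal R) (k : ℤ)
    (M : Type u) [AddCommGroup M] [Module R M] : ModuleCat.{u} R :=
  if 0 ≤ k then (localCohomology I k.toNat).obj (ModuleCat.of R M)
  else ModuleCat.of R PUnit

variable (K R : Type u) [Field K] [CommRing R] [Algebra K R] (𝒜 : ℕ × ℕ → Submodule K R)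

/-- The irrelevant bigraded ideal `P` generated by all elements of degree `(1,0)`. -/
def idealP : Ideal R := Ideal.span (𝒜 (1, 0) : Set R)

/-- The irrelevant bigraded ideal `Q` generated by all elements of degree `(0,1)`. -/
def idealQ : Ideal R := Ideal.span (𝒜 (0, 1) : Set R)

/-- The unique graded maximal ideal `R₊ = P + Q`. -/
def idealRPlus : Ideal R := idealP K R 𝒜 ⊔ idealQ K R 𝒜

/-- `R` is a standard bigraded `K`-algebra: `R_{(0,0)} = K` and `R` is generated over `K`
by the (finite-dimensional) components of degrees `(1,0)` and `(0,1)`. -/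
structure IsStandardBigraded [GradedAlgebra 𝒜] : Prop where
  degree_zero : 𝒜 (0, 0) = Subalgebra.toSubmodule (⊥ : Subalgebra K R)
  fg10 : (𝒜 (1, 0)).FG
  fg01 : (𝒜 (0, 1)).FG
  adjoin_eq_top : Algebra.adjoin K ((𝒜 (1, 0) : Set R) ∪ (𝒜 (0, 1) : Set R)) = ⊤

/-- A bigraded `R`-module structure on `M`: an internal direct sum decomposition into
`K`-stable additive subgroups, compatible with the bigrading `𝒜` of `R`. -/
structure Bigrading (M : Type u) [AddCommGroup M] [Module R M] : Type u where
  grading : ℤ × ℤ → AddSubgroup M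
  ksmul_mem : ∀ (c : K) (b : ℤ × ℤ) (x : M), x ∈ grading b → algebraMap K R c • x ∈ grading b
  internal : DirectSum.IsInternal grading
  compat : ∀ (a : ℕ × ℕ) (b : ℤ × ℤ) (r : R) (x : M), r ∈ 𝒜 a → x ∈ grading b →
    r • x ∈ grading (((a.1 : ℤ), (a.2 : ℤ)) + b)

/-- Data exhibiting a bigraded Matlis dual of `M`: a bigrading `src` on `M`, a bigraded
`R`-module `D`, and an `R`-balanced `K`-bilinear pairing `D × M → K` which puts the component
of `D` of degree `a` in perfect duality with the component of `M` of degree `-a`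
(and is zero between components of degrees `a`, `b` with `a + b ≠ 0`).  This characterizes
`D` as the bigraded module with `D_{(i,j)} = Hom_K (M_{(-i,-j)}, K)`. -/
structure DualData (M : Type u) [AddCommGroup M] [Module R M] : Type (u + 1) where
  src : Bigrading K R 𝒜 M
  D : Type u
  [addCommGroup : AddCommGroup D]
  [module : Module R D]
  bg : Bigrading K R 𝒜 D
  pairing : D →+ M →+ K
  pairing_smul : ∀ (r : R) (d : D) (x : M), pairing (r • d) x = pairing d (r • x)
  pairing_ksmul : ∀ (c : K) (d : D) (x : M), pairing (algebraMap K R c • d) x = c * pairing d x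
  orth : ∀ (a b : ℤ × ℤ), a + b ≠ 0 → ∀ d ∈ bg.grading a, ∀ x ∈ src.grading b, pairing d x = 0
  nondeg : ∀ (a : ℤ × ℤ) (d : D), d ∈ bg.grading a →
    (∀ x ∈ src.grading (-a), pairing d x = 0) → d = 0
  full : ∀ (a : ℤ × ℤ) (φ : M →+ K),
    (∀ (c : K) (x : M), φ (algebraMap K R c • x) = c * φ x) →
    ∃ d ∈ bg.grading a, ∀ x ∈ src.grading (-a), pairing d x = φ x

attribute [instance] DualData.addCommGroup DualData.module

/-- A bigraded module is tame if, viewing it as graded by the second degree `j`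
(with components `N_j = ⊕_i N_{(i,j)}`), there is `j₀` such that either all components with
`j ≤ j₀` vanish, or all components with `j ≤ j₀` are nonzero. -/
def IsTame {M : Type u} [AddCommGroup M] [Module R M] (bg : Bigrading K R 𝒜 M) : Prop :=
  ∃ j₀ : ℤ, (∀ j ≤ j₀, ∀ i : ℤ, bg.grading (i, j) = ⊥) ∨ (∀ j ≤ j₀, ∃ i : ℤ, bg.grading (i, j) ≠ ⊥)

/-- The ideal `P` is minimally generated by `m` (homogeneous, of degree `(1,0)`) elements. -/
def MinimallyGeneratedBy (m : ℕ) : Prop :=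
  (∃ s : Finset R, (↑s : Set R) ⊆ (𝒜 (1, 0) : Set R) ∧ Ideal.span (↑s : Set R) = idealP K R 𝒜 ∧
      s.card = m) ∧
  ∀ s : Finset R, Ideal.span (↑s : Set R) = idealP K R 𝒜 → m ≤ s.card

/-! ### Bounded differential modules

A bounded cochain complex of `R`-modules is encoded as a single module with a differential `d` and
projections `c k` onto the components of cohomological degree `k`. -/

/-- A bounded cochain complex, as one module with a differential and degree projections. -/
structure DiffModule where
  carrier : Type u
  [grp : AddCommGroup carrier]
  [mod : Module R carrier]
  d : carrier →ₗ[R] carrier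
  c : ℤ → carrier →ₗ[R] carrier
  d_d : ∀ x, d (d x) = 0
  c_c : ∀ k l x, c k (c l x) = if k = l then c l x else 0
  c_d : ∀ k x, c (k + 1) (d x) = d (c k x)
  c_sum : ∃ F : Finset ℤ, ∀ x, ∑ k ∈ F, c k x = x

namespace DiffModule

variable {R}

instance : CoeSort (DiffModule R) (Type u) := ⟨DiffModule.carrier⟩

attribute [instance] DiffModule.grp DiffModule.mod

attribute [simp] DiffModule.d_d

variable (A B C : DiffModule R)

lemma c_self (k : ℤ) (x : A) : A.c k (A.c k x) = A.c k x := by simp [A.c_c]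

lemma c_of_ne {k l : ℤ} (h : k ≠ l) (x : A) : A.c k (A.c l x) = 0 := by simp [A.c_c, h]

lemma c_d' (k : ℤ) (x : A) : A.c k (A.d x) = A.d (A.c (k - 1) x) := by
  simpa using A.c_d (k - 1) x

lemma d_c (k : ℤ) (x : A) : A.d (A.c k x) = A.c (k + 1) (A.d x) := (A.c_d k x).symm

variable {A} in
lemma d_c_of_d {x : A} (h : A.d x = 0) (k : ℤ) : A.d (A.c k x) = 0 := by
  rw [d_c, h, map_zero]

lemma sum_of_subset {F G : Finset ℤ} (h : F ⊆ G) (hF : ∀ x : A, ∑ k ∈ F, A.c k x = x) (x : A) :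
    ∑ k ∈ G, A.c k x = x := by
  rw [← Finset.sum_subset h, hF]
  intro k _ hk
  rw [← hF x, map_sum]
  refine Finset.sum_eq_zero fun l hl => A.c_of_ne ?_ x
  rintro rfl
  exact hk hl

/-- Morphisms of complexes. -/
@[ext]
structure Hom where
  toLin : A →ₗ[R] B
  map_d : ∀ x, toLin (A.d x) = B.d (toLin x)
  map_c : ∀ k x, toLin (A.c k x) = B.c k (toLin x)

variable {A B C}

instance : CoeFun (Hom A B) (fun _ => A → B) := ⟨fun f => f.toLin⟩

/-- The identity morphism. -/
def Hom.id : Hom A A := ⟨LinearMap.id, fun _ => rfl, fun _ _ => rfl⟩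

/-- Composition of morphisms. -/
def Hom.comp (g : Hom B C) (f : Hom A B) : Hom A C :=
  ⟨g.toLin ∘ₗ f.toLin, fun x => by simp [f.map_d, g.map_d], fun k x => by simp [f.map_c, g.map_c]⟩

@[simp] lemma Hom.comp_apply (g : Hom B C) (f : Hom A B) (x : A) : g.comp f x = g (f x) := rfl

/-- Vanishing of the cohomology in degree `k`. -/
def Ex (A : DiffModule R) (k : ℤ) : Prop :=
  ∀ z : A, A.d z = 0 → A.c k z = z → ∃ w, z = A.d w

/-- Vanishing of the whole cohomology. -/
def Acyclic (A : DiffModule R) : Prop := ∀ z : A, A.d z = 0 → ∃ w, z = A.d w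

lemma Acyclic.ex (h : A.Acyclic) (k : ℤ) : A.Ex k := fun z hz _ => h z hz

lemma acyclic_of_ex (h : ∀ k, A.Ex k) : A.Acyclic := by
  intro z hz
  have : ∀ k, ∃ w, A.c k z = A.d w := fun k => h k _ (d_c_of_d hz k) (A.c_self k z)
  choose w hw using this
  obtain ⟨F, hF⟩ := A.c_sum
  refine ⟨∑ k ∈ F, w k, ?_⟩
  rw [map_sum, ← Finset.sum_congr rfl fun k _ => hw k, hF]

/-- Injectivity on cohomology in degree `k`. -/
def Hom.InjAt (f : Hom A B) (k : ℤ) : Prop :=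
  ∀ a : A, A.d a = 0 → A.c k a = a → (∃ b, f a = B.d b) → ∃ v, a = A.d v

/-- Surjectivity on cohomology in degree `k`. -/
def Hom.SurjAt (f : Hom A B) (k : ℤ) : Prop :=
  ∀ b : B, B.d b = 0 → B.c k b = b →
    ∃ a : A, A.d a = 0 ∧ A.c k a = a ∧ ∃ v, b = f a + B.d v

/-- Bijectivity on cohomology in degree `k`. -/
def Hom.BijAt (f : Hom A B) (k : ℤ) : Prop := f.InjAt k ∧ f.SurjAt k

lemma Hom.BijAt.comp {g : Hom B C} {f : Hom A B} {k : ℤ} (hg : g.BijAt k) (hf : f.BijAt k) :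
    (g.comp f).BijAt k := by
  refine ⟨fun a ha hk ⟨b, hb⟩ => ?_, fun z hz hk => ?_⟩
  · exact hf.1 a ha hk (hg.1 (f a) (by rw [← f.map_d, ha, map_zero]) (by rw [← f.map_c, hk])
      ⟨b, hb⟩)
  · obtain ⟨b, hb, hbk, c', hc⟩ := hg.2 z hz hk
    obtain ⟨a, ha, hak, b', hb'⟩ := hf.2 b hb hbk
    refine ⟨a, ha, hak, g b' + c', ?_⟩
    rw [hc, hb', map_add, g.map_d, map_add, comp_apply, add_assoc]

lemma Hom.BijAt.of_comp_left {g : Hom B C} {f : Hom A B} {k : ℤ} (hg : g.BijAt k)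
    (hgf : (g.comp f).BijAt k) : f.BijAt k := by
  refine ⟨fun a ha hk ⟨b, hb⟩ => ?_, fun z hz hk => ?_⟩
  · exact hgf.1 a ha hk ⟨g b, by rw [comp_apply, hb, g.map_d]⟩
  · obtain ⟨a, ha, hak, c', hc⟩ := hgf.2 (g z) (by rw [← g.map_d, hz, map_zero])
      (by rw [← g.map_c, hk])
    refine ⟨a, ha, hak, ?_⟩
    obtain ⟨w, hw⟩ := hg.1 (z - f a) (by rw [map_sub, ← f.map_d, hz, ha, map_zero, sub_zero])
      (by rw [map_sub, ← f.map_c, hk, hak]) ⟨c', by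
        rw [map_sub, hc, comp_apply, add_sub_cancel_left]⟩
    exact ⟨w, by rw [← hw, add_sub_cancel]⟩

lemma Hom.BijAt.of_comp_right {g : Hom B C} {f : Hom A B} {k : ℤ} (hf : f.BijAt k)
    (hgf : (g.comp f).BijAt k) : g.BijAt k := by
  refine ⟨fun b hb hk ⟨c', hc⟩ => ?_, fun z hz hk => ?_⟩
  · obtain ⟨a, ha, hak, b', rfl⟩ := hf.2 b hb hk
    obtain ⟨w, hw⟩ := hgf.1 a ha hak ⟨c' - g b', by
      rw [map_sub, ← hc, map_add, g.map_d, comp_apply, add_sub_cancel_right]⟩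
    exact ⟨f w + b', by rw [map_add, ← f.map_d, ← hw]⟩
  · obtain ⟨a, ha, hak, c', hc⟩ := hgf.2 z hz hk
    exact ⟨f a, by rw [← f.map_d, ha, map_zero], by rw [← f.map_c, hak], c', hc⟩

/-- Quasi-isomorphisms. -/
def Hom.QI (f : Hom A B) : Prop := ∀ k, f.BijAt k

/-! #### Short exact sequences -/

/-- Short exact sequences of complexes. -/
structure SES (f : Hom A B) (g : Hom B C) : Prop where
  inj : Function.Injective f
  exact : ∀ b, g b = 0 ↔ ∃ a, f a = b
  surj : Function.Surjective g

section SES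

variable {f : Hom A B} {g : Hom B C} (S : SES f g)
include S

lemma SES.comp_zero (a : A) : g (f a) = 0 := (S.exact _).2 ⟨a, rfl⟩

lemma SES.injAt_left {k l : ℤ} (h : k + 1 = l) (hC : C.Ex k) : f.InjAt l := by
  subst h
  rintro a ha hk ⟨b, hb⟩
  have hb' : f a = B.d (B.c k b) := by
    rw [d_c, ← hb, ← f.map_c, hk]
  obtain ⟨w, hw⟩ := hC (g (B.c k b)) (by rw [← g.map_d, ← hb', S.comp_zero])
    (by rw [← g.map_c, c_self])
  obtain ⟨v, rfl⟩ := S.surj w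
  obtain ⟨a', ha'⟩ := (S.exact (B.c k b - B.d v)).1 (by rw [map_sub, hw, g.map_d, sub_self])
  refine ⟨a', S.inj ?_⟩
  rw [f.map_d, ha', map_sub, d_d, sub_zero, hb']

lemma SES.surjAt_left {k : ℤ} (hC : C.Ex k) : f.SurjAt k := by
  intro b hb hk
  obtain ⟨w, hw⟩ := hC (g b) (by rw [← g.map_d, hb, map_zero]) (by rw [← g.map_c, hk])
  obtain ⟨v, rfl⟩ := S.surj w
  obtain ⟨a', ha'⟩ := (S.exact (b - B.d v)).1 (by rw [map_sub, hw, g.map_d, sub_self])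
  have ha'' : f (A.c k a') = b - B.d (B.c (k - 1) v) := by
    rw [f.map_c, ha', map_sub, hk, c_d']
  refine ⟨A.c k a', S.inj ?_, A.c_self _ _, B.c (k - 1) v, ?_⟩
  · rw [f.map_d, ha'', map_sub, hb, d_d, map_zero, sub_zero]
  · rw [ha'', sub_add_cancel]

lemma SES.surjAt_right {k l : ℤ} (h : k + 1 = l) (hA : A.Ex l) : g.SurjAt k := by
  subst h
  intro c hc hk
  obtain ⟨b, rfl⟩ := S.surj c
  obtain ⟨a, ha⟩ := (S.exact (B.d (B.c k b))).1 (by rw [g.map_d, g.map_c, hk, hc])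
  obtain ⟨w, hw⟩ := hA a (S.inj (by rw [f.map_d, ha, d_d, map_zero]))
    (S.inj (by rw [f.map_c, ha, c_d, c_self]))
  refine ⟨B.c k (B.c k b - f w), ?_, B.c_self _ _, g (f (A.c k w)), ?_⟩
  · rw [d_c, map_sub, ← ha, ← f.map_d, hw, sub_self, map_zero]
  · rw [S.comp_zero, map_zero, add_zero, map_sub, map_sub, c_self, ← f.map_c, S.comp_zero, sub_zero,
      g.map_c, hk]

lemma SES.injAt_right {k : ℤ} (hA : A.Ex k) : g.InjAt k := by
  rintro b hb hk ⟨c, hc⟩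
  obtain ⟨v, rfl⟩ := S.surj c
  obtain ⟨a, ha⟩ := (S.exact (b - B.d (B.c (k - 1) v))).1 (by
    rw [map_sub, ← c_d', g.map_c, g.map_d, ← hc, ← g.map_c, hk, sub_self])
  obtain ⟨w, hw⟩ := hA a (S.inj (by rw [f.map_d, ha, map_sub, hb, d_d, sub_zero, map_zero]))
    (S.inj (by rw [f.map_c, ha, map_sub, hk, ← c_d', c_self]))
  refine ⟨f w + B.c (k - 1) v, ?_⟩
  rw [map_add, ← f.map_d, ← hw, ha, sub_add_cancel]

lemma SES.qi_left (hC : C.Acyclic) : f.QI := fun k =>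
  ⟨S.injAt_left (sub_add_cancel k 1) (hC.ex _), S.surjAt_left (hC.ex _)⟩

lemma SES.qi_right (hA : A.Acyclic) : g.QI := fun k =>
  ⟨S.injAt_right (hA.ex _), S.surjAt_right rfl (hA.ex _)⟩

lemma SES.ex_mid {k : ℤ} (hA : A.Ex k) (hC : C.Ex k) : B.Ex k := by
  intro b hb hk
  obtain ⟨c, hc⟩ := hC (g b) (by rw [← g.map_d, hb, map_zero]) (by rw [← g.map_c, hk])
  exact S.injAt_right hA b hb hk ⟨c, hc⟩

end SES

/-! #### Cohomology modules -/

/-- Cocycles of degree `k`. -/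
def Z (A : DiffModule R) (k : ℤ) : Submodule R A where
  carrier := {x | A.d x = 0 ∧ A.c k x = x}
  zero_mem' := by simp
  add_mem' := by
    rintro x y ⟨h1, h2⟩ ⟨h3, h4⟩
    simp [h1, h2, h3, h4]
  smul_mem' := by
    rintro r x ⟨h1, h2⟩
    simp [h1, h2]

/-- The cohomology of degree `k`. -/
abbrev Coh (A : DiffModule R) (k : ℤ) : Type u :=
  A.Z k ⧸ (LinearMap.range A.d).comap (A.Z k).subtype

/-- The class of a cocycle. -/
abbrev cls (A : DiffModule R) (k : ℤ) : A.Z k →ₗ[R] A.Coh k := Submodule.mkQ _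

lemma cls_surjective (k : ℤ) : Function.Surjective (A.cls k) := Submodule.mkQ_surjective _

lemma cls_eq_zero {k : ℤ} (x : A.Z k) : A.cls k x = 0 ↔ ∃ w, (x : A) = A.d w := by
  rw [Submodule.mkQ_apply, Submodule.Quotient.mk_eq_zero]
  simp [eq_comm]

lemma subsingleton_coh_iff {k : ℤ} : Subsingleton (A.Coh k) ↔ A.Ex k := by
  constructor
  · intro h z hz hk
    exact (cls_eq_zero (⟨z, hz, hk⟩ : A.Z k)).1 (Subsingleton.elim _ _)
  · intro h
    refine subsingleton_of_forall_eq 0 fun y => ?_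
    obtain ⟨x, rfl⟩ := cls_surjective k y
    exact (cls_eq_zero x).2 (h x x.2.1 x.2.2)

/-- The map on cocycles. -/
def Hom.mapZ (f : Hom A B) (k : ℤ) : A.Z k →ₗ[R] B.Z k :=
  f.toLin.restrict fun x hx => ⟨by rw [← f.map_d, hx.1, map_zero], by rw [← f.map_c, hx.2]⟩

@[simp] lemma Hom.coe_mapZ (f : Hom A B) (k : ℤ) (x : A.Z k) : (f.mapZ k x : B) = f x := rfl

/-- The map on cohomology. -/
def Hom.mapCoh (f : Hom A B) (k : ℤ) : A.Coh k →ₗ[R] B.Coh k :=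
  Submodule.mapQ _ _ (f.mapZ k) (by
    rintro x ⟨w, hw⟩
    exact ⟨f w, by rw [← f.map_d, hw]; rfl⟩)

@[simp] lemma Hom.mapCoh_cls (f : Hom A B) (k : ℤ) (x : A.Z k) :
    f.mapCoh k (A.cls k x) = B.cls k (f.mapZ k x) := rfl

lemma Hom.InjAt.injective {f : Hom A B} {k : ℤ} (h : f.InjAt k) :
    Function.Injective (f.mapCoh k) := by
  rw [← LinearMap.ker_eq_bot, LinearMap.ker_eq_bot']
  intro y hy
  obtain ⟨x, rfl⟩ := cls_surjective k y
  exact (cls_eq_zero x).2 (h x x.2.1 x.2.2 ((cls_eq_zero _).1 hy))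

lemma Hom.SurjAt.surjective {f : Hom A B} {k : ℤ} (h : f.SurjAt k) :
    Function.Surjective (f.mapCoh k) := by
  intro y
  obtain ⟨x, rfl⟩ := cls_surjective k y
  obtain ⟨a, ha, hak, b', hb⟩ := h x x.2.1 x.2.2
  refine ⟨A.cls k ⟨a, ha, hak⟩, ?_⟩
  rw [mapCoh_cls, ← sub_eq_zero, ← map_sub, cls_eq_zero]
  refine ⟨-b', ?_⟩
  rw [map_neg, AddSubgroupClass.coe_sub, coe_mapZ, hb]
  abel

/-- The isomorphism induced on cohomology. -/
def Hom.BijAt.equiv {f : Hom A B} {k : ℤ} (h : f.BijAt k) : A.Coh k ≃ₗ[R] B.Coh k :=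
  LinearEquiv.ofBijective (f.mapCoh k) ⟨h.1.injective, h.2.surjective⟩

/-! #### The long exact cohomology sequence -/

section LES

variable {f : Hom A B} {g : Hom B C} (S : SES f g) {k l : ℤ} (h : k + 1 = l)

include S h in
lemma SES.exists_delta : ∃ δ : C.Coh k →ₗ[R] A.Coh l, ∀ (z : C.Z k) (b : B) (a : A.Z l),
    g b = z → f a = B.d b → δ (C.cls k z) = A.cls l a := by
  let W : Submodule R (B × A.Z l) :=
    { carrier := {p | g p.1 ∈ C.Z k ∧ f p.2 = B.d p.1}
      zero_mem' := by simp
      add_mem' := by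
        rintro x y ⟨h1, h2⟩ ⟨h3, h4⟩
        exact ⟨by simpa using add_mem h1 h3, by simp [h2, h4]⟩
      smul_mem' := by
        rintro r x ⟨h1, h2⟩
        exact ⟨by simpa using Submodule.smul_mem _ r h1, by simp [h2]⟩ }
  let π : W →ₗ[R] C.Z k := LinearMap.codRestrict _ (g.toLin ∘ₗ LinearMap.fst R B (A.Z l) ∘ₗ W.subtype)
    fun x => x.2.1
  have hπ : Function.Surjective ((C.cls k) ∘ₗ π) := by
    refine (cls_surjective k).comp fun z => ?_
    obtain ⟨b, hb⟩ := S.surj (z : C)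
    have hgz : g (B.c k b) = z := by rw [g.map_c, hb, z.2.2]
    obtain ⟨a, ha⟩ := (S.exact (B.d (B.c k b))).1 (by rw [g.map_d, hgz, z.2.1])
    refine ⟨⟨(B.c k b, ⟨a, S.inj ?_, S.inj ?_⟩), ?_, ha⟩, ?_⟩
    · rw [f.map_d, ha, d_d, map_zero]
    · rw [f.map_c, ha, ← h, c_d, c_self]
    · change g (B.c k b) ∈ _
      rw [hgz]
      exact z.2
    · exact Subtype.ext hgz
  let σ : W →ₗ[R] A.Coh l := A.cls l ∘ₗ LinearMap.snd R B (A.Z l) ∘ₗ W.subtype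
  have hker : LinearMap.ker ((C.cls k) ∘ₗ π) ≤ LinearMap.ker σ := by
    rintro ⟨⟨b, a⟩, h1, h2⟩ hx
    obtain ⟨w, hw⟩ := (cls_eq_zero _).1 hx
    change g b = _ at hw
    change f a = B.d b at h2
    obtain ⟨v, rfl⟩ := S.surj w
    obtain ⟨a', ha'⟩ := (S.exact (b - B.d v)).1 (by rw [map_sub, hw, g.map_d, sub_self])
    refine (cls_eq_zero _).2 ⟨a', S.inj ?_⟩
    rw [f.map_d, ha', map_sub, d_d, sub_zero]
    exact h2
  let e := ((C.cls k) ∘ₗ π).quotKerEquivOfSurjective hπ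
  refine ⟨(Submodule.liftQ _ σ hker) ∘ₗ e.symm.toLinearMap, fun z b a hb ha => ?_⟩
  have hw : (b, a) ∈ W := ⟨by change g b ∈ _; rw [hb]; exact z.2, ha⟩
  have : C.cls k z = e (Submodule.Quotient.mk ⟨(b, a), hw⟩) := by
    change _ = C.cls k (π ⟨(b, a), hw⟩)
    congr 1
    exact Subtype.ext hb.symm
  rw [this]
  simp [σ]

/-- The connecting homomorphism. -/
def SES.delta : C.Coh k →ₗ[R] A.Coh l := (S.exists_delta h).choose

lemma SES.delta_cls (z : C.Z k) (b : B) (a : A.Z l) (hb : g b = z) (ha : f a = B.d b) :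
    S.delta h (C.cls k z) = A.cls l a := (S.exists_delta h).choose_spec z b a hb ha

include S in
lemma SES.exact_mid (k : ℤ) : Function.Exact (f.mapCoh k) (g.mapCoh k) := by
  intro y
  obtain ⟨x, rfl⟩ := cls_surjective k y
  constructor
  · intro hx
    obtain ⟨w, hw⟩ := (cls_eq_zero _).1 hx
    change g x = _ at hw
    obtain ⟨v, rfl⟩ := S.surj w
    obtain ⟨a, ha⟩ := (S.exact ((x : B) - B.d (B.c (k - 1) v))).1 (by
      rw [map_sub, ← c_d', g.map_c, g.map_d, ← hw, ← g.map_c, x.2.2, sub_self])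
    refine ⟨A.cls k ⟨a, S.inj ?_, S.inj ?_⟩, ?_⟩
    · rw [f.map_d, ha, map_sub, x.2.1, d_d, sub_zero, map_zero]
    · rw [f.map_c, ha, map_sub, x.2.2, ← c_d', c_self]
    · rw [Hom.mapCoh_cls, ← sub_eq_zero, ← map_sub, cls_eq_zero]
      refine ⟨-B.c (k - 1) v, ?_⟩
      rw [map_neg, AddSubgroupClass.coe_sub, Hom.coe_mapZ, ha]
      abel
  · rintro ⟨y, hy⟩
    obtain ⟨a, rfl⟩ := cls_surjective k y
    rw [← hy, Hom.mapCoh_cls, Hom.mapCoh_cls, cls_eq_zero]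
    exact ⟨0, by simp [S.comp_zero]⟩

lemma SES.exact_right : Function.Exact (g.mapCoh k) (S.delta h) := by
  intro y
  obtain ⟨z, rfl⟩ := cls_surjective k y
  constructor
  · intro hx
    obtain ⟨b, hb⟩ := S.surj (z : C)
    have hgz : g (B.c k b) = z := by rw [g.map_c, hb, z.2.2]
    obtain ⟨a, ha⟩ := (S.exact (B.d (B.c k b))).1 (by rw [g.map_d, hgz, z.2.1])
    have haz : a ∈ A.Z l := ⟨S.inj (by rw [f.map_d, ha, d_d, map_zero]),
      S.inj (by rw [f.map_c, ha, ← h, c_d, c_self])⟩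
    rw [S.delta_cls h z _ ⟨a, haz⟩ hgz ha] at hx
    obtain ⟨w, hw⟩ := (cls_eq_zero _).1 hx
    refine ⟨B.cls k ⟨B.c k (B.c k b - f w), ?_, B.c_self _ _⟩, ?_⟩
    · change a = _ at hw
      rw [d_c, map_sub, ← ha, ← f.map_d, hw, sub_self, map_zero]
    · rw [Hom.mapCoh_cls]
      congr 1
      refine Subtype.ext ?_
      change g (B.c k (B.c k b - f w)) = z
      rw [map_sub, map_sub, c_self, ← f.map_c, S.comp_zero, sub_zero, hgz]
  · rintro ⟨y, hy⟩
    obtain ⟨b, rfl⟩ := cls_surjective k y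
    rw [← hy, Hom.mapCoh_cls, S.delta_cls h _ b 0 rfl (by simp [b.2.1]), map_zero]

lemma SES.exact_left : Function.Exact (S.delta h) (f.mapCoh l) := by
  intro y
  obtain ⟨a, rfl⟩ := cls_surjective l y
  constructor
  · intro hx
    obtain ⟨b, hb⟩ := (cls_eq_zero _).1 hx
    change f a = _ at hb
    have hb' : f a = B.d (B.c k b) := by
      rw [d_c, ← hb, ← f.map_c, h, a.2.2]
    refine ⟨C.cls k ⟨g (B.c k b), by rw [← g.map_d, ← hb', S.comp_zero],
      by rw [← g.map_c, c_self]⟩, ?_⟩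
    exact S.delta_cls h _ _ _ rfl hb'
  · rintro ⟨y, hy⟩
    obtain ⟨z, rfl⟩ := cls_surjective k y
    obtain ⟨b, hb⟩ := S.surj (z : C)
    have hgz : g (B.c k b) = z := by rw [g.map_c, hb, z.2.2]
    obtain ⟨a', ha⟩ := (S.exact (B.d (B.c k b))).1 (by rw [g.map_d, hgz, z.2.1])
    have haz : a' ∈ A.Z l := ⟨S.inj (by rw [f.map_d, ha, d_d, map_zero]),
      S.inj (by rw [f.map_c, ha, ← h, c_d, c_self])⟩
    rw [S.delta_cls h z _ ⟨a', haz⟩ hgz ha] at hy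
    rw [← hy, Hom.mapCoh_cls, cls_eq_zero]
    exact ⟨_, ha⟩

end LES

end DiffModule

/-! ### The two-term localization complex -/

section Localization

variable {R}

/-- The localization of a module at the powers of `x`. -/
abbrev LocAway (x : R) (A : Type u) [AddCommGroup A] [Module R A] : Type u :=
  LocalizedModule (Submonoid.powers x) A

namespace LocAway

variable (x : R) {A B C : Type u} [AddCommGroup A] [Module R A] [AddCommGroup B] [Module R B]
  [AddCommGroup C] [Module R C]

/-- The localization map. -/
def ι : A →ₗ[R] LocAway x A := LocalizedModule.mkLinearMap (Submonoid.powers x) A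

instance : IsLocalizedModule (Submonoid.powers x) (ι x : A →ₗ[R] LocAway x A) :=
  inferInstanceAs (IsLocalizedModule (Submonoid.powers x)
    (LocalizedModule.mkLinearMap (Submonoid.powers x) A))

/-- Functoriality of the localization. -/
def map (f : A →ₗ[R] B) : LocAway x A →ₗ[R] LocAway x B :=
  IsLocalizedModule.map (Submonoid.powers x) (ι x) (ι x) f

lemma map_ι (f : A →ₗ[R] B) (a : A) : map x f (ι x a) = ι x (f a) :=
  IsLocalizedModule.map_apply _ _ _ _ _

@[simp] lemma map_zero_left : map x (0 : A →ₗ[R] B) = 0 := by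
  simp [map]

lemma map_map (f : A →ₗ[R] B) (g : B →ₗ[R] C) (y : LocAway x A) :
    map x g (map x f y) = map x (g ∘ₗ f) y := by
  rw [map, map, map, IsLocalizedModule.map_comp' _ (ι x) (ι x) (ι x)]
  rfl

lemma ι_eq_zero {a : A} : ι x a = 0 ↔ ∃ n : ℕ, x ^ n • a = 0 := by
  rw [IsLocalizedModule.eq_zero_iff (Submonoid.powers x)]
  constructor
  · rintro ⟨⟨_, n, rfl⟩, h⟩
    exact ⟨n, h⟩
  · rintro ⟨n, h⟩
    exact ⟨⟨_, n, rfl⟩, h⟩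

lemma exists_pow_smul (y : LocAway x A) : ∃ (n : ℕ) (a : A), x ^ n • y = ι x a := by
  obtain ⟨⟨a, ⟨_, n, rfl⟩⟩, h⟩ := IsLocalizedModule.surj (Submonoid.powers x) (ι x) y
  exact ⟨n, a, h⟩

variable {x} in
lemma eq_zero_of_pow_smul {n : ℕ} {y : LocAway x A} (h : x ^ n • y = 0) : y = 0 :=
  IsLocalizedModule.smul_injective (ι x) (⟨x ^ n, n, rfl⟩ : Submonoid.powers x)
    (by simpa [Submonoid.smul_def] using h)

lemma exists_div (n : ℕ) (y : LocAway x A) : ∃ z : LocAway x A, x ^ n • z = y := by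
  obtain ⟨m, a, h⟩ := exists_pow_smul x y
  refine ⟨IsLocalizedModule.mk' (ι x) a (⟨x ^ (n + m), n + m, rfl⟩ : Submonoid.powers x), ?_⟩
  rw [← sub_eq_zero]
  refine eq_zero_of_pow_smul (n := m) ?_
  rw [smul_sub, h, smul_smul, ← pow_add, add_comm m n, sub_eq_zero]
  exact IsLocalizedModule.mk'_cancel' (ι x) a (⟨x ^ (n + m), n + m, rfl⟩ : Submonoid.powers x)

lemma smul_bijective : Function.Bijective (fun y : LocAway x A => x • y) := by
  constructor
  · intro y z h
    refine sub_eq_zero.1 (eq_zero_of_pow_smul (x := x) (n := 1) ?_)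
    simpa [smul_sub, sub_eq_zero] using h
  · intro y
    obtain ⟨z, hz⟩ := exists_div x 1 y
    exact ⟨z, by simpa using hz⟩

lemma map_injective {f : A →ₗ[R] B} (h : Function.Injective f) : Function.Injective (map x f) :=
  IsLocalizedModule.map_injective _ _ _ _ h

lemma map_surjective {f : A →ₗ[R] B} (h : Function.Surjective f) :
    Function.Surjective (map x f) :=
  IsLocalizedModule.map_surjective _ _ _ _ h

lemma map_exact {f : A →ₗ[R] B} {g : B →ₗ[R] C} (h : Function.Exact f g) :
    Function.Exact (map x f) (map x g) :=
  IsLocalizedModule.map_exact _ _ _ _ _ _ h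

end LocAway

end Localization

namespace DiffModule

variable {R}

open LocAway

variable (x : R) (A : DiffModule R) {B C : DiffModule R}

lemma map_c_sum (F : Finset ℤ) (hF : ∀ a : A, ∑ k ∈ F, A.c k a = a) (y : LocAway x A) :
    ∑ k ∈ F, LocAway.map x (A.c k) y = y := by
  obtain ⟨n, a, h⟩ := exists_pow_smul x y
  refine sub_eq_zero.1 (eq_zero_of_pow_smul (n := n) ?_)
  rw [smul_sub, Finset.smul_sum, sub_eq_zero, h]
  conv_rhs => rw [← hF a, map_sum]
  exact Finset.sum_congr rfl fun k _ => by rw [← map_smul, h, LocAway.map_ι]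

lemma sum_image_shift {M : Type*} [AddCommMonoid M] (F : Finset ℤ) (t : ℤ) (g : ℤ → M) :
    ∑ k ∈ F.image (fun l => l + t), g (k - t) = ∑ k ∈ F, g k := by
  rw [Finset.sum_image (fun a _ b _ h => by simpa using h)]
  simp

/-- The localization of a complex, placed one degree higher and with the opposite differential. -/
@[reducible] def loc : DiffModule R where
  carrier := LocAway x A
  d := -LocAway.map x A.d
  c k := LocAway.map x (A.c (k - 1))
  d_d y := by
    have : A.d ∘ₗ A.d = 0 := LinearMap.ext A.d_d
    rw [LinearMap.neg_apply, LinearMap.neg_apply, map_neg, LocAway.map_map, this]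
    simp
  c_c k l y := by
    rw [LocAway.map_map]
    split_ifs with h
    · subst h
      congr 2
      exact LinearMap.ext (A.c_self _)
    · have : A.c (k - 1) ∘ₗ A.c (l - 1) = 0 :=
        LinearMap.ext fun a => A.c_of_ne (by simpa using h) a
      rw [this]
      simp
  c_d k y := by
    have : A.c k ∘ₗ A.d = A.d ∘ₗ A.c (k - 1) := LinearMap.ext fun a => by simp [c_d']
    rw [LinearMap.neg_apply, LinearMap.neg_apply, map_neg, add_sub_cancel_right, LocAway.map_map,
      LocAway.map_map, this]
  c_sum := by
    obtain ⟨F, hF⟩ := A.c_sum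
    refine ⟨F.image (fun l => l + 1), fun y => ?_⟩
    rw [sum_image_shift F 1 (fun k => LocAway.map x (A.c k) y)]
    exact A.map_c_sum x F hF y

/-- The fibre of the localization map `A → A_x`. -/
@[reducible] def tel : DiffModule R where
  carrier := A × LocAway x A
  d := LinearMap.prod (A.d ∘ₗ LinearMap.fst _ _ _)
    (ι x ∘ₗ LinearMap.fst _ _ _ - LocAway.map x A.d ∘ₗ LinearMap.snd _ _ _)
  c k := LinearMap.prodMap (A.c k) (LocAway.map x (A.c (k - 1)))
  d_d p := by
    have : A.d ∘ₗ A.d = 0 := LinearMap.ext A.d_d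
    refine Prod.ext (A.d_d _) ?_
    change ι x (A.d p.1) - LocAway.map x A.d (ι x p.1 - LocAway.map x A.d p.2) = 0
    rw [map_sub, LocAway.map_ι, LocAway.map_map, this]
    simp
  c_c k l p := by
    split_ifs with h
    · subst h
      exact Prod.ext (A.c_self _ _) ((loc x A).c_self _ _)
    · exact Prod.ext (A.c_of_ne h _) ((loc x A).c_of_ne h _)
  c_d k p := by
    refine Prod.ext (A.c_d _ _) ?_
    have : A.c k ∘ₗ A.d = A.d ∘ₗ A.c (k - 1) := LinearMap.ext fun a => by simp [c_d']
    change LocAway.map x (A.c (k + 1 - 1)) (ι x p.1 - LocAway.map x A.d p.2) =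
      ι x (A.c k p.1) - LocAway.map x A.d (LocAway.map x (A.c (k - 1)) p.2)
    rw [add_sub_cancel_right, map_sub, LocAway.map_ι, LocAway.map_map, LocAway.map_map, this]
  c_sum := by
    obtain ⟨F, hF⟩ := A.c_sum
    obtain ⟨G, hG⟩ := (loc x A).c_sum
    refine ⟨F ∪ G, fun p => Prod.ext ?_ ?_⟩
    · rw [Prod.fst_sum]
      exact A.sum_of_subset Finset.subset_union_left hF p.1
    · rw [Prod.snd_sum]
      exact (loc x A).sum_of_subset Finset.subset_union_right hG p.2

variable {A}

@[simp] lemma loc_d (y : loc x A) : (loc x A).d y = -LocAway.map x A.d y := rfl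

/-- The projection `tel x A → A`. -/
def telFst : Hom (tel x A) A := ⟨LinearMap.fst R A (LocAway x A), fun _ => rfl, fun _ _ => rfl⟩

/-- The inclusion of the localization. -/
def telInr : Hom (loc x A) (tel x A) :=
  ⟨LinearMap.inr R A (LocAway x A), fun y => Prod.ext (by change (0 : A) = A.d 0; simp) (by
    change -LocAway.map x A.d y = ι x (0 : A) - LocAway.map x A.d y
    simp), fun k y => Prod.ext (by change (0 : A) = A.c k 0; simp) rfl⟩

lemma telSES : SES (telInr x) (telFst x : Hom (tel x A) A) where
  inj y z h := (Prod.ext_iff.1 h).2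
  exact p := ⟨fun h => ⟨p.2, Prod.ext h.symm rfl⟩, by rintro ⟨y, rfl⟩; rfl⟩
  surj a := ⟨(a, 0), rfl⟩

/-- Functoriality of `tel`. -/
def telMap (f : Hom A B) : Hom (tel x A) (tel x B) where
  toLin := LinearMap.prodMap f.toLin (LocAway.map x f.toLin)
  map_d p := by
    refine Prod.ext (f.map_d _) ?_
    have : f.toLin ∘ₗ A.d = B.d ∘ₗ f.toLin := LinearMap.ext fun a => f.map_d a
    change LocAway.map x f.toLin (ι x p.1 - LocAway.map x A.d p.2) =
      ι x (f.toLin p.1) - LocAway.map x B.d (LocAway.map x f.toLin p.2)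
    rw [map_sub, LocAway.map_ι, LocAway.map_map, LocAway.map_map, this]
  map_c k p := by
    refine Prod.ext (f.map_c _ _) ?_
    have : f.toLin ∘ₗ A.c (k - 1) = B.c (k - 1) ∘ₗ f.toLin :=
      LinearMap.ext fun a => f.map_c _ a
    change LocAway.map x f.toLin (LocAway.map x (A.c (k - 1)) p.2) =
      LocAway.map x (B.c (k - 1)) (LocAway.map x f.toLin p.2)
    rw [LocAway.map_map, LocAway.map_map, this]

lemma SES.tel {f : Hom A B} {g : Hom B C} (S : SES f g) : SES (telMap x f) (telMap x g) where
  inj := Function.Injective.prodMap S.inj (LocAway.map_injective x S.inj)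
  exact p := by
    have h : Function.Exact f.toLin g.toLin := S.exact
    have h2 := LocAway.map_exact x h
    constructor
    · intro hp
      obtain ⟨a, ha⟩ := (S.exact p.1).1 (Prod.ext_iff.1 hp).1
      obtain ⟨b, hb⟩ := (h2 p.2).1 (Prod.ext_iff.1 hp).2
      exact ⟨(a, b), Prod.ext ha hb⟩
    · rintro ⟨q, rfl⟩
      exact Prod.ext (S.comp_zero _) ((h2 _).2 ⟨_, rfl⟩)
  surj := Function.Surjective.prodMap S.surj (LocAway.map_surjective x S.surj)

lemma Ex.loc {k l : ℤ} (h : k + 1 = l) (hA : A.Ex k) : (loc x A).Ex l := by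
  subst h
  intro y hy hk
  obtain ⟨n, a, hna⟩ := exists_pow_smul x y
  have hk' : LocAway.map x (A.c k) y = y := by
    have : LocAway.map x (A.c (k + 1 - 1)) y = y := hk
    rwa [add_sub_cancel_right] at this
  have h1 : ι x (A.c k a) = x ^ n • y := by
    rw [← LocAway.map_ι, ← hna, map_smul, hk']
  have h2 : ι x (A.d (A.c k a)) = 0 := by
    rw [← LocAway.map_ι, h1, map_smul, ← neg_neg (LocAway.map x A.d y)]
    rw [show -LocAway.map x A.d y = 0 from hy, neg_zero, smul_zero]
  obtain ⟨m, hm⟩ := (ι_eq_zero x).1 h2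
  obtain ⟨w, hw⟩ := hA (x ^ m • A.c k a) (by rw [map_smul, hm]) (by rw [map_smul, c_self])
  obtain ⟨z, hz⟩ := LocAway.exists_div x (m + n) (ι x w)
  refine ⟨-z, ?_⟩
  rw [loc_d]
  refine sub_eq_zero.1 (eq_zero_of_pow_smul (x := x) (n := m + n) ?_)
  rw [map_neg, neg_neg, smul_sub, ← map_smul, hz, LocAway.map_ι, ← hw, map_smul, h1, smul_smul,
    pow_add, sub_self]

lemma Acyclic.loc (hA : A.Acyclic) : (loc x A).Acyclic :=
  acyclic_of_ex fun k => Ex.loc x (sub_add_cancel k 1) (hA.ex _)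

lemma Acyclic.tel (hA : A.Acyclic) : (tel x A).Acyclic :=
  acyclic_of_ex fun k => (telSES x).ex_mid ((hA.loc x).ex k) (hA.ex k)

/-- If `x` acts bijectively on a complex then `tel x` of it is acyclic. -/
lemma tel_acyclic_of_bijective (h : Function.Bijective (fun a : A => x • a)) :
    (DiffModule.tel x A).Acyclic := by
  have hn : ∀ n : ℕ, Function.Bijective (fun a : A => x ^ n • a) := by
    intro n
    induction n with
    | zero => simpa using! (Function.bijective_id (α := A))
    | succ n ih =>
      have := ih.comp h
      convert this using 2 with a
      simp [pow_succ, smul_smul]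
  have hinj : Function.Injective (ι x : A →ₗ[R] LocAway x A) := by
    rw [← LinearMap.ker_eq_bot, LinearMap.ker_eq_bot']
    intro a ha
    obtain ⟨n, hna⟩ := (ι_eq_zero x).1 ha
    exact (hn n).1 (by simpa using hna)
  rintro ⟨a, y⟩ hp
  obtain ⟨n, b, hb⟩ := exists_pow_smul x y
  obtain ⟨c, rfl⟩ := (hn n).2 b
  have hc : y = ι x c := by
    refine sub_eq_zero.1 (eq_zero_of_pow_smul (x := x) (n := n) ?_)
    rw [smul_sub, hb, map_smul, sub_self]
  subst hc
  have h2 : ι x a - LocAway.map x A.d (ι x c) = 0 := (Prod.ext_iff.1 hp).2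
  rw [LocAway.map_ι, ← map_sub, map_eq_zero_iff _ hinj, sub_eq_zero] at h2
  exact ⟨(c, 0), Prod.ext h2 (by simp)⟩

lemma tel_bijective {y : R} (h : Function.Bijective (fun a : A => y • a)) :
    Function.Bijective (fun a : tel x A => y • a) := by
  refine Function.Bijective.prodMap (g := fun b : LocAway x A => y • b) h ?_
  have h1 := LocAway.map_injective x (f := LinearMap.lsmul R A y) h.1
  have h2 := LocAway.map_surjective x (f := LinearMap.lsmul R A y) h.2
  have : ∀ b, LocAway.map x (LinearMap.lsmul R A y) b = y • b := by
    intro b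
    obtain ⟨n, a, ha⟩ := exists_pow_smul x b
    refine sub_eq_zero.1 (eq_zero_of_pow_smul (x := x) (n := n) ?_)
    rw [smul_sub, ← map_smul, ha, LocAway.map_ι, smul_comm, ha]
    simp
  constructor
  · intro a b hab
    exact h1 (by simpa [this] using hab)
  · intro b
    obtain ⟨a, ha⟩ := h2 b
    exact ⟨a, by simpa [this] using ha⟩

/-! #### Torsion cohomology -/

/-- Every cohomology class is killed by a power of `x`. -/
def Tors (x : R) (A : DiffModule R) : Prop :=
  ∀ a : A, A.d a = 0 → ∃ (n : ℕ) (b : A), x ^ n • a = A.d b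

lemma Tors.acyclic_loc {x : R} (h : Tors x A) : (loc x A).Acyclic := by
  intro y hy
  have hy' : LocAway.map x A.d y = 0 := neg_eq_zero.1 hy
  obtain ⟨n, a, hna⟩ := exists_pow_smul x y
  have h2 : ι x (A.d a) = 0 := by
    rw [← LocAway.map_ι, ← hna, map_smul, hy', smul_zero]
  obtain ⟨m, hm⟩ := (ι_eq_zero x).1 h2
  obtain ⟨r, b, hb⟩ := h (x ^ m • a) (by rw [map_smul, hm])
  obtain ⟨z, hz⟩ := LocAway.exists_div x (r + m + n) (ι x b)
  refine ⟨-z, ?_⟩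
  refine sub_eq_zero.1 (eq_zero_of_pow_smul (x := x) (n := r + m + n) ?_)
  rw [loc_d, map_neg, neg_neg, smul_sub, ← map_smul, hz, LocAway.map_ι, ← hb, pow_add, mul_smul,
    hna, pow_add, mul_smul, map_smul, map_smul, sub_self]

lemma Tors.qi {x : R} (h : Tors x A) : (telFst x : Hom (DiffModule.tel x A) A).QI :=
  (telSES x).qi_right h.acyclic_loc

lemma tors_tel_self : Tors x (tel x A) := by
  rintro ⟨a, y⟩ hp
  have h2 : ι x a = LocAway.map x A.d y := sub_eq_zero.1 (Prod.ext_iff.1 hp).2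
  obtain ⟨n, b, hb⟩ := exists_pow_smul x y
  have h3 : ι x (x ^ n • a - A.d b) = 0 := by
    rw [map_sub, map_smul, h2, ← LocAway.map_ι, ← hb, map_smul, sub_self]
  obtain ⟨m, hm⟩ := (ι_eq_zero x).1 h3
  refine ⟨m + n, (x ^ m • b, 0), Prod.ext ?_ ?_⟩
  · rw [smul_sub, sub_eq_zero] at hm
    change x ^ (m + n) • a = A.d (x ^ m • b)
    rw [pow_add, mul_smul, hm, map_smul]
  · change x ^ (m + n) • y = ι x (x ^ m • b) - LocAway.map x A.d 0
    rw [map_zero, sub_zero, pow_add, mul_smul, hb, map_smul]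

lemma Tors.tel {x : R} (h : Tors x A) (y : R) : Tors x (tel y A) := by
  rintro ⟨a, b⟩ hp
  have h1 : A.d a = 0 := (Prod.ext_iff.1 hp).1
  have h2 : ι y a = LocAway.map y A.d b := sub_eq_zero.1 (Prod.ext_iff.1 hp).2
  obtain ⟨n, a', ha'⟩ := h a h1
  set b' : LocAway y A := x ^ n • b - ι y a' with hb'
  have h3 : LocAway.map y A.d b' = 0 := by
    rw [hb', map_sub, map_smul, ← h2, LocAway.map_ι, ← ha', map_smul, sub_self]
  obtain ⟨m, e, he⟩ := exists_pow_smul y b'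
  have h4 : ι y (A.d e) = 0 := by rw [← LocAway.map_ι, ← he, map_smul, h3, smul_zero]
  obtain ⟨r, hr⟩ := (ι_eq_zero y).1 h4
  obtain ⟨N, g, hg⟩ := h (y ^ r • e) (by rw [map_smul, hr])
  obtain ⟨z, hz⟩ := LocAway.exists_div y (r + m) (ι y g)
  have h5 : x ^ N • b' = LocAway.map y A.d z := by
    refine sub_eq_zero.1 (eq_zero_of_pow_smul (x := y) (n := r + m) ?_)
    rw [smul_sub, ← map_smul, hz, LocAway.map_ι, ← hg, smul_comm, pow_add, mul_smul, he,
      map_smul, map_smul, sub_self]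
  refine ⟨N + n, (x ^ N • a', -z), Prod.ext ?_ ?_⟩
  · change x ^ (N + n) • a = A.d (x ^ N • a')
    rw [pow_add, mul_smul, ha', map_smul]
  · change x ^ (N + n) • b = ι y (x ^ N • a') - LocAway.map y A.d (-z)
    rw [map_neg, sub_neg_eq_add, ← h5, hb', map_smul, smul_sub, pow_add, mul_smul]
    abel

/-! #### Iteration over a list of elements -/

/-- The Čech-type complex of `A` with respect to a list of elements. -/
def cech : List R → DiffModule R → DiffModule R
  | [], A => A
  | x :: xs, A => cech xs (tel x A)

lemma cech_append (xs ys : List R) (A : DiffModule R) :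
    cech (xs ++ ys) A = cech ys (cech xs A) := by
  induction xs generalizing A with
  | nil => rfl
  | cons x xs ih => exact ih _

/-- The augmentation `cech xs A → A`. -/
def cechFst : (xs : List R) → (A : DiffModule R) → Hom (cech xs A) A
  | [], _ => Hom.id
  | x :: xs, A => (telFst x).comp (cechFst xs (tel x A))

/-- Functoriality of `cech`. -/
def cechMap : (xs : List R) → {A B : DiffModule R} → Hom A B → Hom (cech xs A) (cech xs B)
  | [], _, _, f => f
  | x :: xs, _, _, f => cechMap xs (telMap x f)

lemma telMap_comp (g : Hom B C) (f : Hom A B) :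
    telMap x (g.comp f) = (telMap x g).comp (telMap x f) := by
  refine Hom.ext (LinearMap.ext fun p => Prod.ext rfl ?_)
  exact (LocAway.map_map x f.toLin g.toLin p.2).symm

lemma cechMap_comp (xs : List R) {A B C : DiffModule R} (g : Hom B C) (f : Hom A B) :
    cechMap xs (g.comp f) = (cechMap xs g).comp (cechMap xs f) := by
  induction xs generalizing A B C with
  | nil => rfl
  | cons x xs ih => exact (congrArg _ (telMap_comp x g f)).trans (ih _ _)

lemma cechFst_naturality (xs : List R) {A B : DiffModule R} (f : Hom A B) :
    (cechFst xs B).comp (cechMap xs f) = f.comp (cechFst xs A) := by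
  induction xs generalizing A B with
  | nil => rfl
  | cons x xs ih =>
    have h := ih (telMap x f)
    refine Hom.ext (LinearMap.ext fun p => ?_)
    have h' := congrArg (fun g : Hom _ _ => telFst x (g p)) h
    exact h'

lemma SES.cech (xs : List R) {A B C : DiffModule R} {f : Hom A B} {g : Hom B C} (S : SES f g) :
    SES (cechMap xs f) (cechMap xs g) := by
  induction xs generalizing A B C with
  | nil => exact S
  | cons x xs ih => exact ih (S.tel x)

lemma Acyclic.cech (xs : List R) {A : DiffModule R} (hA : A.Acyclic) :
    (cech xs A).Acyclic := by
  induction xs generalizing A with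
  | nil => exact hA
  | cons x xs ih => exact ih (hA.tel x)

lemma cech_acyclic_of_bijective {xs : List R} {x : R} (hx : x ∈ xs) {A : DiffModule R}
    (h : Function.Bijective (fun a : A => x • a)) : (DiffModule.cech xs A).Acyclic := by
  induction xs generalizing A with
  | nil => simp at hx
  | cons y xs ih =>
    rcases List.mem_cons.1 hx with rfl | hx
    · exact (tel_acyclic_of_bijective x h).cech xs
    · exact ih hx (tel_bijective y h)

lemma Tors.cech {x : R} (xs : List R) {A : DiffModule R} (h : Tors x A) :
    Tors x (cech xs A) := by
  induction xs generalizing A with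
  | nil => exact h
  | cons y xs ih => exact ih (h.tel y)

lemma tors_cech {x : R} {xs : List R} (hx : x ∈ xs) (A : DiffModule R) :
    Tors x (cech xs A) := by
  induction xs generalizing A with
  | nil => simp at hx
  | cons y xs ih =>
    rcases List.mem_cons.1 hx with rfl | hx
    · exact (tors_tel_self x).cech xs
    · exact ih hx _

lemma cechFst_qi (xs : List R) {A : DiffModule R} (h : ∀ x ∈ xs, Tors x A) :
    (cechFst xs A).QI := by
  induction xs generalizing A with
  | nil =>
    refine fun k => ⟨fun a _ _ ⟨b, hb⟩ => ⟨b, hb⟩, fun b hb hk => ⟨b, hb, hk, 0, ?_⟩⟩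
    change b = b + A.d 0
    simp
  | cons y xs ih =>
    exact fun k => ((h y (by simp)).qi k).comp
      (ih (fun x hx => (h x (by simp [hx])).tel y) k)

lemma Ex.tel {k l : ℤ} (h : k + 1 = l) (hk : A.Ex k) (hl : A.Ex l) : (DiffModule.tel x A).Ex l :=
  (telSES x).ex_mid (Ex.loc x h hk) hl

lemma ex_cech_of_le {k : ℤ} (xs : List R) {A : DiffModule R} (h : ∀ l ≤ k, A.Ex l) :
    ∀ l ≤ k, (cech xs A).Ex l := by
  induction xs generalizing A with
  | nil => exact h
  | cons x xs ih =>
    exact ih fun l hl => Ex.tel x (sub_add_cancel l 1) (h _ (by omega)) (h l hl)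

lemma ex_cech_of_lt {k : ℤ} (xs : List R) {A : DiffModule R} (h : ∀ l, k < l → A.Ex l) :
    ∀ l, k + xs.length < l → (cech xs A).Ex l := by
  induction xs generalizing A k with
  | nil => exact fun l hl => h l (by simpa using hl)
  | cons x xs ih =>
    intro l hl
    refine ih (k := k + 1) (A := DiffModule.tel x A)
      (fun j hj => Ex.tel x (sub_add_cancel j 1) (h _ (by omega)) (h j (by omega))) l ?_
    push_cast [List.length_cons] at hl
    omega

end DiffModule

/-! ### Torsion submodules and injective modules -/

section Torsion

variable {R}

/-- The `I`-power torsion submodule. -/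
def powTorsion (I : Ideal R) (N : Type u) [AddCommGroup N] [Module R N] : Submodule R N where
  carrier := {a | ∃ n : ℕ, ∀ r ∈ I ^ n, r • a = 0}
  zero_mem' := ⟨0, by simp⟩
  add_mem' := by
    rintro a b ⟨n, hn⟩ ⟨m, hm⟩
    refine ⟨n + m, fun r hr => ?_⟩
    rw [smul_add, hn r (Ideal.pow_le_pow_right (Nat.le_add_right n m) hr),
      hm r (Ideal.pow_le_pow_right (Nat.le_add_left m n) hr), add_zero]
  smul_mem' := by
    rintro c a ⟨n, hn⟩
    exact ⟨n, fun r hr => by rw [smul_comm, hn r hr, smul_zero]⟩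

variable {N N' : Type u} [AddCommGroup N'] [Module R N'] [AddCommGroup N] [Module R N]

/-- Functoriality of the torsion submodule. -/
def powTorsionMap (I : Ideal R) (f : N →ₗ[R] N') : powTorsion I N →ₗ[R] powTorsion I N' :=
  f.restrict (by
    rintro a ⟨n, hn⟩
    exact ⟨n, fun r hr => by rw [← map_smul, hn r hr, map_zero]⟩)

lemma mem_powTorsion_span {xs : List R} {a : N} :
    a ∈ powTorsion (Ideal.span {x : R | x ∈ xs}) N ↔ ∀ x ∈ xs, ∃ n : ℕ, x ^ n • a = 0 := by
  constructor
  · rintro ⟨n, hn⟩ x hx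
    have hx' : x ∈ Ideal.span {x : R | x ∈ xs} := Ideal.subset_span hx
    exact ⟨n, hn _ (Ideal.pow_mem_pow hx' n)⟩
  · intro h
    have h1 : Ideal.span {x : R | x ∈ xs} ≤ (Ideal.torsionOf R N a).radical := by
      rw [Ideal.span_le]
      intro x hx
      obtain ⟨n, hn⟩ := h x hx
      exact ⟨n, hn⟩
    have h2 : (Ideal.span {x : R | x ∈ xs}).FG := by
      classical
      exact ⟨xs.toFinset, by simp⟩
    obtain ⟨n, hn⟩ := Ideal.exists_pow_le_of_le_radical_of_fg h1 h2
    exact ⟨n, fun r hr => hn hr⟩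

/-- The torsion submodule with respect to one element. -/
abbrev elemTorsion (x : R) (N : Type u) [AddCommGroup N] [Module R N] : Submodule R N :=
  powTorsion (Ideal.span {y | y ∈ [x]}) N

lemma mem_elemTorsion {x : R} {a : N} : a ∈ elemTorsion x N ↔ ∃ n : ℕ, x ^ n • a = 0 := by
  rw [elemTorsion, mem_powTorsion_span]
  simp

lemma exists_pow_annihilates (x : R) {P : Type u} [AddCommGroup P] [Module R P]
    [Module.Finite R P] (h : ∀ a : P, ∃ n : ℕ, x ^ n • a = 0) :
    ∃ n : ℕ, ∀ a : P, x ^ n • a = 0 := by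
  obtain ⟨s, hs⟩ := Module.Finite.fg_top (R := R) (M := P)
  choose n hn using h
  refine ⟨s.sup n, fun a => ?_⟩
  have ha : a ∈ Submodule.span R (s : Set P) := by rw [hs]; trivial
  induction ha using Submodule.span_induction with
  | mem b hb =>
    obtain ⟨k, hk⟩ := Nat.exists_eq_add_of_le (Finset.le_sup (f := n) hb)
    rw [hk, add_comm, pow_add, mul_smul, hn, smul_zero]
  | zero => simp
  | add b c _ _ hb hc => rw [smul_add, hb, hc, add_zero]
  | smul r b _ hb => rw [smul_comm, hb, smul_zero]

variable [IsNoetherianRing R]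

lemma injective_elemTorsion (x : R) (hJ : Module.Injective R N) :
    Module.Injective R (elemTorsion x N) := by
  refine Module.Baer.injective fun I f => ?_
  obtain ⟨n, hn⟩ : ∃ n : ℕ, ∀ a : LinearMap.range f, x ^ n • a = 0 := by
    refine exists_pow_annihilates (P := LinearMap.range f) x ?_
    rintro ⟨⟨a, ha⟩, -⟩
    obtain ⟨n, hn⟩ := mem_elemTorsion.1 ha
    exact ⟨n, Subtype.ext (Subtype.ext hn)⟩
  obtain ⟨k, hk⟩ := Ideal.exists_pow_inf_eq_pow_smul (Ideal.span {x}) (M := R) I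
  have hk := hk (n + k) (Nat.le_add_left k n)
  set φ : I →ₗ[R] R ⧸ (Ideal.span {x} ^ (n + k)) :=
    (Ideal.span {x} ^ (n + k)).mkQ ∘ₗ I.subtype with hφ
  have hker : LinearMap.ker φ ≤ LinearMap.ker f := by
    rintro ⟨a, ha⟩ hak
    have h1 : a ∈ Ideal.span {x} ^ (n + k) := (Submodule.Quotient.mk_eq_zero _).1 hak
    have h2 : a ∈ Ideal.span {x} ^ (n + k - k) • (Ideal.span {x} ^ k • (⊤ : Submodule R R) ⊓ I) := by
      rw [← hk]
      exact ⟨by simpa using h1, ha⟩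
    have h3 : a ∈ Ideal.span {x ^ n} * I := by
      rw [Nat.add_sub_cancel, Ideal.span_singleton_pow] at h2
      exact Submodule.smul_mono le_rfl inf_le_right h2
    obtain ⟨b, hb, rfl⟩ := Ideal.mem_span_singleton_mul.1 h3
    have h5 : x ^ n • f ⟨b, hb⟩ = 0 := congrArg Subtype.val (hn ⟨f ⟨b, hb⟩, ⟨_, rfl⟩⟩)
    rw [← map_smul] at h5
    exact h5
  obtain ⟨h, hh⟩ := hJ.out ((LinearMap.ker φ).liftQ φ le_rfl)
    (LinearMap.ker_eq_bot.1 (Submodule.ker_liftQ_eq_bot _ _ _ le_rfl))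
    ((elemTorsion x N).subtype ∘ₗ (LinearMap.ker φ).liftQ f hker)
  refine ⟨(h ∘ₗ (Ideal.span {x} ^ (n + k)).mkQ).codRestrict _ fun r => ?_, fun r hr => ?_⟩
  · refine mem_elemTorsion.2 ⟨n + k, ?_⟩
    rw [← map_smul, LinearMap.comp_apply, Submodule.mkQ_apply, (Submodule.Quotient.mk_eq_zero _).2,
      map_zero]
    rw [Ideal.span_singleton_pow]
    exact Ideal.mul_mem_right _ _ (Ideal.mem_span_singleton_self _)
  · refine Subtype.ext ?_
    exact hh (Submodule.Quotient.mk ⟨r, hr⟩)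

lemma loc_surjective_of_injective (x : R) (hJ : Module.Injective R N) :
    Function.Surjective (LocAway.ι x : N →ₗ[R] LocAway x N) := by
  intro y
  obtain ⟨n, a, ha⟩ := LocAway.exists_pow_smul x y
  obtain ⟨k, hk⟩ : ∃ k : ℕ, ∀ r : elemTorsion x R, x ^ k • r = 0 := by
    refine exists_pow_annihilates (P := elemTorsion x R) x ?_
    rintro ⟨r, hr⟩
    obtain ⟨n, hn⟩ := mem_elemTorsion.1 hr
    exact ⟨n, Subtype.ext hn⟩
  have hker : LinearMap.ker (LinearMap.toSpanSingleton R R (x ^ (n + k))) ≤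
      LinearMap.ker (LinearMap.toSpanSingleton R N (x ^ k • a)) := by
    intro r hr
    have hr' : x ^ (n + k) • r = 0 := by
      rw [smul_eq_mul, mul_comm]
      exact hr
    have h2 := congrArg Subtype.val (hk ⟨r, mem_elemTorsion.2 ⟨_, hr'⟩⟩)
    have h3 : x ^ k * r = 0 := h2
    rw [LinearMap.mem_ker, LinearMap.toSpanSingleton_apply, smul_smul, mul_comm, h3, zero_smul]
  obtain ⟨h, hh⟩ := hJ.out
    ((LinearMap.ker (LinearMap.toSpanSingleton R R (x ^ (n + k)))).liftQ _ le_rfl)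
    (LinearMap.ker_eq_bot.1 (Submodule.ker_liftQ_eq_bot _ _ _ le_rfl))
    ((LinearMap.ker (LinearMap.toSpanSingleton R R (x ^ (n + k)))).liftQ
      (LinearMap.toSpanSingleton R N (x ^ k • a)) hker)
  have h1 : h (x ^ (n + k)) = x ^ k • a := by
    have h2 : h (LinearMap.toSpanSingleton R R (x ^ (n + k)) 1) =
      LinearMap.toSpanSingleton R N (x ^ k • a) 1 := hh (Submodule.Quotient.mk 1)
    simpa using h2
  refine ⟨h 1, sub_eq_zero.1 (LocAway.eq_zero_of_pow_smul (x := x) (n := n + k) ?_)⟩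
  rw [smul_sub, ← map_smul, ← map_smul, smul_eq_mul, mul_one, h1, map_smul, ← ha, smul_smul,
    ← pow_add, add_comm k n, sub_self]

omit [IsNoetherianRing R] in
lemma nonempty_equiv_coker {A B D X Y : Type u} [AddCommGroup A] [Module R A] [AddCommGroup B]
    [Module R B] [AddCommGroup D] [Module R D] [AddCommGroup X] [Module R X] [AddCommGroup Y]
    [Module R Y] (e : A ≃ₗ[R] X) (e' : B ≃ₗ[R] Y) {g : A →ₗ[R] B} {g' : X →ₗ[R] Y}
    (h : ∀ a, e' (g a) = g' (e a)) {δ : B →ₗ[R] D} (hδ : Function.Surjective δ)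
    (hex : Function.Exact g δ) : Nonempty (D ≃ₗ[R] Y ⧸ LinearMap.range g') := by
  refine ⟨(δ.quotKerEquivOfSurjective hδ).symm.trans
    (Submodule.Quotient.equiv _ _ e' ?_)⟩
  rw [LinearMap.exact_iff.1 hex]
  ext y
  constructor
  · rintro ⟨_, ⟨a, rfl⟩, rfl⟩
    exact ⟨e a, (h a).symm⟩
  · rintro ⟨x, rfl⟩
    refine ⟨g (e.symm x), ⟨_, rfl⟩, ?_⟩
    exact (h _).trans (by rw [e.apply_symm_apply])

end Torsion

namespace DiffModule

variable {R}

/-! ### Subcomplexes and quotients -/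

section SubQuot

variable (A : DiffModule R) (S : Submodule R A) (hd : ∀ a ∈ S, A.d a ∈ S)
  (hc : ∀ k, ∀ a ∈ S, A.c k a ∈ S)

/-- A subcomplex. -/
@[reducible] def sub : DiffModule R where
  carrier := S
  d := A.d.restrict hd
  c k := (A.c k).restrict (hc k)
  d_d a := Subtype.ext (A.d_d a)
  c_c k l a := by
    split_ifs with h
    · subst h
      exact Subtype.ext (A.c_self _ _)
    · exact Subtype.ext (A.c_of_ne h _)
  c_d k a := Subtype.ext (A.c_d k a)
  c_sum := by
    obtain ⟨F, hF⟩ := A.c_sum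
    refine ⟨F, fun a => Subtype.ext ?_⟩
    rw [AddSubmonoidClass.coe_finsetSum]
    exact hF a

/-- The quotient by a subcomplex. -/
@[reducible] def quot : DiffModule R where
  carrier := A ⧸ S
  d := S.mapQ S A.d hd
  c k := S.mapQ S (A.c k) (hc k)
  d_d a := by
    obtain ⟨a, rfl⟩ := S.mkQ_surjective a
    change S.mkQ (A.d (A.d a)) = 0
    rw [A.d_d, map_zero]
  c_c k l a := by
    obtain ⟨a, rfl⟩ := S.mkQ_surjective a
    change S.mkQ (A.c k (A.c l a)) = if k = l then S.mkQ (A.c l a) else 0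
    split_ifs with h
    · rw [h, A.c_self]
    · rw [A.c_of_ne h, map_zero]
  c_d k a := by
    obtain ⟨a, rfl⟩ := S.mkQ_surjective a
    exact congrArg S.mkQ (A.c_d k a)
  c_sum := by
    obtain ⟨F, hF⟩ := A.c_sum
    refine ⟨F, fun a => ?_⟩
    obtain ⟨a, rfl⟩ := S.mkQ_surjective a
    conv_rhs => rw [← hF a, map_sum]
    rfl

/-- The inclusion of a subcomplex. -/
def subIncl : Hom (A.sub S hd hc) A := ⟨S.subtype, fun _ => rfl, fun _ _ => rfl⟩

/-- The projection to a quotient. -/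
def quotMk : Hom A (A.quot S hd hc) := ⟨S.mkQ, fun _ => rfl, fun _ _ => rfl⟩

lemma subSES : SES (A.subIncl S hd hc) (A.quotMk S hd hc) where
  inj := Subtype.val_injective
  exact b := by
    refine (Submodule.Quotient.mk_eq_zero S).trans ⟨fun h => ⟨⟨b, h⟩, rfl⟩, ?_⟩
    rintro ⟨a, rfl⟩
    exact a.2
  surj := S.mkQ_surjective

variable {A} {B : DiffModule R} (f : Hom A B)

/-- The cokernel of a morphism. -/
@[reducible] def Hom.coker : DiffModule R :=
  B.quot (LinearMap.range f.toLin)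
    (by rintro _ ⟨a, rfl⟩; exact ⟨A.d a, f.map_d a⟩)
    (by rintro k _ ⟨a, rfl⟩; exact ⟨A.c k a, f.map_c k a⟩)

/-- The projection to the cokernel. -/
def Hom.cokerMk : Hom B f.coker := quotMk _ _ _ _

lemma Hom.cokerSES (hf : Function.Injective f.toLin) : SES f f.cokerMk where
  inj := hf
  exact _ := Submodule.Quotient.mk_eq_zero _
  surj := Submodule.mkQ_surjective _

variable {f} in
lemma Hom.BijAt.ex {k : ℤ} (h : f.BijAt k) (hA : A.Ex k) : B.Ex k := by
  intro z hz hk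
  obtain ⟨a, ha, hak, w, hw⟩ := h.2 z hz hk
  obtain ⟨b, rfl⟩ := hA a ha hak
  exact ⟨f b + w, by rw [hw, f.map_d, map_add]⟩

end SubQuot

/-! ### Modules as complexes -/

section Single

variable {N' N'' : Type u} [AddCommGroup N'] [Module R N'] [AddCommGroup N''] [Module R N'']
  (N : Type u) [AddCommGroup N] [Module R N]

/-- A module placed in degree `k`. -/
@[reducible] def single (k : ℤ) : DiffModule R where
  carrier := N
  d := 0
  c l := if l = k then LinearMap.id else 0
  d_d _ := rfl
  c_c l j a := by split_ifs <;> simp_all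
  c_d l a := by simp
  c_sum := ⟨{k}, fun a => by simp⟩

variable {N}

/-- A linear map as a morphism of complexes. -/
def singleMap (f : N →ₗ[R] N') (k : ℤ) : Hom (single N k : DiffModule R) (single N' k) :=
  ⟨f, fun _ => map_zero f, fun l a => by
    change f ((if l = k then LinearMap.id else 0 : N →ₗ[R] N) a) =
      (if l = k then LinearMap.id else 0 : N' →ₗ[R] N') (f a)
    split_ifs <;> simp⟩

lemma single_c_self (k : ℤ) (a : N) : (single N k : DiffModule R).c k a = a := by
  change (if k = k then LinearMap.id else 0 : N →ₗ[R] N) a = a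
  simp

lemma single_c_of_ne {l k : ℤ} (h : l ≠ k) (a : N) : (single N k : DiffModule R).c l a = 0 := by
  change (if l = k then LinearMap.id else 0 : N →ₗ[R] N) a = 0
  simp [h]

lemma singleSES {f : N →ₗ[R] N'} {g : N' →ₗ[R] N''} (hf : Function.Injective f)
    (hfg : Function.Exact f g) (hg : Function.Surjective g) (k : ℤ) :
    SES (singleMap f k) (singleMap g k) := ⟨hf, hfg, hg⟩

lemma ex_single {l k : ℤ} (h : l ≠ k) : (single N k : DiffModule R).Ex l := by
  intro z _ hz
  rw [single_c_of_ne h] at hz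
  exact ⟨0, by rw [← hz, map_zero]⟩

end Single

/-! ### The lowest cohomology of a Čech complex -/

/-- The complex is zero in degrees below `k`. -/
def From (A : DiffModule R) (k : ℤ) : Prop := ∀ l < k, ∀ a : A, A.c l a = 0

variable {A : DiffModule R} {k : ℤ}

lemma From.tel (h : A.From k) (x : R) : (tel x A).From k := by
  intro l hl a
  refine Prod.ext (h l hl _) ?_
  have : A.c (l - 1) = 0 := LinearMap.ext (h (l - 1) (by omega))
  change LocAway.map x (A.c (l - 1)) a.2 = 0
  rw [this, LocAway.map_zero_left, LinearMap.zero_apply]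

lemma From.cech (h : A.From k) (xs : List R) : (cech xs A).From k := by
  induction xs generalizing A with
  | nil => exact h
  | cons x xs ih => exact ih (h.tel x)

lemma From.tel_snd (h : A.From k) {x : R} {p : DiffModule.tel x A}
    (hp : (DiffModule.tel x A).c k p = p) : p.2 = 0 := by
  have : A.c (k - 1) = 0 := LinearMap.ext (h (k - 1) (by omega))
  rw [← hp]
  change LocAway.map x (A.c (k - 1)) p.2 = 0
  rw [this, LocAway.map_zero_left, LinearMap.zero_apply]

lemma cechFst_eq_zero (hA : A.From k) (xs : List R) (z : cech xs A)
    (hz : (cech xs A).c k z = z) (h : cechFst xs A z = 0) : z = 0 := by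
  induction xs generalizing A with
  | nil => exact h
  | cons x xs ih =>
    refine ih (hA.tel x) z hz (Prod.ext h ?_)
    refine hA.tel_snd (p := cechFst xs (DiffModule.tel x A) z) ?_
    exact ((cechFst xs (DiffModule.tel x A)).map_c k z).symm.trans (congrArg _ hz)

lemma exists_cechFst_eq_iff (hA : A.From k) (xs : List R) (a : A) (ha : A.c k a = a) :
    (∃ z : cech xs A, (cech xs A).d z = 0 ∧ (cech xs A).c k z = z ∧ cechFst xs A z = a) ↔
      A.d a = 0 ∧ ∀ x ∈ xs, ∃ n : ℕ, x ^ n • a = 0 := by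
  induction xs generalizing A with
  | nil =>
    constructor
    · rintro ⟨z, hz, -, rfl⟩
      exact ⟨hz, by simp⟩
    · rintro ⟨h, -⟩
      exact ⟨a, h, ha, rfl⟩
  | cons x xs ih =>
    have hp : (DiffModule.tel x A).c k (a, 0) = (a, 0) :=
      Prod.ext ha (map_zero (LocAway.map x (A.c (k - 1))))
    have key := ih (hA.tel x) (a, 0) hp
    have h1 : (DiffModule.tel x A).d (a, 0) = 0 ↔ A.d a = 0 ∧ ∃ n : ℕ, x ^ n • a = 0 := by
      rw [← LocAway.ι_eq_zero]
      change (A.d a, LocAway.ι x a - LocAway.map x A.d 0) = 0 ↔ _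
      rw [map_zero, sub_zero, Prod.mk_eq_zero]
    have h2 : ∀ (y : R) (n : ℕ), y ^ n • ((a, 0) : DiffModule.tel x A) = 0 ↔ y ^ n • a = 0 := by
      intro y n
      change ((y ^ n • a, y ^ n • 0) : A × LocAway x A) = 0 ↔ _
      rw [smul_zero, Prod.mk_eq_zero, and_iff_left rfl]
    have h3 : (∃ z : DiffModule.cech (x :: xs) A, (DiffModule.cech (x :: xs) A).d z = 0 ∧
        (DiffModule.cech (x :: xs) A).c k z = z ∧ cechFst (x :: xs) A z = a) ↔
        ∃ z : DiffModule.cech xs (DiffModule.tel x A), (DiffModule.cech xs (DiffModule.tel x A)).d z = 0 ∧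
        (DiffModule.cech xs (DiffModule.tel x A)).c k z = z ∧
          cechFst xs (DiffModule.tel x A) z = (a, 0) := by
      refine exists_congr fun z => and_congr_right fun _ => and_congr_right fun hz => ?_
      constructor
      · intro h
        refine Prod.ext h (hA.tel_snd (p := cechFst xs (DiffModule.tel x A) z) ?_)
        exact ((cechFst xs (DiffModule.tel x A)).map_c k z).symm.trans (congrArg _ hz)
      · intro h
        exact congrArg Prod.fst h
    rw [h3, key, h1, and_assoc]
    simp only [h2, List.forall_mem_cons]

lemma from_single (N : Type u) [AddCommGroup N] [Module R N] (k : ℤ) :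
    (single N k : DiffModule R).From k := fun _ hl a => single_c_of_ne hl.ne a

section CohZero

variable (xs : List R) (N : Type u) [AddCommGroup N] [Module R N] {N' N'' : Type u}
  [AddCommGroup N'] [Module R N'] [AddCommGroup N''] [Module R N''] (k : ℤ)

lemma exists_cechFst_single_iff (a : N) :
    (∃ z : (cech xs (single N k)).Z k, cechFst xs (single N k) z = a) ↔
      a ∈ powTorsion (Ideal.span {x : R | x ∈ xs}) N := by
  rw [mem_powTorsion_span]
  have h := exists_cechFst_eq_iff (from_single N k) xs a (single_c_self k a)
  constructor
  · rintro ⟨z, hz⟩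
    exact (h.1 ⟨z, z.2.1, z.2.2, hz⟩).2
  · intro h1
    obtain ⟨z, h2, h3, h4⟩ := h.2 ⟨rfl, h1⟩
    exact ⟨⟨z, h2, h3⟩, h4⟩

/-- Lowest degree cocycles of the Čech complex. -/
def cechZeroCocycles :
    (cech xs (single N k)).Z k ≃ₗ[R] powTorsion (Ideal.span {x : R | x ∈ xs}) N :=
  LinearEquiv.ofBijective
    (((cechFst xs (single N k)).toLin ∘ₗ Submodule.subtype _).codRestrict _
      fun z => (exists_cechFst_single_iff xs N k _).1 ⟨z, rfl⟩) (by
    constructor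
    · rw [← LinearMap.ker_eq_bot, LinearMap.ker_eq_bot']
      intro z hz
      exact Subtype.ext (cechFst_eq_zero (from_single N k) xs z z.2.2 (congrArg Subtype.val hz))
    · rintro ⟨a, ha⟩
      obtain ⟨z, hz⟩ := (exists_cechFst_single_iff xs N k a).2 ha
      exact ⟨z, Subtype.ext hz⟩)

/-- Cocycles and cohomology agree in the lowest degree. -/
def clsZero : (cech xs (single N k)).Z k ≃ₗ[R] (cech xs (single N k)).Coh k :=
  LinearEquiv.ofBijective ((cech xs (single N k)).cls k) (by
    refine ⟨?_, cls_surjective k⟩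
    rw [← LinearMap.ker_eq_bot, LinearMap.ker_eq_bot']
    intro z hz
    obtain ⟨w, hw⟩ := (cls_eq_zero z).1 hz
    refine Subtype.ext ?_
    rw [← z.2.2, hw, c_d', (from_single N k).cech xs (k - 1) (by omega), map_zero]
    rfl)

/-- The lowest cohomology of the Čech complex of a module is the torsion submodule. -/
def cechZero :
    (cech xs (single N k)).Coh k ≃ₗ[R] powTorsion (Ideal.span {x : R | x ∈ xs}) N :=
  (clsZero xs N k).symm.trans (cechZeroCocycles xs N k)

lemma cechZero_cls (z : (cech xs (single N k)).Z k) :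
    (cechZero xs N k ((cech xs (single N k)).cls k z) : N) = cechFst xs (single N k) z := by
  have h : (clsZero xs N k).symm ((cech xs (single N k)).cls k z) = z :=
    (clsZero xs N k).symm_apply_apply z
  rw [cechZero, LinearEquiv.trans_apply, h]
  rfl

variable {N}

lemma cechZero_naturality (f : N →ₗ[R] N') (w : (cech xs (single N k)).Coh k) :
    cechZero xs N' k ((cechMap xs (singleMap f k)).mapCoh k w) =
      powTorsionMap _ f (cechZero xs N k w) := by
  obtain ⟨z, rfl⟩ := cls_surjective k w
  refine Subtype.ext ?_
  rw [Hom.mapCoh_cls, cechZero_cls]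
  refine Eq.trans ?_ (congrArg f (cechZero_cls xs N k z).symm)
  exact congrArg (fun g : Hom _ _ => g z) (cechFst_naturality xs (singleMap f k))

end CohZero

/-! ### Čech cohomology of injective modules -/

section Injective

variable [IsNoetherianRing R] (N : Type u) [AddCommGroup N] [Module R N]

lemma ex_cech_single_injective (xs : List R) (hN : Module.Injective R N) {k l : ℤ} (h : l ≠ k) :
    (DiffModule.cech xs (single N k)).Ex l := by
  induction xs generalizing N with
  | nil => exact ex_single h
  | cons x xs ih =>
    have hloc := loc_surjective_of_injective x hN
    let f : Hom (single (elemTorsion x N) k) (DiffModule.tel x (single N k)) :=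
      ⟨(LinearMap.inl R N (LocAway x N)) ∘ₗ (elemTorsion x N).subtype, fun a => by
        refine Prod.ext rfl ?_
        change 0 = LocAway.ι x (a : N) - LocAway.map x 0 0
        rw [map_zero, sub_zero, eq_comm, LocAway.ι_eq_zero]
        exact mem_elemTorsion.1 a.2, fun l a => by
        refine Prod.ext ?_ ?_
        · exact (singleMap (elemTorsion x N).subtype k).map_c l a
        · change 0 = LocAway.map x ((single N k : DiffModule R).c (l - 1)) 0
          rw [map_zero]⟩
    have hf : Function.Injective f.toLin := fun a b hab => Subtype.ext (congrArg Prod.fst hab)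
    have hQ : f.coker.Acyclic := by
      intro q hq
      obtain ⟨⟨a, y⟩, rfl⟩ := (LinearMap.range f.toLin).mkQ_surjective q
      obtain ⟨b, hb⟩ : (DiffModule.tel x (single N k)).d (a, y) ∈ LinearMap.range f.toLin :=
        (Submodule.Quotient.mk_eq_zero _).1 hq
      have h1 : (0 : LocAway x N) = LocAway.ι x a - LocAway.map x 0 y := congrArg Prod.snd hb
      rw [LocAway.map_zero_left, LinearMap.zero_apply, sub_zero, eq_comm,
        LocAway.ι_eq_zero] at h1
      obtain ⟨b, rfl⟩ := hloc y
      refine ⟨(LinearMap.range f.toLin).mkQ (b, 0), ?_⟩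
      refine (Submodule.Quotient.eq _).2 ⟨⟨a, mem_elemTorsion.2 h1⟩, ?_⟩
      refine Prod.ext ?_ ?_
      · change a = a - 0
        rw [sub_zero]
      · change 0 = LocAway.ι x b - (LocAway.ι x b - LocAway.map x 0 0)
        rw [map_zero, sub_zero, sub_self]
    exact (((f.cokerSES hf).cech xs).qi_left (hQ.cech xs) l).ex
      (ih _ (injective_elemTorsion x hN))

variable {N} {J C : Type u} [AddCommGroup J] [Module R J] [AddCommGroup C] [Module R C]
  {f : N →ₗ[R] J} {g : J →ₗ[R] C} (hf : Function.Injective f) (hfg : Function.Exact f g)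
  (hg : Function.Surjective g) (hJ : Module.Injective R J) (xs : List R) (k : ℤ)

include hf hfg hg hJ

lemma cech_one_equiv : Nonempty ((DiffModule.cech xs (single N k)).Coh (k + 1) ≃ₗ[R]
    powTorsion (Ideal.span {x : R | x ∈ xs}) C ⧸
      LinearMap.range (powTorsionMap (Ideal.span {x : R | x ∈ xs}) g)) := by
  have S := (singleSES hf hfg hg k).cech xs
  refine nonempty_equiv_coker (cechZero xs J k) (cechZero xs C k)
    (cechZero_naturality xs k g) (δ := S.delta rfl) ?_ (S.exact_right rfl)
  intro y
  have hs : Subsingleton ((DiffModule.cech xs (single J k)).Coh (k + 1)) :=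
    subsingleton_coh_iff.2 (ex_cech_single_injective J xs hJ (by omega))
  exact (S.exact_left rfl y).1 (Subsingleton.elim _ _)

lemma cech_succ_equiv (i : ℕ) :
    Nonempty ((DiffModule.cech xs (single N k)).Coh (k + (i + 2 : ℕ)) ≃ₗ[R]
      (DiffModule.cech xs (single C k)).Coh (k + (i + 1 : ℕ))) := by
  have S := (singleSES hf hfg hg k).cech xs
  have hk : k + (i + 1 : ℕ) + 1 = k + (i + 2 : ℕ) := by push_cast; ring
  have h1 : Subsingleton ((DiffModule.cech xs (single J k)).Coh (k + (i + 1 : ℕ))) :=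
    subsingleton_coh_iff.2 (ex_cech_single_injective J xs hJ (by omega))
  have h2 : Subsingleton ((DiffModule.cech xs (single J k)).Coh (k + (i + 2 : ℕ))) :=
    subsingleton_coh_iff.2 (ex_cech_single_injective J xs hJ (by omega))
  refine ⟨(LinearEquiv.ofBijective (S.delta hk) ⟨?_, ?_⟩).symm⟩
  · rw [← LinearMap.ker_eq_bot, LinearMap.ker_eq_bot']
    intro y hy
    obtain ⟨z, rfl⟩ := (S.exact_right hk y).1 hy
    rw [Subsingleton.elim z 0, map_zero]
  · intro y
    exact (S.exact_left hk y).1 (Subsingleton.elim _ _)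

end Injective

end DiffModule

section LeftDerivedSequence

open Limits HomologicalComplex

variable {𝒞 𝒟 : Type*} [Category* 𝒞] [Category* 𝒟] [Abelian 𝒞] [Abelian 𝒟]
  [HasProjectiveResolutions 𝒞] {F G H : 𝒞 ⥤ 𝒟} [F.Additive] [G.Additive] [H.Additive]
  (α : F ⟶ G) (β : G ⟶ H)

/-- Left derived functors computed as the homology of a projective resolution. -/
def leftDerivedIso (F : 𝒞 ⥤ 𝒟) [F.Additive] {X : 𝒞} (P : ProjectiveResolution X) (n : ℕ) :
    (F.leftDerived n).obj X ≅
      ((F.mapHomologicalComplex (ComplexShape.down ℕ)).obj P.complex).homology n :=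
  P.isoLeftDerivedObj F n

lemma leftDerivedIso_hom_naturality (F : 𝒞 ⥤ 𝒟) [F.Additive] {X Y : 𝒞} (f : X ⟶ Y)
    (P : ProjectiveResolution X) (Q : ProjectiveResolution Y) (n : ℕ) :
    (F.leftDerived n).map f ≫ (leftDerivedIso F Q n).hom = (leftDerivedIso F P n).hom ≫
      homologyMap ((F.mapHomologicalComplex (ComplexShape.down ℕ)).map
        (ProjectiveResolution.lift f P Q)) n :=
  ProjectiveResolution.isoLeftDerivedObj_hom_naturality f P Q _
    (ProjectiveResolution.lift_commutes_zero f P Q) F n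

lemma leftDerivedIso_inv_naturality (F : 𝒞 ⥤ 𝒟) [F.Additive] {X Y : 𝒞} (f : X ⟶ Y)
    (P : ProjectiveResolution X) (Q : ProjectiveResolution Y) (n : ℕ) :
    (leftDerivedIso F P n).inv ≫ (F.leftDerived n).map f =
      homologyMap ((F.mapHomologicalComplex (ComplexShape.down ℕ)).map
        (ProjectiveResolution.lift f P Q)) n ≫ (leftDerivedIso F Q n).inv :=
  ProjectiveResolution.isoLeftDerivedObj_inv_naturality f P Q _
    (ProjectiveResolution.lift_commutes_zero f P Q) F n

lemma leftDerived_app_eq_leftDerivedIso (α : F ⟶ G) {X : 𝒞} (P : ProjectiveResolution X) (n : ℕ) :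
    (NatTrans.leftDerived α n).app X = (leftDerivedIso F P n).hom ≫
      homologyMap ((NatTrans.mapHomologicalComplex α (ComplexShape.down ℕ)).app P.complex) n ≫
        (leftDerivedIso G P n).inv :=
  ProjectiveResolution.leftDerived_app_eq α P n

/-- A composable pair of natural transformations which is short exact on projectives. -/
structure ShortExactOnProjectives : Prop where
  comp_zero : ∀ X, α.app X ≫ β.app X = 0
  shortExact : ∀ X [Projective X], (ShortComplex.mk (α.app X) (β.app X) (comp_zero X)).ShortExact

namespace ShortExactOnProjectives

variable {α β} (S : ShortExactOnProjectives α β)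

/-- The short complex obtained by evaluating on a chain complex. -/
abbrev sc (P : ChainComplex 𝒞 ℕ) : ShortComplex (ChainComplex 𝒟 ℕ) :=
  ShortComplex.mk ((NatTrans.mapHomologicalComplex α (ComplexShape.down ℕ)).app P)
    ((NatTrans.mapHomologicalComplex β (ComplexShape.down ℕ)).app P)
    (by ext n; exact S.comp_zero (P.X n))

lemma sc_shortExact {X : 𝒞} (P : ProjectiveResolution X) : (S.sc P.complex).ShortExact :=
  shortExact_of_degreewise_shortExact _ fun n => S.shortExact (P.complex.X n)

/-- The connecting homomorphism of the short exact sequence given by a projective resolution. -/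
def resδ {X : 𝒞} (P : ProjectiveResolution X) (n : ℕ) :
    ((H.mapHomologicalComplex (ComplexShape.down ℕ)).obj P.complex).homology (n + 1) ⟶
      ((F.mapHomologicalComplex (ComplexShape.down ℕ)).obj P.complex).homology n :=
  (S.sc_shortExact P).δ (n + 1) n (by simp)

/-- The connecting homomorphism computed by a projective resolution. -/
def connecting {X : 𝒞} (P : ProjectiveResolution X) (n : ℕ) :
    (H.leftDerived (n + 1)).obj X ⟶ (F.leftDerived n).obj X :=
  (leftDerivedIso H P (n + 1)).hom ≫ S.resδ P n ≫ (leftDerivedIso F P n).inv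

lemma resδ_naturality {X Y : 𝒞} (f : X ⟶ Y) (P : ProjectiveResolution X)
    (Q : ProjectiveResolution Y) (n : ℕ) :
    S.resδ P n ≫ homologyMap ((F.mapHomologicalComplex (ComplexShape.down ℕ)).map
        (ProjectiveResolution.lift f P Q)) n =
      homologyMap ((H.mapHomologicalComplex (ComplexShape.down ℕ)).map
        (ProjectiveResolution.lift f P Q)) (n + 1) ≫ S.resδ Q n := by
  let φ := ProjectiveResolution.lift f P Q
  let Φ : S.sc P.complex ⟶ S.sc Q.complex :=
    { τ₁ := (F.mapHomologicalComplex _).map φ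
      τ₂ := (G.mapHomologicalComplex _).map φ
      τ₃ := (H.mapHomologicalComplex _).map φ
      comm₁₂ := (NatTrans.mapHomologicalComplex α (ComplexShape.down ℕ)).naturality φ
      comm₂₃ := (NatTrans.mapHomologicalComplex β (ComplexShape.down ℕ)).naturality φ }
  exact HomologicalComplex.HomologySequence.δ_naturality Φ (S.sc_shortExact P)
    (S.sc_shortExact Q) (n + 1) n (by simp)

lemma connecting_naturality {X Y : 𝒞} (f : X ⟶ Y) (P : ProjectiveResolution X)
    (Q : ProjectiveResolution Y) (n : ℕ) :
    (H.leftDerived (n + 1)).map f ≫ S.connecting Q n =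
      S.connecting P n ≫ (F.leftDerived n).map f := by
  unfold connecting
  rw [← Category.assoc, leftDerivedIso_hom_naturality H f P Q, Category.assoc, Category.assoc,
    Category.assoc, leftDerivedIso_inv_naturality F f P Q, ← Category.assoc (S.resδ P n),
    resδ_naturality, Category.assoc]

/-- The connecting natural transformation between left derived functors. -/
def derivedδ (n : ℕ) : H.leftDerived (n + 1) ⟶ F.leftDerived n where
  app X := S.connecting (projectiveResolution X) n
  naturality _ _ f := S.connecting_naturality f _ _ n

lemma β_resδ {X : 𝒞} (P : ProjectiveResolution X) (n : ℕ) :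
    homologyMap ((NatTrans.mapHomologicalComplex β (ComplexShape.down ℕ)).app P.complex) (n + 1) ≫
      S.resδ P n = 0 :=
  (S.sc_shortExact P).comp_δ (n + 1) n (by simp)

lemma resδ_α {X : 𝒞} (P : ProjectiveResolution X) (n : ℕ) :
    S.resδ P n ≫
      homologyMap ((NatTrans.mapHomologicalComplex α (ComplexShape.down ℕ)).app P.complex) n = 0 :=
  (S.sc_shortExact P).δ_comp (n + 1) n (by simp)

lemma β_derivedδ (X : 𝒞) (n : ℕ) :
    (NatTrans.leftDerived β (n + 1)).app X ≫ (S.derivedδ n).app X = 0 := by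
  rw [leftDerived_app_eq_leftDerivedIso β (projectiveResolution X)]
  simp only [derivedδ, connecting, Category.assoc, Iso.inv_hom_id_assoc]
  rw [reassoc_of% (S.β_resδ (projectiveResolution X) n)]
  simp

lemma derivedδ_α (X : 𝒞) (n : ℕ) :
    (S.derivedδ n).app X ≫ (NatTrans.leftDerived α n).app X = 0 := by
  rw [leftDerived_app_eq_leftDerivedIso α (projectiveResolution X)]
  simp only [derivedδ, connecting, Category.assoc, Iso.inv_hom_id_assoc]
  rw [reassoc_of% (S.resδ_α (projectiveResolution X) n)]
  simp

lemma exact_β_derivedδ (X : 𝒞) (n : ℕ) :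
    (ShortComplex.mk _ _ (S.β_derivedδ X n)).Exact := by
  have h : (ShortComplex.mk _ _ (S.β_resδ (projectiveResolution X) n)).Exact :=
    (S.sc_shortExact (projectiveResolution X)).homology_exact₃ (n + 1) n (by simp)
  refine ShortComplex.exact_of_iso (ShortComplex.isoMk (leftDerivedIso G _ (n + 1)).symm
    (leftDerivedIso H _ (n + 1)).symm (leftDerivedIso F _ n).symm ?_ ?_) h
  · dsimp only
    rw [leftDerived_app_eq_leftDerivedIso β (projectiveResolution X)]
    simp
  · simp [derivedδ, connecting]

lemma exact_derivedδ_α (X : 𝒞) (n : ℕ) :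
    (ShortComplex.mk _ _ (S.derivedδ_α X n)).Exact := by
  have h : (ShortComplex.mk _ _ (S.resδ_α (projectiveResolution X) n)).Exact :=
    (S.sc_shortExact (projectiveResolution X)).homology_exact₁ (n + 1) n (by simp)
  refine ShortComplex.exact_of_iso (ShortComplex.isoMk (leftDerivedIso H _ (n + 1)).symm
    (leftDerivedIso F _ n).symm (leftDerivedIso G _ n).symm ?_ ?_) h
  · simp [derivedδ, connecting]
  · dsimp only
    rw [leftDerived_app_eq_leftDerivedIso α (projectiveResolution X)]
    simp

end ShortExactOnProjectives

/-- The canonical morphism from the zeroth left derived functor, via a projective resolution. -/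
def fromZeroHomology (F : 𝒞 ⥤ 𝒟) [F.Additive] {X : 𝒞} (P : ProjectiveResolution X) :
    ((F.mapHomologicalComplex (ComplexShape.down ℕ)).obj P.complex).homology 0 ⟶ F.obj X :=
  (ChainComplex.isoHomologyι₀ _).hom ≫ P.fromLeftDerivedZero' F

lemma leftDerivedIso_comp_fromZeroHomology (F : 𝒞 ⥤ 𝒟) [F.Additive] {X : 𝒞}
    (P : ProjectiveResolution X) :
    (leftDerivedIso F P 0).hom ≫ fromZeroHomology F P = F.fromLeftDerivedZero.app X :=
  (ProjectiveResolution.fromLeftDerivedZero_eq P F).symm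

lemma homologyι_fromLeftDerivedZero'_naturality (α : F ⟶ G) {X : 𝒞}
    (P : ProjectiveResolution X) :
    HomologicalComplex.opcyclesMap
      ((NatTrans.mapHomologicalComplex α (ComplexShape.down ℕ)).app P.complex) 0 ≫
        P.fromLeftDerivedZero' G = P.fromLeftDerivedZero' F ≫ α.app X := by
  rw [← cancel_epi (HomologicalComplex.pOpcycles _ _), HomologicalComplex.p_opcyclesMap_assoc]
  have h1 := ProjectiveResolution.pOpcycles_comp_fromLeftDerivedZero' P F
  have h2 := ProjectiveResolution.pOpcycles_comp_fromLeftDerivedZero' P G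
  exact ((congrArg (fun t => α.app (P.complex.X 0) ≫ t) h2).trans
    (α.naturality (P.π.f 0)).symm).trans
      ((congrArg (fun t => t ≫ α.app X) h1).symm.trans (Category.assoc _ _ _))

lemma fromZeroHomology_naturality (α : F ⟶ G) {X : 𝒞} (P : ProjectiveResolution X) :
    homologyMap ((NatTrans.mapHomologicalComplex α (ComplexShape.down ℕ)).app P.complex) 0 ≫
      fromZeroHomology G P = fromZeroHomology F P ≫ α.app X := by
  unfold fromZeroHomology
  rw [Category.assoc, ← homologyι_fromLeftDerivedZero'_naturality α P]
  exact HomologicalComplex.homologyι_naturality_assoc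
    ((NatTrans.mapHomologicalComplex α (ComplexShape.down ℕ)).app P.complex) 0 _

lemma leftDerived_comp_fromLeftDerivedZero (α : F ⟶ G) (X : 𝒞) :
    (NatTrans.leftDerived α 0).app X ≫ G.fromLeftDerivedZero.app X =
      F.fromLeftDerivedZero.app X ≫ α.app X := by
  have P := projectiveResolution X
  rw [leftDerived_app_eq_leftDerivedIso α P, ← leftDerivedIso_comp_fromZeroHomology F P,
    ← leftDerivedIso_comp_fromZeroHomology G P, Category.assoc, Category.assoc,
    Iso.inv_hom_id_assoc, fromZeroHomology_naturality, Category.assoc]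

end LeftDerivedSequence

section LocalCohomologyColimit

open Limits Opposite

variable {R}

/-- The contravariant functor of linear maps into `Y`, as a covariant functor. -/
abbrev homInto (Y : ModuleCat.{u} R) : ModuleCat.{u} R ⥤ (ModuleCat.{u} R)ᵒᵖ :=
  ((linearYoneda R (ModuleCat.{u} R)).obj Y).rightOp

/-- Functoriality of `homInto`, which reverses arrows. -/
abbrev homIntoMap {Y Y' : ModuleCat.{u} R} (f : Y ⟶ Y') : homInto Y' ⟶ homInto Y :=
  NatTrans.rightOp ((linearYoneda R (ModuleCat.{u} R)).map f)

/-- The modules `Ext i (X, Y)` as a contravariant functor of `X`. -/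
abbrev extInto (i : ℕ) (Y : ModuleCat.{u} R) : (ModuleCat.{u} R)ᵒᵖ ⥤ ModuleCat.{u} R :=
  ((homInto Y).leftDerived i).leftOp

abbrev extIntoMap (i : ℕ) {Y Y' : ModuleCat.{u} R} (f : Y ⟶ Y') : extInto i Y ⟶ extInto i Y' :=
  NatTrans.leftOp (NatTrans.leftDerived (homIntoMap f) i)

lemma isZero_extInto_succ (i : ℕ) (X : (ModuleCat.{u} R)ᵒᵖ) (J : ModuleCat.{u} R)
    [Injective J] : IsZero ((extInto (i + 1) J).obj X) := by
  let P := projectiveResolution X.unop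
  let T := (((homInto J).mapHomologicalComplex (ComplexShape.down ℕ)).obj P.complex)
  refine IsZero.unop (X := ((homInto J).leftDerived (i + 1)).obj X.unop) ?_
  refine IsZero.of_iso ?_ (leftDerivedIso (homInto J) P (i + 1))
  rw [← HomologicalComplex.exactAt_iff_isZero_homology,
    HomologicalComplex.exactAt_iff' _ (i + 1 + 1) (i + 1) i (by simp) (by simp)]
  have hP := P.complex_exactAt_succ i
  rw [HomologicalComplex.exactAt_iff' _ (i + 1 + 1) (i + 1) i (by simp) (by simp)] at hP
  rw [← ShortComplex.exact_unop_iff, ShortComplex.moduleCat_exact_iff]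
  intro (φ : P.complex.X (i + 1) ⟶ J) (h : P.complex.d (i + 1 + 1) (i + 1) ≫ φ = 0)
  exact ⟨hP.descToInjective φ h, hP.comp_descToInjective φ h⟩

variable {S : ShortComplex (ModuleCat.{u} R)} (hS : S.ShortExact)

include hS in
lemma shortExact_linearYoneda (X : ModuleCat.{u} R) [Projective X] :
    ∃ w, (ShortComplex.mk (((linearYoneda R _).map S.f).app (op X))
      (((linearYoneda R _).map S.g).app (op X)) w).ShortExact := by
  have := hS.mono_f
  have := hS.epi_g
  have w : ((linearYoneda R _).map S.f).app (op X) ≫ ((linearYoneda R _).map S.g).app (op X) = 0 := by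
    ext (φ : X ⟶ S.X₁)
    change (φ ≫ S.f) ≫ S.g = 0
    simp
  refine ⟨w, { exact := ?_, mono_f := ?_, epi_g := ?_ }⟩
  · rw [ShortComplex.moduleCat_exact_iff]
    intro (φ : X ⟶ S.X₂) (h : φ ≫ S.g = 0)
    exact ⟨hS.exact.lift φ h, hS.exact.lift_f φ h⟩
  · rw [ModuleCat.mono_iff_injective]
    intro (φ : X ⟶ S.X₁) (ψ : X ⟶ S.X₁) (h : φ ≫ S.f = ψ ≫ S.f)
    exact (cancel_mono S.f).1 h
  · rw [ModuleCat.epi_iff_surjective]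
    intro (φ : X ⟶ S.X₃)
    exact ⟨Projective.factorThru φ S.g, Projective.factorThru_comp φ S.g⟩

include hS in
lemma shortExactOnProjectives :
    ShortExactOnProjectives (homIntoMap S.g) (homIntoMap S.f) where
  comp_zero X := by
    refine Quiver.Hom.unop_inj ?_
    change ((linearYoneda R _).map S.f).app (op X) ≫ ((linearYoneda R _).map S.g).app (op X) = 0
    rw [← NatTrans.comp_app, ← Functor.map_comp, S.zero]
    ext (φ : X ⟶ S.X₁)
    change φ ≫ 0 = 0
    simp
  shortExact X _ := (shortExact_linearYoneda hS X).choose_spec.op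

/-- The connecting homomorphism of `Ext` in the second argument. -/
def extδ (i : ℕ) : extInto i S.X₃ ⟶ extInto (i + 1) S.X₁ :=
  NatTrans.leftOp ((shortExactOnProjectives hS).derivedδ i)

lemma extIntoMap_extδ (i : ℕ) : extIntoMap i S.g ≫ extδ hS i = 0 := by
  ext1; ext1 X
  exact congrArg Quiver.Hom.unop ((shortExactOnProjectives hS).derivedδ_α X.unop i)

lemma extδ_extIntoMap (i : ℕ) : extδ hS i ≫ extIntoMap (i + 1) S.f = 0 := by
  ext1; ext1 X
  exact congrArg Quiver.Hom.unop ((shortExactOnProjectives hS).β_derivedδ X.unop i)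

lemma exact_extδ_left (i : ℕ) (X : (ModuleCat.{u} R)ᵒᵖ) :
    ((ShortComplex.mk _ _ (extIntoMap_extδ hS i)).map ((evaluation _ _).obj X)).Exact :=
  ((shortExactOnProjectives hS).exact_derivedδ_α X.unop i).unop

lemma exact_extδ_right (i : ℕ) (X : (ModuleCat.{u} R)ᵒᵖ) :
    ((ShortComplex.mk _ _ (extδ_extIntoMap hS i)).map ((evaluation _ _).obj X)).Exact :=
  ((shortExactOnProjectives hS).exact_β_derivedδ X.unop i).unop

/-- The directed system `R ⧸ I ^ n`. -/
abbrev quotPowers (I : Ideal R) : (ℕᵒᵖ)ᵒᵖ ⥤ (ModuleCat.{u} R)ᵒᵖ :=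
  (localCohomology.ringModIdeals (localCohomology.idealPowersDiagram I)).op

/-- The directed system whose colimit is local cohomology. -/
abbrev lcDiagram (I : Ideal R) (i : ℕ) (Y : ModuleCat.{u} R) : (ℕᵒᵖ)ᵒᵖ ⥤ ModuleCat.{u} R :=
  quotPowers I ⋙ extInto i Y

/-- Local cohomology of a module as a colimit of modules. -/
def localCohomologyIso (I : Ideal R) (i : ℕ) (Y : ModuleCat.{u} R) :
    (localCohomology I i).obj Y ≅ colim.obj (lcDiagram I i Y) :=
  colimitObjIsoColimitCompEvaluation
    (localCohomology.diagram (localCohomology.idealPowersDiagram I) i) Y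

def lcδ (I : Ideal R) (i : ℕ) :
    colim.obj (lcDiagram I i S.X₃) ⟶ colim.obj (lcDiagram I (i + 1) S.X₁) :=
  colim.map (Functor.whiskerLeft (quotPowers I) (extδ hS i))

def lcMap (I : Ideal R) (i : ℕ) {Y Y' : ModuleCat.{u} R} (f : Y ⟶ Y') :
    colim.obj (lcDiagram I i Y) ⟶ colim.obj (lcDiagram I i Y') :=
  colim.map (Functor.whiskerLeft (quotPowers I) (extIntoMap i f))

instance preservesColimitsOfShape_forget :
    PreservesColimitsOfShape (ℕᵒᵖ)ᵒᵖ (forget (ModuleCat.{u} R)) :=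
  have : PreservesFilteredColimitsOfSize.{0, 0} (forget (ModuleCat.{u} R)) :=
    preservesFilteredColimitsOfSize_shrink.{0, u, 0, u} _
  inferInstance

lemma colim_map_exact {A B C : (ℕᵒᵖ)ᵒᵖ ⥤ ModuleCat.{u} R} (f : A ⟶ B) (g : B ⟶ C)
    (h : ∀ X, Function.Exact (f.app X) (g.app X)) :
    Function.Exact (colim.map f) (colim.map g) := by
  intro x
  constructor
  · intro hx
    obtain ⟨j, b, rfl⟩ := Concrete.colimit_exists_rep B x
    have h1 : colimit.ι C j (g.app j b) = colimit.ι C j 0 := by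
      rw [map_zero, ← hx]
      exact (ConcreteCategory.congr_hom (ι_colimMap g j) b).symm
    obtain ⟨k, u, v, huv⟩ := Concrete.colimit_exists_of_rep_eq C _ _ h1
    rw [map_zero] at huv
    have h2 : g.app k (B.map u b) = 0 :=
      (ConcreteCategory.congr_hom (g.naturality u) b).trans huv
    obtain ⟨a, ha⟩ := (h k _).1 h2
    refine ⟨colimit.ι A k a, ?_⟩
    refine (ConcreteCategory.congr_hom (ι_colimMap f k) a).trans ?_
    change colimit.ι B k (f.app k a) = _
    rw [ha]
    exact ConcreteCategory.congr_hom (colimit.w B u) b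
  · rintro ⟨y, rfl⟩
    obtain ⟨j, a, rfl⟩ := Concrete.colimit_exists_rep A y
    have h1 : colim.map g (colim.map f (colimit.ι A j a)) =
        colimit.ι C j (g.app j (f.app j a)) := by
      rw [show colim.map f (colimit.ι A j a) = colimit.ι B j (f.app j a) from
        ConcreteCategory.congr_hom (ι_colimMap f j) a]
      exact ConcreteCategory.congr_hom (ι_colimMap g j) _
    rw [h1, (h j _).2 ⟨a, rfl⟩, map_zero]

lemma exact_lcMap_lcδ (I : Ideal R) (i : ℕ) : Function.Exact (lcMap I i S.g) (lcδ hS I i) :=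
  colim_map_exact _ _ fun X =>
    (ShortComplex.ShortExact.moduleCat_exact_iff_function_exact _).1
      (exact_extδ_left hS i ((quotPowers I).obj X))

lemma exact_lcδ_lcMap (I : Ideal R) (i : ℕ) : Function.Exact (lcδ hS I i) (lcMap I (i + 1) S.f) :=
  colim_map_exact _ _ fun X =>
    (ShortComplex.ShortExact.moduleCat_exact_iff_function_exact _).1
      (exact_extδ_right hS i ((quotPowers I).obj X))

lemma subsingleton_lc_succ_injective (I : Ideal R) (i : ℕ) (J : ModuleCat.{u} R) [Injective J] :
    Subsingleton (colim.obj (lcDiagram I (i + 1) J) : ModuleCat.{u} R) := by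
  refine subsingleton_of_forall_eq 0 fun x => ?_
  obtain ⟨j, b, rfl⟩ := Concrete.colimit_exists_rep (lcDiagram I (i + 1) J) x
  have := ModuleCat.subsingleton_of_isZero (isZero_extInto_succ i ((quotPowers I).obj j) J)
  rw [show b = 0 from @Subsingleton.elim _ this b 0, map_zero]

lemma lcδ_surjective [Injective S.X₂] (I : Ideal R) (i : ℕ) :
    Function.Surjective (lcδ hS I i) := fun y =>
  (exact_lcδ_lcMap hS I i y).1 (@Subsingleton.elim _
    (subsingleton_lc_succ_injective I i S.X₂) _ _)

lemma lcδ_bijective [Injective S.X₂] (I : Ideal R) (i : ℕ) :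
    Function.Bijective (lcδ hS I (i + 1)) := by
  refine ⟨(injective_iff_map_eq_zero _).2 fun x hx => ?_, lcδ_surjective hS I (i + 1)⟩
  obtain ⟨y, rfl⟩ := (exact_lcMap_lcδ hS I (i + 1) x).1 hx
  rw [@Subsingleton.elim _ (subsingleton_lc_succ_injective I i S.X₂) y 0, map_zero]

instance preservesLimits_linearYoneda (Y : ModuleCat.{u} R) :
    PreservesFiniteLimits ((linearYoneda R (ModuleCat.{u} R)).obj Y) where
  preservesFiniteLimits J _ _ := by
    have : PreservesLimitsOfShape J ((linearYoneda R (ModuleCat.{u} R)).obj Y ⋙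
        forget (ModuleCat.{u} R)) :=
      inferInstanceAs (PreservesLimitsOfShape J (yoneda.obj Y))
    exact preservesLimitsOfShape_of_reflects_of_preserves _ (forget (ModuleCat.{u} R))

instance preservesFiniteColimits_homInto (Y : ModuleCat.{u} R) :
    PreservesFiniteColimits (homInto Y) :=
  preservesFiniteColimits_rightOp _

/-- `Ext⁰` is `Hom`. -/
def extZeroIso (Y : ModuleCat.{u} R) : extInto 0 Y ≅ (linearYoneda R (ModuleCat.{u} R)).obj Y where
  hom := NatTrans.leftOp (homInto Y).leftDerivedZeroIsoSelf.inv
  inv := NatTrans.leftOp (homInto Y).leftDerivedZeroIsoSelf.hom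
  hom_inv_id := by
    ext1; ext1 X
    exact congrArg Quiver.Hom.unop ((homInto Y).leftDerivedZeroIsoSelf_hom_inv_id_app X.unop)
  inv_hom_id := by
    ext1; ext1 X
    exact congrArg Quiver.Hom.unop ((homInto Y).leftDerivedZeroIsoSelf_inv_hom_id_app X.unop)

lemma extZeroIso_inv_naturality {Y Y' : ModuleCat.{u} R} (f : Y ⟶ Y') :
    (extZeroIso Y).inv ≫ extIntoMap 0 f =
      (linearYoneda R (ModuleCat.{u} R)).map f ≫ (extZeroIso Y').inv := by
  ext1; ext1 X
  exact congrArg Quiver.Hom.unop (leftDerived_comp_fromLeftDerivedZero (homIntoMap f) X.unop)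

/-- The directed system of homomorphisms from `R ⧸ I ^ n`. -/
abbrev homDiagram (I : Ideal R) (Y : ModuleCat.{u} R) : (ℕᵒᵖ)ᵒᵖ ⥤ ModuleCat.{u} R :=
  quotPowers I ⋙ (linearYoneda R (ModuleCat.{u} R)).obj Y

/-- Evaluation at `1`. -/
def evalOne (I : Ideal R) (Y : ModuleCat.{u} R) (n : ℕ) :
    ModuleCat.of R (ModuleCat.of R (R ⧸ I ^ n) ⟶ Y) ⟶ ModuleCat.of R (powTorsion I Y) :=
  ModuleCat.ofHom
    { toFun := fun φ => ⟨φ.hom (Ideal.Quotient.mk (I ^ n) 1), n, fun r hr => by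
        have : r • (Ideal.Quotient.mk (I ^ n) 1) = 0 := by
          rw [← Ideal.Quotient.mk_eq_mk, ← Submodule.Quotient.mk_smul]
          simpa [Ideal.Quotient.eq_zero_iff_mem] using hr
        exact (map_smul φ.hom r _).symm.trans ((congrArg _ this).trans (map_zero _))⟩
      map_add' := fun _ _ => rfl
      map_smul' := fun _ _ => rfl }

/-- The cocone on `homDiagram` given by evaluation at `1`. -/
abbrev homCocone (I : Ideal R) (Y : ModuleCat.{u} R) : Cocone (homDiagram I Y) where
  pt := ModuleCat.of R (powTorsion I Y)
  ι :=
    { app := fun j => evalOne I Y j.unop.unop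
      naturality := fun _ _ _ => rfl }

lemma homCocone_injective (I : Ideal R) (Y : ModuleCat.{u} R) (j : (ℕᵒᵖ)ᵒᵖ) :
    Function.Injective ((homCocone I Y).ι.app j) := by
  intro (φ : ModuleCat.of R (R ⧸ I ^ j.unop.unop) ⟶ Y)
    (ψ : ModuleCat.of R (R ⧸ I ^ j.unop.unop) ⟶ Y) h
  have h' : φ.hom (Ideal.Quotient.mk _ 1) = ψ.hom (Ideal.Quotient.mk _ 1) :=
    congrArg (Subtype.val : powTorsion I Y → Y) h
  change φ = ψ
  refine ModuleCat.hom_ext (LinearMap.ext fun x => ?_)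
  obtain ⟨r, rfl⟩ := Ideal.Quotient.mk_surjective x
  have hr : Ideal.Quotient.mk (I ^ j.unop.unop) r = r • Ideal.Quotient.mk (I ^ j.unop.unop) 1 := by
    rw [← Ideal.Quotient.mk_eq_mk, ← Ideal.Quotient.mk_eq_mk, ← Submodule.Quotient.mk_smul]
    simp
  exact (congrArg φ.hom hr).trans ((map_smul φ.hom r _).trans
    ((congrArg (r • ·) h').trans ((map_smul ψ.hom r _).symm.trans (congrArg ψ.hom hr).symm)))

lemma evalOne_exists (I : Ideal R) (Y : ModuleCat.{u} R) (y : powTorsion I Y) :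
    ∃ n φ, evalOne I Y n φ = y := by
  obtain ⟨y, n, hy⟩ := y
  refine ⟨n, ModuleCat.ofHom (X := R ⧸ I ^ n)
    ((I ^ n).liftQ (LinearMap.toSpanSingleton R Y y) fun r hr =>
      LinearMap.mem_ker.2 (hy r hr)), ?_⟩
  apply Subtype.ext
  change (I ^ n).liftQ (LinearMap.toSpanSingleton R Y y) _ (Submodule.Quotient.mk 1) = y
  exact (Submodule.liftQ_apply _ _ _).trans (one_smul R y)

/-- Evaluation at `1` on the colimit. -/
def homColimDesc (I : Ideal R) (Y : ModuleCat.{u} R) :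
    (colim.obj (homDiagram I Y) : ModuleCat.{u} R) ⟶ ModuleCat.of R (powTorsion I Y) :=
  colimit.desc _ (homCocone I Y)

lemma homColimDesc_ι (I : Ideal R) (Y : ModuleCat.{u} R) (j : (ℕᵒᵖ)ᵒᵖ) (b : (homDiagram I Y).obj j) :
    homColimDesc I Y (colimit.ι (homDiagram I Y) j b) = (evalOne I Y j.unop.unop).hom b :=
  ConcreteCategory.congr_hom (colimit.ι_desc (homCocone I Y) j) b

/-- The colimit of `homDiagram` is the `I`-power torsion. -/
def homColimEquiv (I : Ideal R) (Y : ModuleCat.{u} R) :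
    (colim.obj (homDiagram I Y) : ModuleCat.{u} R) ≃ₗ[R] powTorsion I Y :=
  LinearEquiv.ofBijective (homColimDesc I Y).hom (by
    constructor
    · rw [injective_iff_map_eq_zero]
      intro x hx
      obtain ⟨j, b, rfl⟩ := Concrete.colimit_exists_rep (homDiagram I Y) x
      have h : (homCocone I Y).ι.app j b = 0 :=
        (homColimDesc_ι I Y j b).symm.trans hx
      have hb : b = 0 := homCocone_injective I Y j (h.trans (map_zero ((homCocone I Y).ι.app j).hom).symm)
      rw [hb, map_zero]
    · intro y
      obtain ⟨n, φ, hφ⟩ := evalOne_exists I Y y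
      exact ⟨colimit.ι (homDiagram I Y) (op (op n)) φ, (homColimDesc_ι I Y (op (op n)) φ).trans hφ⟩)

lemma homColimEquiv_naturality (I : Ideal R) {Y Y' : ModuleCat.{u} R} (f : Y ⟶ Y')
    (w : (colim.obj (homDiagram I Y) : ModuleCat.{u} R)) :
    homColimEquiv I Y' (colim.map (Functor.whiskerLeft (quotPowers I)
      ((linearYoneda R (ModuleCat.{u} R)).map f)) w) =
      powTorsionMap I f.hom (homColimEquiv I Y w) := by
  obtain ⟨j, b, rfl⟩ := Concrete.colimit_exists_rep (homDiagram I Y) w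
  have h1 := ConcreteCategory.congr_hom (ι_colimMap (Functor.whiskerLeft (quotPowers I)
      ((linearYoneda R (ModuleCat.{u} R)).map f)) j) b
  refine (congrArg (homColimEquiv I Y') h1).trans ?_
  refine (homColimDesc_ι I Y' j _).trans ?_
  exact congrArg (powTorsionMap I f.hom) (homColimDesc_ι I Y j b).symm

/-- Local cohomology in degree zero is the power torsion. -/
def lcZero (I : Ideal R) (Y : ModuleCat.{u} R) :
    (colim.obj (lcDiagram I 0 Y) : ModuleCat.{u} R) ≃ₗ[R] powTorsion I Y :=
  (colim.mapIso (Functor.isoWhiskerLeft (quotPowers I) (extZeroIso Y))).toLinearEquiv.trans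
    (homColimEquiv I Y)

lemma lcZero_naturality (I : Ideal R) {Y Y' : ModuleCat.{u} R} (f : Y ⟶ Y')
    (w : (colim.obj (lcDiagram I 0 Y) : ModuleCat.{u} R)) :
    lcZero I Y' (lcMap I 0 f w) = powTorsionMap I f.hom (lcZero I Y w) := by
  refine Eq.trans ?_ (homColimEquiv_naturality I f _)
  refine congrArg (homColimEquiv I Y') ?_
  have h : extIntoMap 0 f ≫ (extZeroIso Y').hom =
      (extZeroIso Y).hom ≫ (linearYoneda R (ModuleCat.{u} R)).map f := by
    rw [← Iso.inv_comp_eq, ← Category.assoc, extZeroIso_inv_naturality, Category.assoc,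
      Iso.inv_hom_id, Category.comp_id]
  have h2 : lcMap I 0 f ≫ colim.map (Functor.whiskerLeft (quotPowers I) (extZeroIso Y').hom) =
      colim.map (Functor.whiskerLeft (quotPowers I) (extZeroIso Y).hom) ≫
        colim.map (Functor.whiskerLeft (quotPowers I)
          ((linearYoneda R (ModuleCat.{u} R)).map f)) := by
    unfold lcMap
    rw [← Functor.map_comp, ← Functor.map_comp, ← Functor.whiskerLeft_comp,
      ← Functor.whiskerLeft_comp, h]
  exact ConcreteCategory.congr_hom h2 w

end LocalCohomologyColimit

section CechComparison

open Limits DiffModule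

variable {R} [IsNoetherianRing R]

lemma exists_injective_shortExact (N : Type u) [AddCommGroup N] [Module R N] :
    ∃ S : ShortComplex (ModuleCat.{u} R), S.ShortExact ∧ Injective S.X₂ ∧
      S.X₁ = ModuleCat.of R N := by
  refine ⟨ShortComplex.mk (Injective.ι (ModuleCat.of R N)) (cokernel.π _)
    (cokernel.condition _), ?_, inferInstance, rfl⟩
  exact { exact := ShortComplex.exact_cokernel _, mono_f := inferInstance, epi_g := inferInstance }

lemma localCohomology_equiv_cech (xs : List R) (k : ℤ) (i : ℕ) (N : ModuleCat.{u} R) :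
    Nonempty ((colim.obj (lcDiagram (Ideal.span {x : R | x ∈ xs}) i N) : ModuleCat.{u} R) ≃ₗ[R]
      (cech xs (single N k)).Coh (k + i)) := by
  induction i generalizing N with
  | zero =>
    rw [Nat.cast_zero, add_zero]
    exact ⟨(lcZero (Ideal.span {x : R | x ∈ xs}) N).trans (cechZero xs N k).symm⟩
  | succ i ih =>
    obtain ⟨S, hS, hJ, hN⟩ := exists_injective_shortExact (R := R) N
    obtain rfl : S.X₁ = N := hN
    have hinj : Module.Injective R S.X₂ := Module.injective_module_of_injective_object R S.X₂
    have hf : Function.Injective S.f.hom := (ModuleCat.mono_iff_injective S.f).1 hS.mono_f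
    have hg : Function.Surjective S.g.hom := (ModuleCat.epi_iff_surjective S.g).1 hS.epi_g
    have hfg : Function.Exact S.f.hom S.g.hom :=
      (ShortComplex.ShortExact.moduleCat_exact_iff_function_exact S).1 hS.exact
    cases i with
    | zero =>
      obtain ⟨e⟩ := nonempty_equiv_coker (lcZero (Ideal.span {x : R | x ∈ xs}) S.X₂)
        (lcZero (Ideal.span {x : R | x ∈ xs}) S.X₃) (lcZero_naturality _ S.g)
        (δ := (lcδ hS _ 0).hom) (lcδ_surjective hS _ 0) (exact_lcMap_lcδ hS _ 0)
      obtain ⟨e'⟩ := cech_one_equiv hf hfg hg hinj xs k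
      exact ⟨e.trans e'.symm⟩
    | succ i =>
      obtain ⟨e'⟩ := cech_succ_equiv hf hfg hg hinj xs k i
      obtain ⟨e⟩ := ih S.X₃
      exact ⟨(LinearEquiv.ofBijective (lcδ hS _ (i + 1)).hom (lcδ_bijective hS _ i)).symm.trans
        (e.trans e'.symm)⟩

omit [IsNoetherianRing R] in
lemma LC_of_neg (I : Ideal R) {j : ℤ} (hj : ¬ 0 ≤ j) (N : Type u) [AddCommGroup N] [Module R N] :
    Subsingleton (LC R I j N) := by
  unfold LC
  rw [if_neg hj]
  exact inferInstanceAs (Subsingleton PUnit)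

omit [IsNoetherianRing R] in
lemma LC_of_nonneg (I : Ideal R) {j : ℤ} (hj : 0 ≤ j) (N : Type u) [AddCommGroup N] [Module R N] :
    LC R I j N = (localCohomology I j.toNat).obj (ModuleCat.of R N) :=
  if_pos hj

/-- Local cohomology is the cohomology of the Čech complex. -/
lemma LC_equiv_cech {I : Ideal R} (xs : List R) (hI : Ideal.span {x : R | x ∈ xs} = I) (N : Type u)
    [AddCommGroup N] [Module R N] {j k l : ℤ} (h : k + j = l) :
    Nonempty (LC R I j N ≃ₗ[R] (cech xs (single N k)).Coh l) := by
  subst hI h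
  by_cases hj : 0 ≤ j
  · lift j to ℕ using hj
    obtain ⟨e⟩ := localCohomology_equiv_cech xs k j (ModuleCat.of R N)
    exact ⟨(eqToIso (LC_of_nonneg _ (Int.natCast_nonneg j) N) ≪≫
      localCohomologyIso _ j (ModuleCat.of R N)).toLinearEquiv.trans e⟩
  · have h1 : Subsingleton ((cech xs (single N k)).Coh (k + j)) :=
      subsingleton_coh_iff.2 (ex_cech_of_le xs
        (fun l' hl => ex_single (by omega : l' ≠ k)) _ le_rfl)
    have h2 := LC_of_neg (Ideal.span {x : R | x ∈ xs}) hj N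
    exact ⟨{ toFun := fun _ => 0, map_add' := fun _ _ => (add_zero _).symm,
             map_smul' := fun _ _ => (smul_zero _).symm, invFun := fun _ => 0,
             left_inv := fun _ => Subsingleton.elim _ _,
             right_inv := fun _ => Subsingleton.elim _ _ }⟩

end CechComparison

/-! ### Bigradings through projections -/

section Gradings

variable {K R}

/-- The integral bidegree of a natural bidegree. -/
abbrev zdeg (a : ℕ × ℕ) : ℤ × ℤ := ((a.1 : ℤ), (a.2 : ℤ))

/-- A bigrading on a module, given by its family of projections. -/
structure Gr (N : Type u) [AddCommGroup N] [Module R N] where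
  π : ℤ × ℤ → N →+ N
  π_π : ∀ a b x, π a (π b x) = if a = b then π b x else 0
  finite : ∀ x, ∃ F : Finset (ℤ × ℤ), ∑ b ∈ F, π b x = x
  π_smul : ∀ a b (r : R) x, r ∈ 𝒜 a → π (zdeg a + b) (r • x) = r • π b x

namespace Gr

variable {𝒜} {N : Type u} [AddCommGroup N] [Module R N] (g : Gr 𝒜 N)

lemma π_self (a : ℤ × ℤ) (x : N) : g.π a (g.π a x) = g.π a x := by simp [g.π_π]

lemma π_of_ne {a b : ℤ × ℤ} (h : a ≠ b) (x : N) : g.π a (g.π b x) = 0 := by simp [g.π_π, h]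

lemma exists_support (x : N) : ∃ F : Finset (ℤ × ℤ), ∀ b ∉ F, g.π b x = 0 := by
  obtain ⟨F, hF⟩ := g.finite x
  refine ⟨F, fun b hb => ?_⟩
  rw [← hF, map_sum]
  refine Finset.sum_eq_zero fun c hc => g.π_of_ne ?_ x
  rintro rfl
  exact hb hc

variable {g} in
lemma eq_zero_of_π {x : N} (h : ∀ b, g.π b x = 0) : x = 0 := by
  obtain ⟨F, hF⟩ := g.finite x
  rw [← hF]
  exact Finset.sum_eq_zero fun b _ => h b

variable {g} in
lemma eq_of_π {x y : N} (h : ∀ b, g.π b x = g.π b y) : x = y :=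
  sub_eq_zero.1 (g.eq_zero_of_π fun b => by rw [map_sub, h, sub_self])

variable {g} in
lemma sum_eq {x : N} {F : Finset (ℤ × ℤ)} (h : ∀ b ∉ F, g.π b x = 0) : ∑ b ∈ F, g.π b x = x := by
  refine g.eq_of_π fun b => ?_
  rw [map_sum]
  by_cases hb : b ∈ F
  · rw [Finset.sum_eq_single_of_mem b hb fun c _ hc => g.π_of_ne hc.symm x, g.π_self]
  · rw [h b hb]
    refine Finset.sum_eq_zero fun c hc => g.π_of_ne ?_ x
    rintro rfl
    exact hb hc

lemma π_ksmul [GradedAlgebra 𝒜] (c : K) (b : ℤ × ℤ) (x : N) :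
    g.π b (algebraMap K R c • x) = algebraMap K R c • g.π b x := by
  have h := g.π_smul 0 b (algebraMap K R c) x (SetLike.algebraMap_mem_graded 𝒜 c)
  have h0 : zdeg 0 + b = b := by
    change (((0 : ℕ) : ℤ), ((0 : ℕ) : ℤ)) + b = b
    ext <;> simp
  rwa [h0] at h

/-- The bigrading with given projections. -/
def toBigrading [GradedAlgebra 𝒜] : Bigrading K R 𝒜 N where
  grading b := (g.π b).range
  ksmul_mem := by
    rintro c b _ ⟨x, rfl⟩
    exact ⟨algebraMap K R c • x, g.π_ksmul c b x⟩
  internal := by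
    have key : ∀ (v : DirectSum (ℤ × ℤ) fun b => (g.π b).range) (b : ℤ × ℤ),
        g.π b (DirectSum.coeAddMonoidHom (fun b => (g.π b).range) v) = v b := by
      intro v b
      induction v using DirectSum.induction_on with
      | zero => simp
      | of i x =>
        obtain ⟨_, x, rfl⟩ := x
        rw [DirectSum.coeAddMonoidHom_of]
        by_cases h : b = i
        · subst h
          rw [DirectSum.of_eq_same]
          exact g.π_self _ _
        · rw [DirectSum.of_eq_of_ne _ _ _ h]
          exact g.π_of_ne h x
      | add x y hx hy => simp [hx, hy]
    constructor
    · refine (injective_iff_map_eq_zero _).2 fun v hv => ?_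
      refine DFinsupp.ext fun b => Subtype.ext ?_
      have := key v b
      rw [hv, map_zero] at this
      exact this.symm
    · intro x
      obtain ⟨F, hF⟩ := g.finite x
      refine ⟨∑ b ∈ F, DirectSum.of (fun b => (g.π b).range) b ⟨g.π b x, x, rfl⟩, ?_⟩
      rw [map_sum]
      simpa using hF
  compat := by
    rintro a b r _ hr ⟨x, rfl⟩
    exact ⟨r • x, g.π_smul a b r x hr⟩

lemma mem_grading [GradedAlgebra 𝒜] {b : ℤ × ℤ} {x : N} :
    x ∈ g.toBigrading.grading b ↔ g.π b x = x := by
  constructor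
  · rintro ⟨x, rfl⟩
    exact g.π_self b x
  · intro h
    exact ⟨x, h⟩

/-- Transport of a bigrading along an isomorphism. -/
def ofEquiv {N' : Type u} [AddCommGroup N'] [Module R N'] (e : N' ≃ₗ[R] N) : Gr 𝒜 N' where
  π b := (e.symm.toAddEquiv.toAddMonoidHom.comp (g.π b)).comp e.toAddEquiv.toAddMonoidHom
  π_π a b x := by
    change e.symm (g.π a (e (e.symm (g.π b (e x))))) =
      if a = b then e.symm (g.π b (e x)) else 0
    rw [e.apply_symm_apply, g.π_π]
    split_ifs <;> simp
  finite x := by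
    obtain ⟨F, hF⟩ := g.finite (e x)
    refine ⟨F, e.injective ?_⟩
    rw [map_sum]
    change ∑ b ∈ F, e (e.symm (g.π b (e x))) = e x
    simpa using hF
  π_smul a b r x hr := by
    change e.symm (g.π _ (e (r • x))) = r • e.symm (g.π b (e x))
    rw [map_smul, g.π_smul a b r _ hr, map_smul]

lemma ofEquiv_π {N' : Type u} [AddCommGroup N'] [Module R N'] (e : N' ≃ₗ[R] N) (b : ℤ × ℤ)
    (x : N') : e ((g.ofEquiv e).π b x) = g.π b (e x) :=
  e.apply_symm_apply _

end Gr

section OfBigrading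

variable {𝒜} {N : Type u} [AddCommGroup N] [Module R N] (B : Bigrading K R 𝒜 N)

/-- The decomposition of a bigraded module. -/
def Bigrading.equiv : DirectSum (ℤ × ℤ) (fun b => B.grading b) ≃+ N :=
  AddEquiv.ofBijective (DirectSum.coeAddMonoidHom B.grading) B.internal

lemma Bigrading.equiv_of (b : ℤ × ℤ) (x : B.grading b) :
    B.equiv (DirectSum.of (fun b => B.grading b) b x) = x :=
  DirectSum.coeAddMonoidHom_of _ _ _

lemma Bigrading.equiv_symm_of_mem {b : ℤ × ℤ} {x : N} (hx : x ∈ B.grading b) :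
    B.equiv.symm x = DirectSum.of (fun b => B.grading b) b ⟨x, hx⟩ := by
  rw [AddEquiv.symm_apply_eq, B.equiv_of]

/-- The projections of a bigraded module. -/
def Bigrading.proj (b : ℤ × ℤ) : N →+ N :=
  ((B.grading b).subtype.comp (DFinsupp.evalAddMonoidHom b)).comp B.equiv.symm.toAddMonoidHom

lemma Bigrading.proj_mem (b : ℤ × ℤ) (x : N) : B.proj b x ∈ B.grading b :=
  (B.equiv.symm x b).2

lemma Bigrading.proj_of_mem {a b : ℤ × ℤ} {x : N} (hx : x ∈ B.grading b) :
    B.proj a x = if a = b then x else 0 := by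
  change ((B.equiv.symm x a : B.grading a) : N) = _
  rw [B.equiv_symm_of_mem hx]
  split_ifs with h
  · subst h
    rw [DirectSum.of_eq_same]
  · rw [DirectSum.of_eq_of_ne _ _ _ h]
    rfl

lemma Bigrading.exists_sum_proj (x : N) : ∃ F : Finset (ℤ × ℤ), ∑ b ∈ F, B.proj b x = x := by
  classical
  refine ⟨(B.equiv.symm x).support, ?_⟩
  conv_rhs => rw [← B.equiv.apply_symm_apply x, ← DirectSum.sum_support_of (B.equiv.symm x),
    map_sum]
  exact Finset.sum_congr rfl fun b _ => (B.equiv_of b _).symm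

/-- A bigrading as a family of projections. -/
def Bigrading.toGr : Gr 𝒜 N where
  π := B.proj
  π_π a b x := B.proj_of_mem (B.proj_mem b x)
  finite := B.exists_sum_proj
  π_smul a b r x hr := by
    obtain ⟨F, hF⟩ := B.exists_sum_proj x
    conv_lhs => rw [← hF, Finset.smul_sum, map_sum]
    conv_rhs => rw [← hF, map_sum, Finset.smul_sum]
    refine Finset.sum_congr rfl fun c _ => ?_
    rw [B.proj_of_mem (B.compat a c r _ hr (B.proj_mem c x)), B.proj_of_mem (B.proj_mem c x)]
    simp only [zdeg, add_right_inj]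
    split_ifs <;> simp

end OfBigrading

end Gradings

/-! ### Bigraded complexes -/

namespace LocAway

variable {K R 𝒜} {x : R} {e : ℕ × ℕ} {A : Type u} [AddCommGroup A] [Module R A]

lemma zdeg_smul_add (n : ℕ) (e : ℕ × ℕ) (b : ℤ × ℤ) : zdeg (n • e) + b = b + n • zdeg e := by
  ext <;> simp [zdeg, add_comm]

lemma π_pow_smul (g : Gr 𝒜 A) [GradedAlgebra 𝒜] (hx : x ∈ 𝒜 e) (n : ℕ) (b : ℤ × ℤ) (a : A) :
    g.π (b + n • zdeg e) (x ^ n • a) = x ^ n • g.π b a := by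
  rw [← zdeg_smul_add]
  exact g.π_smul _ _ _ _ (SetLike.pow_mem_graded n hx)

lemma exists_π (g : Gr 𝒜 A) [GradedAlgebra 𝒜] (hx : x ∈ 𝒜 e) (b : ℤ × ℤ) :
    ∃ f : LocAway x A →+ LocAway x A, ∀ (n : ℕ) (y : LocAway x A) (a : A),
      x ^ n • y = ι x a → x ^ n • f y = ι x (g.π (b + n • zdeg e) a) := by
  have h1 : ∀ y : LocAway x A, ∃ z : LocAway x A, ∀ (n : ℕ) (a : A),
      x ^ n • y = ι x a → x ^ n • z = ι x (g.π (b + n • zdeg e) a) := by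
    intro y
    obtain ⟨n, a, h⟩ := exists_pow_smul x y
    obtain ⟨z, hz⟩ := exists_div x n (ι x (g.π (b + n • zdeg e) a))
    refine ⟨z, fun n' a' h' => ?_⟩
    have h2 : ι x (x ^ n' • a - x ^ n • a') = 0 := by
      rw [map_sub, map_smul, map_smul, ← h, ← h', smul_comm, sub_self]
    obtain ⟨m, hm⟩ := (ι_eq_zero x).1 h2
    rw [smul_sub, sub_eq_zero, smul_smul, smul_smul, ← pow_add, ← pow_add] at hm
    have h3 := congrArg (g.π (b + (m + n + n') • zdeg e)) hm
    have e1 : b + (m + n + n') • zdeg e = (b + n • zdeg e) + (m + n') • zdeg e := by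
      simp only [add_smul]; abel
    have e2 : b + (m + n + n') • zdeg e = (b + n' • zdeg e) + (m + n) • zdeg e := by
      simp only [add_smul]; abel
    conv_lhs at h3 => rw [e1, π_pow_smul g hx]
    conv_rhs at h3 => rw [e2, π_pow_smul g hx]
    refine sub_eq_zero.1 (eq_zero_of_pow_smul (x := x) (n := m + n) ?_)
    rw [smul_sub, ← map_smul, ← h3, map_smul, ← hz, smul_smul, smul_smul, ← pow_add, ← pow_add,
      sub_eq_zero]
    congr 2
    omega
  choose f hf using h1
  refine ⟨AddMonoidHom.mk' f fun y y' => ?_, fun n y a h => hf y n a h⟩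
  obtain ⟨n, a, h⟩ := exists_pow_smul x y
  obtain ⟨n', a', h'⟩ := exists_pow_smul x y'
  have h1 : x ^ (n' + n) • y = ι x (x ^ n' • a) := by rw [pow_add, mul_smul, h, map_smul]
  have h2 : x ^ (n' + n) • y' = ι x (x ^ n • a') := by
    rw [add_comm, pow_add, mul_smul, h', map_smul]
  have h3 : x ^ (n' + n) • (y + y') = ι x (x ^ n' • a + x ^ n • a') := by
    rw [smul_add, h1, h2, map_add]
  refine sub_eq_zero.1 (eq_zero_of_pow_smul (x := x) (n := n' + n) ?_)
  rw [smul_sub, smul_add, hf _ _ _ h1, hf _ _ _ h2, hf _ _ _ h3, map_add, map_add, sub_self]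

/-- The projections of the localization at a homogeneous element. -/
def π (g : Gr 𝒜 A) [GradedAlgebra 𝒜] (hx : x ∈ 𝒜 e) (b : ℤ × ℤ) : LocAway x A →+ LocAway x A :=
  (exists_π g hx b).choose

lemma π_spec (g : Gr 𝒜 A) [GradedAlgebra 𝒜] (hx : x ∈ 𝒜 e) (b : ℤ × ℤ) {n : ℕ} {y : LocAway x A}
    {a : A} (h : x ^ n • y = ι x a) : x ^ n • π g hx b y = ι x (g.π (b + n • zdeg e) a) :=
  (exists_π g hx b).choose_spec n y a h

lemma π_ι (g : Gr 𝒜 A) [GradedAlgebra 𝒜] (hx : x ∈ 𝒜 e) (b : ℤ × ℤ) (a : A) :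
    π g hx b (ι x a) = ι x (g.π b a) := by
  have := π_spec g hx b (n := 0) (y := ι x a) (a := a) (by simp)
  simpa using this

lemma π_map {B : Type u} [AddCommGroup B] [Module R B] [GradedAlgebra 𝒜] (g : Gr 𝒜 A)
    (g' : Gr 𝒜 B) (hx : x ∈ 𝒜 e) {f : A →ₗ[R] B} {b : ℤ × ℤ}
    (hf : ∀ b a, f (g.π b a) = g'.π b (f a)) (y : LocAway x A) :
    LocAway.map x f (π g hx b y) = π g' hx b (LocAway.map x f y) := by
  obtain ⟨n, a, h⟩ := exists_pow_smul x y
  refine sub_eq_zero.1 (eq_zero_of_pow_smul (x := x) (n := n) ?_)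
  rw [smul_sub, ← map_smul, π_spec g hx b h, LocAway.map_ι, hf,
    π_spec g' hx b (a := f a) (by rw [← map_smul, h, LocAway.map_ι]), sub_self]

/-- The bigrading of the localization at a homogeneous element. -/
def gr (g : Gr 𝒜 A) [GradedAlgebra 𝒜] (hx : x ∈ 𝒜 e) : Gr 𝒜 (LocAway x A) where
  π := π g hx
  π_π a b y := by
    obtain ⟨n, c, h⟩ := exists_pow_smul x y
    refine sub_eq_zero.1 (eq_zero_of_pow_smul (x := x) (n := n) ?_)
    rw [smul_sub, π_spec g hx a (π_spec g hx b h), g.π_π]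
    simp only [add_left_inj]
    split_ifs
    · rw [π_spec g hx b h, sub_self]
    · simp
  finite y := by
    obtain ⟨n, c, h⟩ := exists_pow_smul x y
    obtain ⟨F, hF⟩ := g.finite c
    refine ⟨F.image (fun b => b - n • zdeg e), ?_⟩
    rw [Finset.sum_image (fun a _ b _ h => by simpa using h)]
    refine sub_eq_zero.1 (eq_zero_of_pow_smul (x := x) (n := n) ?_)
    rw [smul_sub, h, Finset.smul_sum, sub_eq_zero]
    conv_rhs => rw [← hF, map_sum]
    exact Finset.sum_congr rfl fun b _ => by rw [π_spec g hx _ h, sub_add_cancel]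
  π_smul a b r y hr := by
    obtain ⟨n, c, h⟩ := exists_pow_smul x y
    refine sub_eq_zero.1 (eq_zero_of_pow_smul (x := x) (n := n) ?_)
    rw [smul_sub, π_spec g hx _ (a := r • c) (by rw [smul_comm, h, map_smul]), add_assoc,
      g.π_smul _ _ _ _ hr, smul_comm, π_spec g hx _ h, map_smul, sub_self]

end LocAway

namespace DiffModule

variable {K R}

/-- A bigrading on a complex. -/
structure DGr (A : DiffModule R) extends Gr 𝒜 A where
  π_d : ∀ b x, π b (A.d x) = A.d (π b x)
  π_c : ∀ b k x, π b (A.c k x) = A.c k (π b x)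

variable {𝒜} {A B C : DiffModule R}

/-- A morphism is compatible with the bigradings. -/
def Hom.Graded (f : Hom A B) (g : DGr 𝒜 A) (g' : DGr 𝒜 B) : Prop :=
  ∀ b x, f (g.π b x) = g'.π b (f x)

lemma Hom.Graded.comp {f : Hom A B} {f' : Hom B C} {g : DGr 𝒜 A} {g' : DGr 𝒜 B} {g'' : DGr 𝒜 C}
    (hf' : f'.Graded g' g'') (hf : f.Graded g g') : (f'.comp f).Graded g g'' := fun b x => by
  rw [Hom.comp_apply, hf, hf', Hom.comp_apply]

/-- The bigrading of a bigraded module placed in one degree. -/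
def DGr.single {N : Type u} [AddCommGroup N] [Module R N] (g : Gr 𝒜 N) (k : ℤ) :
    DGr 𝒜 (DiffModule.single N k : DiffModule R) where
  toGr := g
  π_d b _ := map_zero (g.π b)
  π_c b l x := by
    change g.π b ((if l = k then LinearMap.id else 0 : N →ₗ[R] N) x) =
      (if l = k then LinearMap.id else 0 : N →ₗ[R] N) (g.π b x)
    split_ifs <;> simp

section

variable [GradedAlgebra 𝒜] {x : R} {e : ℕ × ℕ} (hx : x ∈ 𝒜 e) (g : DGr 𝒜 A)

/-- The bigrading of `loc x A`. -/
def DGr.loc : DGr 𝒜 (DiffModule.loc x A) where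
  toGr := LocAway.gr g.toGr hx
  π_d b y := by
    change LocAway.π g.toGr hx b (-LocAway.map x A.d y) =
      -LocAway.map x A.d (LocAway.π g.toGr hx b y)
    rw [map_neg, LocAway.π_map g.toGr g.toGr hx fun b a => (g.π_d b a).symm]
  π_c b k y := (LocAway.π_map g.toGr g.toGr hx (fun b a => (g.π_c b _ a).symm) y).symm

/-- The bigrading of `tel x A`. -/
def DGr.tel : DGr 𝒜 (DiffModule.tel x A) where
  π b := AddMonoidHom.prodMap (g.π b) ((g.loc hx).π b)
  π_π a b y := by
    refine Prod.ext ?_ ?_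
    · refine (g.π_π a b y.1).trans ?_
      split_ifs <;> rfl
    · refine ((g.loc hx).π_π a b y.2).trans ?_
      split_ifs <;> rfl
  finite y := by
    obtain ⟨F, hF⟩ := g.exists_support y.1
    obtain ⟨F', hF'⟩ := (g.loc hx).exists_support y.2
    refine ⟨F ∪ F', Prod.ext ?_ ?_⟩
    · rw [Prod.fst_sum]
      exact Gr.sum_eq fun b hb => hF b fun h => hb (Finset.mem_union_left _ h)
    · rw [Prod.snd_sum]
      exact Gr.sum_eq fun b hb => hF' b fun h => hb (Finset.mem_union_right _ h)
  π_smul a b r y hr := Prod.ext (g.π_smul a b r y.1 hr) ((g.loc hx).π_smul a b r y.2 hr)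
  π_d b y := by
    refine Prod.ext (g.π_d b y.1) ?_
    change LocAway.π g.toGr hx b (LocAway.ι x y.1 - LocAway.map x A.d y.2) =
      LocAway.ι x (g.π b y.1) - LocAway.map x A.d (LocAway.π g.toGr hx b y.2)
    rw [map_sub, LocAway.π_ι, LocAway.π_map g.toGr g.toGr hx fun b a => (g.π_d b a).symm]
  π_c b k y := Prod.ext (g.π_c b k y.1) ((g.loc hx).π_c b k y.2)

lemma graded_telFst : (telFst x : Hom (DiffModule.tel x A) A).Graded (g.tel hx) g := fun _ _ => rfl

lemma graded_telInr : (telInr x : Hom (DiffModule.loc x A) (DiffModule.tel x A)).Graded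
    (g.loc hx) (g.tel hx) := fun b _ => Prod.ext (map_zero (g.π b)).symm rfl

end

/-- The bigrading of the Čech complex of homogeneous elements of the same degree. -/
def DGr.cech [GradedAlgebra 𝒜] {e : ℕ × ℕ} : (xs : List R) → (∀ x ∈ xs, x ∈ 𝒜 e) →
    {A : DiffModule R} → DGr 𝒜 A → DGr 𝒜 (cech xs A)
  | [], _, _, g => g
  | x :: xs, h, _, g => DGr.cech xs (fun y hy => h y (List.mem_cons_of_mem _ hy))
      (g.tel (h x List.mem_cons_self))

lemma graded_cechFst [GradedAlgebra 𝒜] {e : ℕ × ℕ} (xs : List R) (h : ∀ x ∈ xs, x ∈ 𝒜 e)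
    {A : DiffModule R} (g : DGr 𝒜 A) : (cechFst xs A).Graded (g.cech xs h) g := by
  induction xs generalizing A with
  | nil => exact fun _ _ => rfl
  | cons x xs ih =>
    exact (graded_telFst (h x List.mem_cons_self) g).comp
      (ih (fun y hy => h y (List.mem_cons_of_mem _ hy)) _)

/-! #### Bigradings bounded below in the first degree -/

/-- The components of first degree less than `i₀` vanish. -/
def _root_.Gr.Low {N : Type u} [AddCommGroup N] [Module R N] (g : Gr 𝒜 N) (i₀ : ℤ) : Prop :=
  ∀ b : ℤ × ℤ, b.1 < i₀ → ∀ x, g.π b x = 0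

lemma _root_.Gr.Low.cech [GradedAlgebra 𝒜] {i₀ : ℤ} (xs : List R) (h : ∀ x ∈ xs, x ∈ 𝒜 (0, 1))
    {A : DiffModule R} {g : DGr 𝒜 A} (hg : g.toGr.Low i₀) : (g.cech xs h).toGr.Low i₀ := by
  induction xs generalizing A with
  | nil => exact hg
  | cons x xs ih =>
    refine ih (fun y hy => h y (List.mem_cons_of_mem _ hy)) fun b hb y => Prod.ext (hg b hb _) ?_
    obtain ⟨n, a, hn⟩ := LocAway.exists_pow_smul x y.2
    refine LocAway.eq_zero_of_pow_smul (x := x) (n := n)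
      ((LocAway.π_spec g.toGr (h x List.mem_cons_self) b hn).trans ?_)
    rw [hg _ (by simpa [zdeg] using hb), map_zero]

lemma exists_low [GradedAlgebra 𝒜] {N : Type u} [AddCommGroup N] [Module R N] [Module.Finite R N]
    (g : Gr 𝒜 N) : ∃ i₀, g.Low i₀ := by
  classical
  let W : ℤ → Submodule R N := fun i₀ =>
    { carrier := {x | ∀ b : ℤ × ℤ, b.1 < i₀ → g.π b x = 0}
      zero_mem' := fun b _ => map_zero _
      add_mem' := fun {x y} hx hy b hb => by rw [map_add, hx b hb, hy b hb, add_zero]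
      smul_mem' := fun r x hx b hb => by
        rw [← DirectSum.sum_support_decompose 𝒜 r, Finset.sum_smul, map_sum]
        refine Finset.sum_eq_zero fun a _ => ?_
        have h := g.π_smul a (b - zdeg a) _ x (DirectSum.decompose 𝒜 r a).2
        rw [add_sub_cancel] at h
        rw [h, hx _ (by simp [zdeg]; omega), smul_zero] }
  have hW : ∀ x : N, ∃ i₀, x ∈ W i₀ := by
    intro x
    obtain ⟨F, hF⟩ := g.exists_support x
    obtain ⟨i₀, hi⟩ := (F.image Prod.fst).bddBelow
    refine ⟨i₀, fun b hb => hF b fun hb' => ?_⟩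
    have := hi (Finset.mem_coe.2 (Finset.mem_image_of_mem Prod.fst hb'))
    omega
  have hanti : ∀ {i j : ℤ}, i ≤ j → W j ≤ W i := fun hij x hx b hb => hx b (by omega)
  obtain ⟨S, hS⟩ := Module.Finite.fg_top (R := R) (M := N)
  choose t ht using hW
  obtain ⟨i₀, hi⟩ := (S.image t).bddBelow
  refine ⟨i₀, fun b hb x => ?_⟩
  have h1 : (⊤ : Submodule R N) ≤ W i₀ := by
    rw [← hS, Submodule.span_le]
    exact fun y hy => hanti (hi (Finset.mem_coe.2 (Finset.mem_image_of_mem t hy))) (ht y)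
  exact h1 (Submodule.mem_top (x := x)) b hb

/-! #### The bigrading of the cohomology -/

section Coh

variable (g : DGr 𝒜 A) (k : ℤ)

/-- The projections on cocycles. -/
def DGr.πZ (b : ℤ × ℤ) : A.Z k →+ A.Z k :=
  ((g.π b).comp (A.Z k).subtype.toAddMonoidHom).codRestrict (A.Z k) fun x => by
    constructor
    · exact (g.π_d b x).symm.trans (by rw [x.2.1, map_zero])
    · exact (g.π_c b k x).symm.trans (by rw [x.2.2]; rfl)

/-- The projections on the cohomology. -/
def DGr.πCoh (b : ℤ × ℤ) : A.Coh k →+ A.Coh k :=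
  QuotientAddGroup.map _ _ (g.πZ k b) (by
    rintro x ⟨w, hw⟩
    refine ⟨g.π b w, ?_⟩
    rw [← g.π_d, hw]
    rfl)

@[simp] lemma DGr.πCoh_cls (b : ℤ × ℤ) (x : A.Z k) :
    g.πCoh k b (A.cls k x) = A.cls k (g.πZ k b x) := rfl

/-- The bigrading of the cohomology. -/
def DGr.coh : Gr 𝒜 (A.Coh k) where
  π := g.πCoh k
  π_π a b y := by
    obtain ⟨x, rfl⟩ := cls_surjective k y
    have h : g.πZ k a (g.πZ k b x) = if a = b then g.πZ k b x else 0 := by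
      refine Subtype.ext ((g.π_π a b x).trans ?_)
      split_ifs <;> rfl
    rw [g.πCoh_cls, g.πCoh_cls, h]
    split_ifs <;> simp
  finite y := by
    obtain ⟨x, rfl⟩ := cls_surjective k y
    obtain ⟨F, hF⟩ := g.finite (x : A)
    refine ⟨F, ?_⟩
    have h : ∑ b ∈ F, g.πZ k b x = x := Subtype.ext (by
      rw [AddSubmonoidClass.coe_finsetSum]
      exact hF)
    conv_rhs => rw [← h, map_sum]
    rfl
  π_smul a b r y hr := by
    obtain ⟨x, rfl⟩ := cls_surjective k y
    rw [← map_smul, g.πCoh_cls, g.πCoh_cls, ← map_smul]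
    exact congrArg _ (Subtype.ext (g.π_smul a b r x hr))

end Coh

end DiffModule

/-! ### Graded duals -/

section GradedDual

variable {K R} {𝒜}

/-- `K`-linearity of an additive functional on an `R`-module. -/
def IsKLin (R : Type u) [CommRing R] [Algebra K R] {N : Type u} [AddCommGroup N] [Module R N]
    (φ : N →+ K) : Prop :=
  ∀ (c : K) (x : N), φ (algebraMap K R c • x) = c * φ x

lemma IsKLin.exists_extension {N N' : Type u} [AddCommGroup N] [Module R N] [AddCommGroup N']
    [Module R N'] {φ : N →+ K} (hφ : IsKLin R φ) (f : N →ₗ[R] N') (h : ∀ x, f x = 0 → φ x = 0) :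
    ∃ ψ : N' →+ K, IsKLin R ψ ∧ ∀ x, ψ (f x) = φ x := by
  let : Module K N := Module.compHom N (algebraMap K R)
  let : Module K N' := Module.compHom N' (algebraMap K R)
  let φ' : N →ₗ[K] K := { toFun := φ, map_add' := map_add φ, map_smul' := hφ }
  let f' : N →ₗ[K] N' :=
    { toFun := f, map_add' := map_add f, map_smul' := fun c x => map_smul f (algebraMap K R c) x }
  have hk : LinearMap.ker f' ≤ LinearMap.ker φ' := fun x hx => h x hx
  obtain ⟨ψ, hψ⟩ := LinearMap.exists_extend
    ((LinearMap.ker f').liftQ φ' hk ∘ₗ f'.quotKerEquivRange.symm.toLinearMap)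
  refine ⟨ψ.toAddMonoidHom, fun c x => ψ.map_smul c x, fun x => ?_⟩
  have h1 := LinearMap.congr_fun hψ ⟨f' x, x, rfl⟩
  refine h1.trans ?_
  have h2 : f'.quotKerEquivRange.symm ⟨f' x, x, rfl⟩ = Submodule.Quotient.mk x :=
    (LinearEquiv.symm_apply_eq _).2 rfl
  change (LinearMap.ker f').liftQ φ' hk (f'.quotKerEquivRange.symm ⟨f' x, x, rfl⟩) = φ x
  rw [h2]
  rfl

namespace Gr

variable {N N' N'' : Type u} [AddCommGroup N'] [Module R N'] [AddCommGroup N''] [Module R N'']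
  [AddCommGroup N] [Module R N]

/-- The functionals of finite support. -/
def dualSubgroup (g : Gr 𝒜 N) : AddSubgroup (N →+ K) where
  carrier := {φ | IsKLin R φ ∧ ∃ F : Finset (ℤ × ℤ), ∀ b ∉ F, ∀ x, φ (g.π b x) = 0}
  zero_mem' := ⟨fun c x => by simp, ∅, fun b _ x => rfl⟩
  add_mem' := by
    rintro φ ψ ⟨h1, F, hF⟩ ⟨h2, F', hF'⟩
    refine ⟨fun c x => ?_, F ∪ F', fun b hb x => ?_⟩
    · rw [AddMonoidHom.add_apply, h1, h2, AddMonoidHom.add_apply, mul_add]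
    · rw [AddMonoidHom.add_apply, hF b fun h => hb (Finset.mem_union_left _ h),
        hF' b fun h => hb (Finset.mem_union_right _ h), add_zero]
  neg_mem' := by
    rintro φ ⟨h1, F, hF⟩
    refine ⟨fun c x => ?_, F, fun b hb x => ?_⟩
    · rw [AddMonoidHom.neg_apply, h1, AddMonoidHom.neg_apply, mul_neg]
    · rw [AddMonoidHom.neg_apply, hF b hb, neg_zero]

/-- The graded dual. -/
def Dual (g : Gr 𝒜 N) : Type u := g.dualSubgroup

instance (g : Gr 𝒜 N) : AddCommGroup g.Dual := inferInstanceAs (AddCommGroup g.dualSubgroup)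

variable {g : Gr 𝒜 N} {g' : Gr 𝒜 N'} {g'' : Gr 𝒜 N''}

instance : FunLike g.Dual N K where
  coe φ := φ.1
  coe_injective φ ψ h := Subtype.ext (AddMonoidHom.ext fun x => congrFun h x)

instance : AddMonoidHomClass g.Dual N K where
  map_add φ := map_add φ.1
  map_zero φ := map_zero φ.1

namespace Dual

@[ext] lemma ext {φ ψ : g.Dual} (h : ∀ x, φ x = ψ x) : φ = ψ := DFunLike.ext _ _ h

@[simp] lemma zero_apply (x : N) : (0 : g.Dual) x = 0 := rfl

/-- Evaluation. -/
def eval (x : N) : g.Dual →+ K where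
  toFun φ := φ x
  map_zero' := rfl
  map_add' _ _ := rfl

lemma sum_apply {ι : Type*} (F : Finset ι) (φ : ι → g.Dual) (x : N) :
    (∑ i ∈ F, φ i) x = ∑ i ∈ F, φ i x :=
  map_sum (eval x) φ F

lemma ksmul (φ : g.Dual) (c : K) (x : N) : φ (algebraMap K R c • x) = c * φ x := φ.2.1 c x

lemma exists_support (φ : g.Dual) : ∃ F : Finset (ℤ × ℤ), ∀ b ∉ F, ∀ x, φ (g.π b x) = 0 := φ.2.2

/-- A functional of finite support. -/
def mk (φ : N →+ K) (h : IsKLin R φ) (F : Finset (ℤ × ℤ)) (hF : ∀ b ∉ F, ∀ x, φ (g.π b x) = 0) :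
    g.Dual := ⟨φ, h, F, hF⟩

lemma exists_support_smul [GradedAlgebra 𝒜] (r : R) (φ : g.Dual) :
    ∃ F : Finset (ℤ × ℤ), ∀ b ∉ F, ∀ x, φ (r • g.π b x) = 0 := by
  obtain ⟨F, hF⟩ := φ.exists_support
  induction r using DirectSum.Decomposition.inductionOn 𝒜 with
  | zero => exact ⟨∅, fun b _ x => by rw [zero_smul, map_zero]⟩
  | homogeneous r =>
    rename_i a
    refine ⟨F.image fun b => b - zdeg a, fun b hb x => ?_⟩
    rw [← g.π_smul a b _ x r.2]
    refine hF _ (fun h => hb ?_) _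
    exact Finset.mem_image.2 ⟨_, h, add_sub_cancel_left _ _⟩
  | add r s hr hs =>
    obtain ⟨F, hF⟩ := hr
    obtain ⟨F', hF'⟩ := hs
    exact ⟨F ∪ F', fun b hb x => by
      rw [add_smul, map_add, hF b fun h => hb (Finset.mem_union_left _ h),
        hF' b fun h => hb (Finset.mem_union_right _ h), add_zero]⟩

instance [GradedAlgebra 𝒜] : Module R g.Dual where
  smul r φ := mk (φ.1.comp (DistribSMul.toAddMonoidHom N r))
    (fun c x => by
      change φ (r • algebraMap K R c • x) = c * φ (r • x)
      rw [smul_comm, φ.ksmul]) (exists_support_smul r φ).choose (exists_support_smul r φ).choose_spec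
  one_smul φ := ext fun x => congrArg φ (one_smul R x)
  mul_smul r s φ := ext fun x =>
    congrArg φ (show (r * s) • x = s • r • x by rw [mul_comm, mul_smul])
  smul_zero r := rfl
  smul_add r φ ψ := rfl
  add_smul r s φ := ext fun x => (congrArg φ (add_smul r s x)).trans (map_add φ _ _)
  zero_smul φ := ext fun x => (congrArg φ (zero_smul R x)).trans (map_zero φ)

variable [GradedAlgebra 𝒜]

@[simp] lemma smul_apply (r : R) (φ : g.Dual) (x : N) : (r • φ) x = φ (r • x) := rfl

/-- The transpose of a graded map. -/
def map (f : N →ₗ[R] N') (hf : ∀ b x, f (g.π b x) = g'.π b (f x)) : g'.Dual →ₗ[R] g.Dual where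
  toFun φ := mk (φ.1.comp f.toAddMonoidHom)
    (fun c x => (congrArg φ (map_smul f _ x)).trans (φ.ksmul c (f x)))
    φ.exists_support.choose
    (fun b hb x => (congrArg φ (hf b x)).trans (φ.exists_support.choose_spec b hb (f x)))
  map_add' _ _ := rfl
  map_smul' r φ := ext fun x => (congrArg φ (map_smul f r x)).symm

@[simp] lemma map_apply (f : N →ₗ[R] N') (hf : ∀ b x, f (g.π b x) = g'.π b (f x)) (φ : g'.Dual)
    (x : N) : map f hf φ x = φ (f x) := rfl

lemma map_eq_sum (φ : g.Dual) {F : Finset (ℤ × ℤ)} (hF : ∀ b ∉ F, ∀ x, φ (g.π b x) = 0) (x : N) :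
    ∑ b ∈ F, φ (g.π b x) = φ x := by
  obtain ⟨F', hF'⟩ := g.exists_support x
  rw [Finset.sum_subset (Finset.subset_union_left (s₂ := F')) fun b _ hb => hF b hb x, ← map_sum,
    Gr.sum_eq fun b hb => hF' b fun h => hb (Finset.mem_union_right _ h)]

/-- A functional on the source of a graded map which kills the kernel extends to the target. -/
lemma exists_map_eq (f : N →ₗ[R] N') (hf : ∀ b x, f (g.π b x) = g'.π b (f x)) (φ : g.Dual)
    (h : ∀ x, f x = 0 → φ x = 0) : ∃ ψ : g'.Dual, map f hf ψ = φ := by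
  obtain ⟨ψ, hψ, hψ'⟩ := IsKLin.exists_extension φ.2.1 f h
  obtain ⟨F, hF⟩ := φ.exists_support
  refine ⟨mk (∑ b ∈ F, ψ.comp (g'.π b)) (fun c x => ?_) F (fun b hb x => ?_), ext fun x => ?_⟩
  · rw [AddMonoidHom.finsetSum_apply, AddMonoidHom.finsetSum_apply, Finset.mul_sum]
    refine Finset.sum_congr rfl fun b _ => ?_
    rw [AddMonoidHom.comp_apply, g'.π_ksmul, hψ, AddMonoidHom.comp_apply]
  · rw [AddMonoidHom.finsetSum_apply]
    refine Finset.sum_eq_zero fun c hc => ?_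
    rw [AddMonoidHom.comp_apply, g'.π_of_ne, map_zero]
    rintro rfl
    exact hb hc
  · change (∑ b ∈ F, ψ.comp (g'.π b)) (f x) = φ x
    rw [AddMonoidHom.finsetSum_apply, ← map_eq_sum φ hF]
    refine Finset.sum_congr rfl fun b _ => ?_
    rw [AddMonoidHom.comp_apply, ← hf]
    exact hψ' _

lemma map_injective {f : N →ₗ[R] N'} {hf : ∀ b x, f (g.π b x) = g'.π b (f x)}
    (h : Function.Surjective f) : Function.Injective (map f hf) := fun φ ψ hφ => ext fun y => by
  obtain ⟨x, rfl⟩ := h y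
  exact DFunLike.congr_fun hφ x

lemma map_surjective {f : N →ₗ[R] N'} {hf : ∀ b x, f (g.π b x) = g'.π b (f x)}
    (h : Function.Injective f) : Function.Surjective (map f hf) := fun φ =>
  exists_map_eq f hf φ fun x hx => by rw [(map_eq_zero_iff f h).1 hx, map_zero]

lemma map_exact {f : N →ₗ[R] N'} {f' : N' →ₗ[R] N''} {hf : ∀ b x, f (g.π b x) = g'.π b (f x)}
    {hf' : ∀ b x, f' (g'.π b x) = g''.π b (f' x)} (h : ∀ y, f' y = 0 ↔ ∃ x, f x = y)
    (φ : g'.Dual) :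
    map f hf φ = 0 ↔ ∃ ψ, map f' hf' ψ = φ := by
  constructor
  · intro hφ
    refine exists_map_eq f' hf' φ fun y hy => ?_
    obtain ⟨x, rfl⟩ := (h y).1 hy
    exact DFunLike.congr_fun hφ x
  · rintro ⟨ψ, rfl⟩
    refine ext fun x => ?_
    rw [map_apply, map_apply, (h _).2 ⟨x, rfl⟩, map_zero, zero_apply]

/-- The projections of the graded dual. -/
def π (g : Gr 𝒜 N) (b : ℤ × ℤ) : g.Dual →+ g.Dual where
  toFun φ := mk (φ.1.comp (g.π (-b)))
    (fun c x => (congrArg φ (g.π_ksmul c _ x)).trans (φ.ksmul c _)) {-b}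
    (fun c hc x => (congrArg φ (g.π_of_ne (by simpa [eq_comm] using hc) x)).trans (map_zero φ))
  map_zero' := rfl
  map_add' _ _ := rfl

@[simp] lemma π_apply (b : ℤ × ℤ) (φ : g.Dual) (x : N) : π g b φ x = φ (g.π (-b) x) := rfl

/-- The bigrading of the graded dual. -/
def gr (g : Gr 𝒜 N) : Gr 𝒜 g.Dual where
  π := π g
  π_π a b φ := ext fun x => by
    rw [π_apply, π_apply, g.π_π]
    by_cases h : a = b
    · subst h
      rw [if_pos rfl, if_pos rfl, π_apply]
    · rw [if_neg h, if_neg (fun h' => h (neg_injective h').symm), map_zero, zero_apply]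
  finite φ := by
    obtain ⟨F, hF⟩ := φ.exists_support
    refine ⟨F.image fun b => -b, ext fun x => ?_⟩
    rw [sum_apply, Finset.sum_image (fun a _ b _ h => neg_injective h), ← map_eq_sum φ hF]
    exact Finset.sum_congr rfl fun b _ => by rw [π_apply, neg_neg]
  π_smul a b r φ hr := ext fun x => by
    rw [π_apply, smul_apply, smul_apply, π_apply, ← g.π_smul a _ r x hr]
    congr 2
    abel_nf

end Dual

end Gr

namespace DiffModule

variable {A B C : DiffModule R} [GradedAlgebra 𝒜]

/-- The graded dual of a bigraded complex. -/
@[reducible] def DGr.dual (g : DGr 𝒜 A) : DiffModule R where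
  carrier := g.toGr.Dual
  d := Gr.Dual.map A.d fun b x => (g.π_d b x).symm
  c k := Gr.Dual.map (A.c (-k)) fun b x => (g.π_c b _ x).symm
  d_d φ := Gr.Dual.ext fun x => by
    rw [Gr.Dual.map_apply, Gr.Dual.map_apply, A.d_d, map_zero, Gr.Dual.zero_apply]
  c_c k l φ := Gr.Dual.ext fun x => by
    rw [Gr.Dual.map_apply, Gr.Dual.map_apply, A.c_c]
    by_cases h : k = l
    · subst h
      rw [if_pos rfl, if_pos rfl, Gr.Dual.map_apply]
    · rw [if_neg h, if_neg (by omega), map_zero, Gr.Dual.zero_apply]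
  c_d k φ := Gr.Dual.ext fun x => by
    rw [Gr.Dual.map_apply, Gr.Dual.map_apply, Gr.Dual.map_apply, Gr.Dual.map_apply, A.c_d']
    congr 4
    ring
  c_sum := by
    obtain ⟨F, hF⟩ := A.c_sum
    refine ⟨F.image fun k => -k, fun φ => Gr.Dual.ext fun x => ?_⟩
    rw [Gr.Dual.sum_apply, Finset.sum_image (fun a _ b _ h => neg_injective h)]
    conv_rhs => rw [← hF x, map_sum]
    exact Finset.sum_congr rfl fun k _ => by rw [Gr.Dual.map_apply, neg_neg]

variable (g : DGr 𝒜 A) (g' : DGr 𝒜 B) (g'' : DGr 𝒜 C)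

lemma DGr.dual_d (φ : g.dual) (x : A) : (g.dual.d φ : g.toGr.Dual) x = φ (A.d x) := rfl

lemma DGr.dual_c (k : ℤ) (φ : g.dual) (x : A) :
    (g.dual.c k φ : g.toGr.Dual) x = φ (A.c (-k) x) := rfl

/-- The bigrading of the graded dual of a complex. -/
def DGr.dualGr : DGr 𝒜 g.dual where
  toGr := Gr.Dual.gr g.toGr
  π_d b φ := Gr.Dual.ext fun x => congrArg φ (g.π_d (-b) x).symm
  π_c b k φ := Gr.Dual.ext fun x => congrArg φ (g.π_c (-b) (-k) x).symm

variable {g g' g''}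

/-- The transpose of a graded morphism. -/
def Hom.Graded.dual {f : Hom A B} (hf : f.Graded g g') : Hom g'.dual g.dual where
  toLin := Gr.Dual.map f.toLin hf
  map_d φ := Gr.Dual.ext fun x => congrArg φ (f.map_d x).symm
  map_c k φ := Gr.Dual.ext fun x => congrArg φ (f.map_c (-k) x).symm

lemma SES.dual {f : Hom A B} {f' : Hom B C} (S : SES f f') (hf : f.Graded g g')
    (hf' : f'.Graded g' g'') : SES hf'.dual hf.dual where
  inj := Gr.Dual.map_injective (hf := hf') S.surj
  exact φ := Gr.Dual.map_exact (hf := hf) (hf' := hf') S.exact φ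
  surj := Gr.Dual.map_surjective (hf := hf) S.inj

/-- A cocycle of the dual which vanishes on all cocycles is a coboundary. -/
lemma DGr.exists_eq_dual_d {k l : ℤ} (h : k + l = 0) {φ : g.dual} (hφ : g.dual.c l φ = φ)
    (hz : ∀ z ∈ A.Z k, (φ : g.toGr.Dual) z = 0) : ∃ ψ, φ = g.dual.d ψ := by
  obtain ⟨ψ, hψ⟩ := Gr.Dual.exists_map_eq (g := g.toGr) (g' := g.toGr) A.d
    (fun b x => (g.π_d b x).symm) φ fun x hx => by
      have h1 := DFunLike.congr_fun (F := g.toGr.Dual) hφ x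
      rw [← h1]
      change (φ : g.toGr.Dual) (A.c (-l) x) = 0
      obtain rfl : -l = k := by omega
      exact hz _ ⟨d_c_of_d hx _, A.c_self _ _⟩
  exact ⟨ψ, hψ.symm⟩

lemma DGr.dual_cocycle_apply_d {φ : g.dual} (hφ : g.dual.d φ = 0) (x : A) :
    (φ : g.toGr.Dual) (A.d x) = 0 :=
  DFunLike.congr_fun (F := g.toGr.Dual) hφ x

lemma DGr.ex_dual {k l : ℤ} (h : k + l = 0) (hA : A.Ex k) : g.dual.Ex l := fun φ hφ hc =>
  g.exists_eq_dual_d h hc fun z hz => by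
    obtain ⟨w, rfl⟩ := hA z hz.1 hz.2
    exact g.dual_cocycle_apply_d hφ w

end DiffModule

end GradedDual

/-! ### Dual data of the cohomology of a bigraded complex -/

section DualDataOfComplex

variable {K R} {𝒜}

namespace DiffModule

variable {A : DiffModule R} [GradedAlgebra 𝒜] (g : DGr 𝒜 A) {k l : ℤ}

/-- A functional which is a cocycle induces a functional on cohomology. -/
def DGr.cohEval (φ : g.dual) (hφ : g.dual.d φ = 0) (k : ℤ) : A.Coh k →+ K :=
  QuotientAddGroup.lift _ ((φ : g.toGr.Dual).1.comp (A.Z k).subtype.toAddMonoidHom) (by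
    rintro x ⟨w, hw⟩
    change (φ : g.toGr.Dual) (x : A) = 0
    have : (x : A) = A.d w := hw.symm
    rw [this]
    exact g.dual_cocycle_apply_d hφ w)

/-- The pairing between the cohomology of the dual and the cohomology. -/
def DGr.cohPairing (k l : ℤ) : g.dual.Coh l →+ A.Coh k →+ K :=
  QuotientAddGroup.lift _
    (AddMonoidHom.mk' (fun φ : g.dual.Z l => g.cohEval φ φ.2.1 k) (by
      intro φ ψ
      ext y
      obtain ⟨x, rfl⟩ := cls_surjective k y
      rfl)) (by
    rintro φ ⟨ψ, hψ⟩
    refine AddMonoidHom.ext fun y => ?_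
    obtain ⟨x, rfl⟩ := cls_surjective k y
    change (φ.1 : g.toGr.Dual) (x : A) = 0
    have : φ.1 = g.dual.d ψ := hψ.symm
    rw [this]
    refine (g.dual_d _ _).trans ?_
    rw [x.2.1, map_zero])

@[simp] lemma DGr.cohPairing_cls (φ : g.dual.Z l) (x : A.Z k) :
    g.cohPairing k l (g.dual.cls l φ) (A.cls k x) = (φ.1 : g.toGr.Dual) x := rfl

lemma DGr.cohPairing_nondeg (h : k + l = 0) (y : g.dual.Coh l)
    (hy : ∀ x, g.cohPairing k l y x = 0) : y = 0 := by
  obtain ⟨φ, rfl⟩ := cls_surjective l y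
  rw [cls_eq_zero]
  exact g.exists_eq_dual_d h φ.2.2 fun z hz => hy (A.cls k ⟨z, hz⟩)

lemma DGr.cohPairing_π (a : ℤ × ℤ) (y : g.dual.Coh l) (x : A.Coh k) :
    g.cohPairing k l ((g.dualGr.coh l).π a y) x = g.cohPairing k l y ((g.coh k).π (-a) x) := by
  obtain ⟨φ, rfl⟩ := cls_surjective l y
  obtain ⟨z, rfl⟩ := cls_surjective k x
  rfl

/-- Every functional on the component of degree `-a` of the cohomology is represented. -/
lemma DGr.exists_cohPairing (h : k + l = 0) (a : ℤ × ℤ) (f : A.Coh k →+ K) (hf : IsKLin R f) :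
    ∃ y, (g.dualGr.coh l).π a y = y ∧ ∀ x, g.cohPairing k l y x = f ((g.coh k).π (-a) x) := by
  obtain ⟨ψ, hψ, hψ'⟩ := IsKLin.exists_extension
    (φ := f.comp (A.cls k).toAddMonoidHom) (fun c x => hf c (A.cls k x)) (A.Z k).subtype (by
      intro x hx
      obtain rfl : x = 0 := Subtype.ext hx
      exact map_zero _)
  let φ : g.dual := Gr.Dual.mk (g := g.toGr)
    ((ψ.comp (g.π (-a))).comp (A.c k).toAddMonoidHom) (fun c x => by
      change ψ (g.π (-a) (A.c k (algebraMap K R c • x))) = c * ψ (g.π (-a) (A.c k x))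
      rw [map_smul, g.π_ksmul, hψ]) {-a} (fun b hb x => by
      change ψ (g.π (-a) (A.c k (g.π b x))) = 0
      rw [← g.π_c, g.π_of_ne (by simpa [eq_comm] using hb), map_zero])
  have hφ : ∀ x, (φ : g.toGr.Dual) x = ψ (g.π (-a) (A.c k x)) := fun x => rfl
  have hd : g.dual.d φ = 0 := Gr.Dual.ext fun x => by
    rw [g.dual_d, hφ, A.c_d', g.π_d]
    have hz : A.d (g.π (-a) (A.c (k - 1) x)) ∈ A.Z k := by
      refine ⟨A.d_d _, ?_⟩
      rw [A.c_d', ← g.π_c, A.c_self]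
    refine (hψ' ⟨_, hz⟩).trans ?_
    change f (A.cls k ⟨_, hz⟩) = 0
    rw [(cls_eq_zero _).2 ⟨_, rfl⟩, map_zero]
  have hc : g.dual.c l φ = φ := Gr.Dual.ext fun x => by
    rw [g.dual_c, hφ, hφ]
    obtain rfl : k = -l := by omega
    rw [A.c_self]
  refine ⟨g.dual.cls l ⟨φ, hd, hc⟩, ?_, fun x => ?_⟩
  · refine congrArg (g.dual.cls l) (Subtype.ext (Gr.Dual.ext fun x => ?_))
    change ψ (g.π (-a) (A.c k (g.π (-a) x))) = ψ (g.π (-a) (A.c k x))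
    rw [← g.π_c, g.π_self]
  · obtain ⟨z, rfl⟩ := cls_surjective k x
    rw [g.cohPairing_cls]
    refine (hφ _).trans ?_
    rw [z.2.2]
    exact hψ' (g.πZ k (-a) z)

/-- The dual data given by the graded dual of a complex. -/
def DGr.dualData (h : k + l = 0) {N : Type u} [AddCommGroup N] [Module R N]
    (e : N ≃ₗ[R] A.Coh k) : DualData K R 𝒜 N where
  src := ((g.coh k).ofEquiv e).toBigrading
  D := g.dual.Coh l
  bg := (g.dualGr.coh l).toBigrading
  pairing := AddMonoidHom.mk'
    (fun y => (g.cohPairing k l y).comp e.toLinearMap.toAddMonoidHom) (fun y y' => by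
      rw [map_add]
      rfl)
  pairing_smul r y x := by
    change g.cohPairing k l (r • y) (e x) = g.cohPairing k l y (e (r • x))
    rw [e.map_smul]
    obtain ⟨φ, rfl⟩ := cls_surjective l y
    obtain ⟨z, hz⟩ := cls_surjective k (e x)
    rw [← hz]
    rfl
  pairing_ksmul c y x := by
    change g.cohPairing k l (algebraMap K R c • y) (e x) = c * g.cohPairing k l y (e x)
    obtain ⟨φ, rfl⟩ := cls_surjective l y
    obtain ⟨z, hz⟩ := cls_surjective k (e x)
    rw [← hz]
    exact (φ.1 : g.toGr.Dual).ksmul c _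
  orth a b hab y hy x hx := by
    change g.cohPairing k l y (e x) = 0
    rw [Gr.mem_grading] at hy hx
    rw [← hy, ← hx, Gr.ofEquiv_π, g.cohPairing_π, Gr.π_of_ne, map_zero]
    rintro rfl
    exact hab (add_neg_cancel a)
  nondeg a y hy hx := by
    rw [Gr.mem_grading] at hy
    refine g.cohPairing_nondeg h y fun x => ?_
    rw [← hy, g.cohPairing_π]
    have := hx (e.symm ((g.coh k).π (-a) x)) (by
      rw [Gr.mem_grading]
      refine e.injective ?_
      rw [Gr.ofEquiv_π, e.apply_symm_apply, Gr.π_self])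
    change g.cohPairing k l y (e _) = 0 at this
    rwa [e.apply_symm_apply] at this
  full a f hf := by
    obtain ⟨y, hy, hyx⟩ := g.exists_cohPairing h a (f.comp e.symm.toLinearMap.toAddMonoidHom)
      (fun c x => by
        change f (e.symm (algebraMap K R c • x)) = c * f (e.symm x)
        rw [map_smul, hf])
    refine ⟨y, Gr.mem_grading _ |>.2 hy, fun x hx => ?_⟩
    rw [Gr.mem_grading] at hx
    change g.cohPairing k l y (e x) = f x
    rw [hyx, ← Gr.ofEquiv_π, hx]
    exact congrArg f (e.symm_apply_apply x)

end DiffModule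

end DualDataOfComplex

/-! ### Čech complexes of graded duals -/

section CechDual

variable {K R} {𝒜}

lemma Gr.Dual.smul_bijective [GradedAlgebra 𝒜] {N : Type u} [AddCommGroup N] [Module R N]
    (g : Gr 𝒜 N) {x : R} {e : ℕ × ℕ} (hx : x ∈ 𝒜 e)
    (h : Function.Bijective (fun y : N => x • y)) :
    Function.Bijective (fun φ : g.Dual => x • φ) := by
  constructor
  · intro φ ψ hφ
    refine Gr.Dual.ext fun y => ?_
    obtain ⟨z, rfl⟩ := h.2 y
    exact DFunLike.congr_fun hφ z
  · intro φ
    let u : N ≃ₗ[R] N := LinearEquiv.ofBijective (LinearMap.lsmul R N x) h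
    have hu : ∀ y, x • u.symm y = y := u.apply_symm_apply
    obtain ⟨F, hF⟩ := φ.exists_support
    refine ⟨Gr.Dual.mk (φ.1.comp u.symm.toLinearMap.toAddMonoidHom) (fun c y => ?_)
      (F.image fun b => zdeg e + b) (fun b hb y => ?_), Gr.Dual.ext fun y => ?_⟩
    · change φ (u.symm (algebraMap K R c • y)) = c * φ (u.symm y)
      rw [map_smul, φ.ksmul]
    · change φ (u.symm (g.π b y)) = 0
      have h1 : u.symm (g.π b y) = g.π (b - zdeg e) (u.symm y) := by
        refine h.1 ?_
        change x • u.symm (g.π b y) = x • g.π (b - zdeg e) (u.symm y)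
        rw [hu, ← g.π_smul _ _ _ _ hx, hu, add_sub_cancel]
      rw [h1]
      refine hF _ (fun h' => hb (Finset.mem_image.2 ⟨_, h', add_sub_cancel _ _⟩)) _
    · change φ (u.symm (x • y)) = φ y
      exact congrArg φ (u.symm_apply_apply y)

namespace DiffModule

lemma Hom.id_qi {A : DiffModule R} : (Hom.id : Hom A A).QI := fun k =>
  ⟨fun a _ _ ⟨b, hb⟩ => ⟨b, hb⟩, fun b hb hk => ⟨b, hb, hk, 0, by
    change b = b + A.d 0
    rw [map_zero, add_zero]⟩⟩

lemma cechMap_id (xs : List R) {A : DiffModule R} :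
    cechMap xs (Hom.id : Hom A A) = Hom.id := by
  induction xs generalizing A with
  | nil => rfl
  | cons x xs ih =>
    refine (congrArg (cechMap xs) ?_).trans ih
    refine Hom.ext (LinearMap.ext fun p => Prod.ext rfl ?_)
    change LocAway.map x LinearMap.id p.2 = p.2
    rw [LocAway.map, IsLocalizedModule.map_id]
    rfl

variable {A B C : DiffModule R} [GradedAlgebra 𝒜]

lemma cechMap_dual_telFst_qi {xs : List R} {x : R} (hxs : x ∈ xs) {e : ℕ × ℕ} (hx : x ∈ 𝒜 e)
    (g : DGr 𝒜 A) : (cechMap xs (graded_telFst hx g).dual).QI :=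
  (((telSES x).dual (graded_telInr hx g) (graded_telFst hx g)).cech xs).qi_left
    (cech_acyclic_of_bijective hxs
      (Gr.Dual.smul_bijective (g.loc hx).toGr hx (LocAway.smul_bijective x)))

lemma cechMap_dual_cechFst_qi {xs ys : List R} (hxs : ∀ y ∈ ys, y ∈ xs) {e : ℕ × ℕ}
    (h : ∀ y ∈ ys, y ∈ 𝒜 e) (g : DGr 𝒜 A) : (cechMap xs (graded_cechFst ys h g).dual).QI := by
  induction ys generalizing A with
  | nil =>
    change (cechMap xs (Hom.id : Hom g.dual g.dual)).QI
    rw [cechMap_id]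
    exact Hom.id_qi
  | cons y ys ih =>
    have hy := h y List.mem_cons_self
    have h' := fun z hz => h z (List.mem_cons_of_mem _ hz)
    change (cechMap xs
      ((graded_cechFst ys h' (g.tel hy)).dual.comp (graded_telFst hy g).dual)).QI
    rw [cechMap_comp]
    exact fun k => (ih (fun z hz => hxs z (List.mem_cons_of_mem _ hz)) h' _ k).comp
      (cechMap_dual_telFst_qi (hxs y List.mem_cons_self) hy g k)

lemma tors_dual_of_low {g : DGr 𝒜 A} {i₀ : ℤ} (hg : g.toGr.Low i₀) {x : R} (hx : x ∈ 𝒜 (1, 0)) :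
    Tors x g.dual := fun φ _ => by
  obtain ⟨F, hF⟩ := Gr.Dual.exists_support (g := g.toGr) φ
  obtain ⟨i₁, hi⟩ := (F.image Prod.fst).bddAbove
  have hn (n : ℕ) : x ^ n ∈ 𝒜 (n, 0) := by
    have := SetLike.pow_mem_graded n hx
    simpa using this
  refine ⟨(i₁ + 1 - i₀).toNat, 0, Gr.Dual.ext fun y => ?_⟩
  rw [map_zero]
  set n := (i₁ + 1 - i₀).toNat
  obtain ⟨G, hG⟩ := g.finite y
  rw [Gr.Dual.smul_apply, ← hG, Finset.smul_sum, map_sum]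
  refine Finset.sum_eq_zero fun b _ => ?_
  by_cases hb : b.1 < i₀
  · rw [hg b hb, smul_zero, map_zero]
  · rw [← g.π_smul _ _ _ _ (hn n)]
    refine hF _ (fun h => ?_) _
    have h1 : (n : ℤ) + b.1 ≤ i₁ := hi (Finset.mem_coe.2 (Finset.mem_image_of_mem Prod.fst h))
    omega

end DiffModule

end CechDual

/-! ### Truncations -/

section Truncation

variable {R}

namespace DiffModule

lemma tors_of_forall {x : R} {A : DiffModule R}
    (h : ∀ k (a : A), A.d a = 0 → A.c k a = a → ∃ (n : ℕ) (b : A), x ^ n • a = A.d b) :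
    Tors x A := by
  intro a ha
  have h' := fun k => h k (A.c k a) (d_c_of_d ha k) (A.c_self k a)
  choose n b hb using h'
  obtain ⟨F, hF⟩ := A.c_sum
  refine ⟨F.sup n, ∑ k ∈ F, x ^ (F.sup n - n k) • b k, ?_⟩
  conv_lhs => rw [← hF a, Finset.smul_sum]
  rw [map_sum]
  refine Finset.sum_congr rfl fun k hk => ?_
  rw [map_smul, ← hb, smul_smul, ← pow_add, Nat.sub_add_cancel (Finset.le_sup hk)]

variable (E : DiffModule R) (t : ℤ)

/-- The elements of degrees at most `t` which are cocycles in degree `t`. -/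
def truncSubmodule : Submodule R E where
  carrier := {e | (∀ l, t < l → E.c l e = 0) ∧ E.d (E.c t e) = 0}
  zero_mem' := ⟨fun l _ => map_zero _, by rw [map_zero, map_zero]⟩
  add_mem' := by
    rintro a b ⟨h1, h2⟩ ⟨h3, h4⟩
    refine ⟨fun l hl => by rw [map_add, h1 l hl, h3 l hl, add_zero], ?_⟩
    rw [map_add, map_add, h2, h4, add_zero]
  smul_mem' := by
    rintro r a ⟨h1, h2⟩
    exact ⟨fun l hl => by rw [map_smul, h1 l hl, smul_zero], by
      rw [map_smul, map_smul, h2, smul_zero]⟩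

lemma truncSubmodule_d : ∀ a ∈ E.truncSubmodule t, E.d a ∈ E.truncSubmodule t := by
  rintro a ⟨h1, h2⟩
  refine ⟨fun l hl => ?_, by rw [c_d', d_d]⟩
  rw [c_d']
  rcases eq_or_lt_of_le (show t ≤ l - 1 by omega) with h | h
  · rw [← h, h2]
  · rw [h1 _ h, map_zero]

lemma truncSubmodule_c (k : ℤ) : ∀ a ∈ E.truncSubmodule t, E.c k a ∈ E.truncSubmodule t := by
  rintro a ⟨h1, h2⟩
  constructor
  · intro l hl
    by_cases h : l = k
    · subst h
      rw [c_self, h1 _ hl]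
    · rw [E.c_of_ne h]
  · by_cases h : t = k
    · subst h
      rw [c_self, h2]
    · rw [E.c_of_ne h, map_zero]

/-- The canonical truncation. -/
@[reducible] def trunc : DiffModule R :=
  E.sub (E.truncSubmodule t) (E.truncSubmodule_d t) (E.truncSubmodule_c t)

/-- The quotient by the canonical truncation. -/
@[reducible] def cotrunc : DiffModule R :=
  E.quot (E.truncSubmodule t) (E.truncSubmodule_d t) (E.truncSubmodule_c t)

/-- The inclusion of the truncation. -/
def truncIncl : Hom (E.trunc t) E := subIncl _ _ _ _

/-- The projection to the quotient by the truncation. -/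
def cotruncMk : Hom E (E.cotrunc t) := quotMk _ _ _ _

lemma truncSES : SES (E.truncIncl t) (E.cotruncMk t) := subSES _ _ _ _

lemma ex_trunc {k : ℤ} (hk : t < k) : (E.trunc t).Ex k := fun z _ hz =>
  ⟨0, by
    rw [map_zero, ← hz]
    exact Subtype.ext (z.2.1 k hk)⟩

lemma cotruncMk_bijAt {k : ℤ} (hk : t < k) : (E.cotruncMk t).BijAt k :=
  ⟨(E.truncSES t).injAt_right (E.ex_trunc t hk),
    (E.truncSES t).surjAt_right rfl (E.ex_trunc t (by omega))⟩

lemma ex_cotrunc {k : ℤ} (hk : k ≤ t) : (E.cotrunc t).Ex k := by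
  intro z hz hkz
  obtain ⟨e, rfl⟩ := (E.truncSES t).surj z
  have h1 : E.cotruncMk t (E.c k e) = E.cotruncMk t e := hkz
  have h2 : E.cotruncMk t (E.d e) = 0 := hz
  rw [← h1]
  have h3 : E.d (E.c k e) ∈ E.truncSubmodule t := by
    rw [← c_d]
    exact E.truncSubmodule_c t _ _ ((Submodule.Quotient.mk_eq_zero _).1 h2)
  refine ⟨0, ?_⟩
  rw [map_zero]
  refine (Submodule.Quotient.mk_eq_zero _).2 ⟨fun l hl => E.c_of_ne (by omega) _, ?_⟩
  by_cases h : t = k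
  · subst h
    have := h3.1 (t + 1) (by omega)
    rwa [c_d] at this
  · rw [E.c_of_ne h, map_zero]

variable {E t} in
lemma tors_cotrunc {x : R}
    (h : ∀ k, t < k → ∃ n : ℕ, ∀ z ∈ E.Z k, ∃ w, x ^ n • z = E.d w) : Tors x (E.cotrunc t) := by
  refine tors_of_forall fun k a ha hka => ?_
  by_cases hk : k ≤ t
  · obtain ⟨b, hb⟩ := E.ex_cotrunc t hk a ha hka
    exact ⟨0, b, by rw [pow_zero, one_smul, hb]⟩
  · obtain ⟨n, hn⟩ := h k (by omega)
    obtain ⟨e, he, hke, b, hb⟩ := (E.cotruncMk_bijAt t (by omega : t < k)).2 a ha hka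
    obtain ⟨w, hw⟩ := hn e ⟨he, hke⟩
    refine ⟨n, E.cotruncMk t w + x ^ n • b, ?_⟩
    rw [hb, smul_add, map_add, map_smul]
    refine congrArg (· + _) ?_
    exact congrArg (E.cotruncMk t) hw

/-- The map from the truncation to its cohomology in degree `t`. -/
def truncHom : Hom (E.trunc t) (single (E.Coh t) t) where
  toLin := E.cls t ∘ₗ LinearMap.codRestrict (E.Z t) (E.c t ∘ₗ (E.truncSubmodule t).subtype)
    fun e => ⟨e.2.2, E.c_self _ _⟩
  map_d e := by
    refine (cls_eq_zero _).2 ⟨E.c (t - 1) e, ?_⟩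
    exact E.c_d' t e
  map_c k e := by
    by_cases h : k = t
    · subst h
      rw [single_c_self]
      exact congrArg (E.cls k) (Subtype.ext (E.c_self k e.1))
    · rw [single_c_of_ne h]
      refine (congrArg (E.cls t) (Subtype.ext ?_)).trans (map_zero (E.cls t))
      exact E.c_of_ne (Ne.symm h) _

variable {E t}

lemma truncHom_eq_zero (e : E.trunc t) (h : E.truncHom t e = 0) : ∃ w, E.c t e.1 = E.d w :=
  (cls_eq_zero _).1 h

/-- The kernel of a morphism. -/
@[reducible] def Hom.ker {A B : DiffModule R} (f : Hom A B) : DiffModule R :=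
  A.sub (LinearMap.ker f.toLin)
    (fun a ha => (f.map_d a).trans (by
      rw [show f a = 0 from ha, map_zero]))
    (fun k a ha => (f.map_c k a).trans (by
      rw [show f a = 0 from ha, map_zero]))

lemma Hom.kerSES {A B : DiffModule R} {f : Hom A B} (hf : Function.Surjective f.toLin) :
    SES (subIncl A (LinearMap.ker f.toLin) _ _ : Hom f.ker A) f where
  inj := Subtype.val_injective
  exact b := ⟨fun h => ⟨⟨b, h⟩, rfl⟩, by
    rintro ⟨a, rfl⟩
    exact a.2⟩
  surj := hf

lemma truncHom_surjective : Function.Surjective (E.truncHom t).toLin := by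
  intro y
  obtain ⟨z, rfl⟩ := cls_surjective t y
  have hz : z.1 ∈ E.truncSubmodule t := by
    refine ⟨fun l hl => ?_, by rw [z.2.2, z.2.1]⟩
    rw [← z.2.2, E.c_of_ne (by omega)]
  exact ⟨⟨z, hz⟩, congrArg (E.cls t) (Subtype.ext z.2.2)⟩

lemma truncHom_ker_acyclic (h : ∀ k < t, E.Ex k) : (E.truncHom t).ker.Acyclic := by
  refine acyclic_of_ex fun k z hz hk => ?_
  have hz' : E.d z.1.1 = 0 := congrArg (fun y : (E.truncHom t).ker => (y.1.1 : E)) hz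
  have hk' : E.c k z.1.1 = z.1.1 := congrArg (fun y : (E.truncHom t).ker => (y.1.1 : E)) hk
  have key : (∃ w, z.1.1 = E.d w) → k ≤ t → ∃ w, z = (E.truncHom t).ker.d w := by
    rintro ⟨w, hw⟩ hkt
    have hw' : E.c (k - 1) w ∈ E.truncSubmodule t :=
      ⟨fun l hl => E.c_of_ne (by omega) _, by rw [E.c_of_ne (by omega), map_zero]⟩
    refine ⟨⟨⟨_, hw'⟩, ?_⟩, Subtype.ext (Subtype.ext ?_)⟩
    · refine (cls_eq_zero _).2 ⟨0, ?_⟩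
      rw [map_zero]
      exact E.c_of_ne (by omega) _
    · change z.1.1 = E.d (E.c (k - 1) w)
      rw [← c_d', ← hw, hk']
  rcases lt_trichotomy k t with hlt | heq | hgt
  · exact key (h k hlt _ hz' hk') hlt.le
  · subst heq
    obtain ⟨w, hw⟩ := truncHom_eq_zero z.1 z.2
    exact key ⟨w, hk'.symm.trans hw⟩ le_rfl
  · refine ⟨0, ?_⟩
    rw [map_zero]
    refine Subtype.ext (Subtype.ext ?_)
    rw [← hk', z.1.2.1 k hgt]
    rfl

lemma cechMap_truncHom_qi (h : ∀ k < t, E.Ex k) (xs : List R) :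
    (cechMap xs (E.truncHom t)).QI :=
  ((Hom.kerSES truncHom_surjective).cech xs).qi_right ((truncHom_ker_acyclic h).cech xs)

end DiffModule

end Truncation

/-! ### Unrolling a long exact sequence -/

section Unroll

variable {R}

namespace Unroll

variable {A B C : ℤ → Type u} [∀ j, AddCommGroup (A j)] [∀ j, Module R (A j)]
  [∀ j, AddCommGroup (B j)] [∀ j, Module R (B j)] [∀ j, AddCommGroup (C j)] [∀ j, Module R (C j)]

/-- The total module of three families of modules. -/
abbrev Total (A B C : ℤ → Type u) : Type u := ∀ j, A j × B j × C j

variable (α : ∀ j, A j →ₗ[R] B j) (β : ∀ j, B j →ₗ[R] C j) (γ : ∀ j, C (j - 1) →ₗ[R] A j)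

/-- The total map of a long exact sequence. -/
def total : Total A B C →ₗ[R] Total A B C where
  toFun w j := (γ j (w (j - 1)).2.2, α j (w j).1, β j (w j).2.1)
  map_add' v w := funext fun j => Prod.ext (map_add (γ j) _ _)
    (Prod.ext (map_add (α j) _ _) (map_add (β j) _ _))
  map_smul' r w := funext fun j => Prod.ext (map_smul (γ j) r _)
    (Prod.ext (map_smul (α j) r _) (map_smul (β j) r _))

variable (R A B C) in
/-- The term of index `k` of the sequence
`0 → A 1 → B 1 → C 1 → A 2 → ⋯ → C m → 0` whose first nonzero term has index `1`. -/
def term (m k : ℤ) : Submodule R (Total A B C) where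
  carrier := {w | ∀ j, (¬ (k = 3 * j - 2 ∧ 1 ≤ j ∧ j ≤ m) → (w j).1 = 0) ∧
    (¬ (k = 3 * j - 1 ∧ 1 ≤ j ∧ j ≤ m) → (w j).2.1 = 0) ∧
    (¬ (k = 3 * j ∧ 1 ≤ j ∧ j ≤ m) → (w j).2.2 = 0)}
  zero_mem' j := ⟨fun _ => rfl, fun _ => rfl, fun _ => rfl⟩
  add_mem' {v w} hv hw j := by
    refine ⟨fun h => ?_, fun h => ?_, fun h => ?_⟩
    · change (v j).1 + (w j).1 = 0
      rw [(hv j).1 h, (hw j).1 h, add_zero]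
    · change (v j).2.1 + (w j).2.1 = 0
      rw [(hv j).2.1 h, (hw j).2.1 h, add_zero]
    · change (v j).2.2 + (w j).2.2 = 0
      rw [(hv j).2.2 h, (hw j).2.2 h, add_zero]
  smul_mem' r w hw j := by
    refine ⟨fun h => ?_, fun h => ?_, fun h => ?_⟩
    · change r • (w j).1 = 0
      rw [(hw j).1 h, smul_zero]
    · change r • (w j).2.1 = 0
      rw [(hw j).2.1 h, smul_zero]
    · change r • (w j).2.2 = 0
      rw [(hw j).2.2 h, smul_zero]

variable {m : ℤ}

lemma term_ext {k : ℤ} {v w : Total A B C} (hv : v ∈ term R A B C m k)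
    (hw : w ∈ term R A B C m k)
    (h1 : ∀ j, k = 3 * j - 2 → 1 ≤ j → j ≤ m → (v j).1 = (w j).1)
    (h2 : ∀ j, k = 3 * j - 1 → 1 ≤ j → j ≤ m → (v j).2.1 = (w j).2.1)
    (h3 : ∀ j, k = 3 * j → 1 ≤ j → j ≤ m → (v j).2.2 = (w j).2.2) : v = w := by
  refine funext fun j => Prod.ext ?_ (Prod.ext ?_ ?_)
  · by_cases h : k = 3 * j - 2 ∧ 1 ≤ j ∧ j ≤ m
    · exact h1 j h.1 h.2.1 h.2.2
    · rw [(hv j).1 h, (hw j).1 h]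
  · by_cases h : k = 3 * j - 1 ∧ 1 ≤ j ∧ j ≤ m
    · exact h2 j h.1 h.2.1 h.2.2
    · rw [(hv j).2.1 h, (hw j).2.1 h]
  · by_cases h : k = 3 * j ∧ 1 ≤ j ∧ j ≤ m
    · exact h3 j h.1 h.2.1 h.2.2
    · rw [(hv j).2.2 h, (hw j).2.2 h]

lemma subsingleton_term {k : ℤ} (h : k ≤ 0 ∨ 3 * m < k) :
    Subsingleton (term R A B C m k) :=
  ⟨fun v w => Subtype.ext (term_ext v.2 w.2 (fun j _ _ _ => by omega) (fun j _ _ _ => by omega)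
    (fun j _ _ _ => by omega))⟩

lemma single_mem_term_fst {j : ℤ} (h1 : 1 ≤ j) (hm : j ≤ m) (a : A j) :
    (Pi.single j (a, 0, 0) : Total A B C) ∈ term R A B C m (3 * j - 2) := by
  intro i
  by_cases h : i = j
  · subst h
    rw [Pi.single_eq_same]
    exact ⟨fun h => absurd ⟨rfl, h1, hm⟩ h, fun _ => rfl, fun _ => rfl⟩
  · rw [Pi.single_eq_of_ne h]
    exact ⟨fun _ => rfl, fun _ => rfl, fun _ => rfl⟩

lemma single_mem_term_snd {j : ℤ} (h1 : 1 ≤ j) (hm : j ≤ m) (b : B j) :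
    (Pi.single j (0, b, 0) : Total A B C) ∈ term R A B C m (3 * j - 1) := by
  intro i
  by_cases h : i = j
  · subst h
    rw [Pi.single_eq_same]
    exact ⟨fun _ => rfl, fun h => absurd ⟨rfl, h1, hm⟩ h, fun _ => rfl⟩
  · rw [Pi.single_eq_of_ne h]
    exact ⟨fun _ => rfl, fun _ => rfl, fun _ => rfl⟩

lemma single_mem_term_thd {j : ℤ} (h1 : 1 ≤ j) (hm : j ≤ m) (c : C j) :
    (Pi.single j (0, 0, c) : Total A B C) ∈ term R A B C m (3 * j) := by
  intro i
  by_cases h : i = j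
  · subst h
    rw [Pi.single_eq_same]
    exact ⟨fun _ => rfl, fun _ => rfl, fun h => absurd ⟨rfl, h1, hm⟩ h⟩
  · rw [Pi.single_eq_of_ne h]
    exact ⟨fun _ => rfl, fun _ => rfl, fun _ => rfl⟩

lemma nonempty_equiv_fst {j : ℤ} (h1 : 1 ≤ j) (hm : j ≤ m) :
    Nonempty (term R A B C m (3 * j - 2) ≃ₗ[R] A j) := by
  refine ⟨LinearEquiv.ofBijective ((LinearMap.fst R (A j) (B j × C j) ∘ₗ LinearMap.proj j) ∘ₗ
    (term R A B C m (3 * j - 2)).subtype) ⟨fun v w h => Subtype.ext ?_, fun a => ?_⟩⟩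
  · refine term_ext v.2 w.2 (fun i hi _ _ => ?_) (fun i _ _ _ => by omega) fun i _ _ _ => by omega
    obtain rfl : i = j := by omega
    exact h
  · refine ⟨⟨_, single_mem_term_fst h1 hm a⟩, ?_⟩
    change ((Pi.single j (a, 0, 0) : Total A B C) j).1 = a
    rw [Pi.single_eq_same]

lemma nonempty_equiv_snd {j : ℤ} (h1 : 1 ≤ j) (hm : j ≤ m) :
    Nonempty (term R A B C m (3 * j - 1) ≃ₗ[R] B j) := by
  refine ⟨LinearEquiv.ofBijective (((LinearMap.fst R (B j) (C j) ∘ₗ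
    LinearMap.snd R (A j) (B j × C j)) ∘ₗ LinearMap.proj j) ∘ₗ
    (term R A B C m (3 * j - 1)).subtype) ⟨fun v w h => Subtype.ext ?_, fun b => ?_⟩⟩
  · refine term_ext v.2 w.2 (fun i _ _ _ => by omega) (fun i hi _ _ => ?_) fun i _ _ _ => by omega
    obtain rfl : i = j := by omega
    exact h
  · refine ⟨⟨_, single_mem_term_snd h1 hm b⟩, ?_⟩
    change ((Pi.single j (0, b, 0) : Total A B C) j).2.1 = b
    rw [Pi.single_eq_same]

lemma nonempty_equiv_thd {j : ℤ} (h1 : 1 ≤ j) (hm : j ≤ m) :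
    Nonempty (term R A B C m (3 * j) ≃ₗ[R] C j) := by
  refine ⟨LinearEquiv.ofBijective (((LinearMap.snd R (B j) (C j) ∘ₗ
    LinearMap.snd R (A j) (B j × C j)) ∘ₗ LinearMap.proj j) ∘ₗ
    (term R A B C m (3 * j)).subtype) ⟨fun v w h => Subtype.ext ?_, fun c => ?_⟩⟩
  · refine term_ext v.2 w.2 (fun i _ _ _ => by omega) (fun i _ _ _ => by omega) fun i hi _ _ => ?_
    obtain rfl : i = j := by omega
    exact h
  · refine ⟨⟨_, single_mem_term_thd h1 hm c⟩, ?_⟩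
    change ((Pi.single j (0, 0, c) : Total A B C) j).2.2 = c
    rw [Pi.single_eq_same]

lemma total_mem (hA : Subsingleton (A (m + 1))) {k : ℤ} :
    ∀ w ∈ term R A B C m k, total α β γ w ∈ term R A B C m (k + 1) := by
  intro w hw j
  refine ⟨fun h => ?_, fun h => ?_, fun h => ?_⟩
  · change γ j (w (j - 1)).2.2 = 0
    by_cases hj : j = m + 1
    · subst hj
      exact Subsingleton.elim _ _
    · rw [(hw _).2.2 (by omega), map_zero]
  · change α j (w j).1 = 0
    rw [(hw _).1 (by omega), map_zero]
  · change β j (w j).2.1 = 0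
    rw [(hw _).2.1 (by omega), map_zero]

variable {α β γ}

lemma total_total (h12 : ∀ j, Function.Exact (α j) (β j))
    (h23 : ∀ j, Function.Exact (β (j - 1)) (γ j)) (h31 : ∀ j, Function.Exact (γ j) (α j))
    (w : Total A B C) : total α β γ (total α β γ w) = 0 :=
  funext fun j => Prod.ext ((h23 j).apply_apply_eq_zero _)
    (Prod.ext ((h31 j).apply_apply_eq_zero _) ((h12 j).apply_apply_eq_zero _))

lemma exists_total_eq (h12 : ∀ j, Function.Exact (α j) (β j))
    (h23 : ∀ j, Function.Exact (β (j - 1)) (γ j)) (h31 : ∀ j, Function.Exact (γ j) (α j))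
    (hC : Subsingleton (C 0)) (hA : Subsingleton (A (m + 1))) {k : ℤ} {w : Total A B C}
    (hw : w ∈ term R A B C m (k + 1)) (h0 : total α β γ w = 0) :
    ∃ v ∈ term R A B C m k, total α β γ v = w := by
  by_cases hk : 1 ≤ k + 1 ∧ k + 1 ≤ 3 * m
  swap
  · refine ⟨0, Submodule.zero_mem _, ?_⟩
    rw [map_zero]
    have := subsingleton_term (R := R) (A := A) (B := B) (C := C) (m := m) (k := k + 1) (by omega)
    exact congrArg Subtype.val (Subsingleton.elim (0 : term R A B C m (k + 1)) ⟨w, hw⟩)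
  have e1 : ∀ j, γ j (w (j - 1)).2.2 = 0 := fun j => congrArg (fun v => (v j).1) h0
  have e2 : ∀ j, α j (w j).1 = 0 := fun j => congrArg (fun v => (v j).2.1) h0
  have e3 : ∀ j, β j (w j).2.1 = 0 := fun j => congrArg (fun v => (v j).2.2) h0
  obtain ⟨j, hj⟩ : ∃ j, k = 3 * (j - 1) ∨ k = 3 * j - 2 ∨ k = 3 * (j - 1) - 1 :=
    ⟨(k + 4) / 3, by omega⟩
  rcases hj with rfl | rfl | rfl
  · obtain ⟨c, hc⟩ := (h31 j _).1 (e2 j)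
    by_cases hj1 : j = 1
    · subst hj1
      have hC' : Subsingleton (C (1 - 1)) := hC
      refine ⟨0, Submodule.zero_mem _, ?_⟩
      rw [map_zero]
      refine term_ext (Submodule.zero_mem _) hw (fun i hi _ _ => ?_) (fun i _ _ _ => by omega)
        (fun i _ _ _ => by omega)
      obtain rfl : i = 1 := by omega
      rw [← hc, Subsingleton.elim c 0, map_zero]
      rfl
    · have hv := single_mem_term_thd (R := R) (A := A) (B := B) (j := j - 1) (m := m) (by omega)
        (by omega) c
      refine ⟨_, hv, term_ext (total_mem α β γ hA _ hv) hw (fun i hi _ _ => ?_)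
        (fun i _ _ _ => by omega) (fun i _ _ _ => by omega)⟩
      obtain rfl : i = j := by omega
      change γ i ((Pi.single (i - 1) (0, 0, c) : Total A B C) (i - 1)).2.2 = _
      rw [Pi.single_eq_same, hc]
  · obtain ⟨a, ha⟩ := (h12 j _).1 (e3 j)
    have hv := single_mem_term_fst (R := R) (B := B) (C := C) (j := j) (m := m) (by omega)
      (by omega) a
    refine ⟨_, hv, term_ext (total_mem α β γ hA _ hv) hw (fun i _ _ _ => by omega)
      (fun i hi _ _ => ?_) (fun i _ _ _ => by omega)⟩
    obtain rfl : i = j := by omega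
    change α i ((Pi.single i (a, 0, 0) : Total A B C) i).1 = _
    rw [Pi.single_eq_same, ha]
  · obtain ⟨b, hb⟩ := (h23 j _).1 (e1 j)
    have hv := single_mem_term_snd (R := R) (A := A) (C := C) (j := j - 1) (m := m) (by omega)
      (by omega) b
    refine ⟨_, hv, term_ext (total_mem α β γ hA _ hv) hw (fun i _ _ _ => by omega)
      (fun i _ _ _ => by omega) (fun i hi _ _ => ?_)⟩
    obtain rfl : i = j - 1 := by omega
    change β (j - 1) ((Pi.single (j - 1) (0, b, 0) : Total A B C) (j - 1)).2.1 = _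
    rw [Pi.single_eq_same, hb]

end Unroll

/-- A long exact sequence `A 1 → B 1 → C 1 → A 2 → ⋯ → C m` of modules with `C 0 = 0` and
`A (m + 1) = 0`, as a sequence indexed by `ℤ`. -/
lemma exists_unroll {A B C : ℤ → Type u} [∀ j, AddCommGroup (A j)] [∀ j, Module R (A j)]
    [∀ j, AddCommGroup (B j)] [∀ j, Module R (B j)] [∀ j, AddCommGroup (C j)]
    [∀ j, Module R (C j)] {α : ∀ j, A j →ₗ[R] B j} {β : ∀ j, B j →ₗ[R] C j}
    {γ : ∀ j, C (j - 1) →ₗ[R] A j} {m : ℤ} (h12 : ∀ j, Function.Exact (α j) (β j))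
    (h23 : ∀ j, Function.Exact (β (j - 1)) (γ j)) (h31 : ∀ j, Function.Exact (γ j) (α j))
    (hC : Subsingleton (C 0)) (hA : Subsingleton (A (m + 1))) :
    ∃ (X : ℤ → ModuleCat.{u} R) (f : ∀ k : ℤ, X k ⟶ X (k + 1)),
      (∀ k : ℤ, Function.Exact (f k) (f (k + 1))) ∧
      (∀ k : ℤ, k ≤ 0 → Subsingleton (X k)) ∧ (∀ k : ℤ, 3 * m < k → Subsingleton (X k)) ∧
      ∀ j : ℤ, 1 ≤ j → j ≤ m → Nonempty ((X (3 * j - 2) : Type u) ≃ₗ[R] A j) ∧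
        Nonempty ((X (3 * j - 1) : Type u) ≃ₗ[R] B j) ∧
        Nonempty ((X (3 * j) : Type u) ≃ₗ[R] C j) := by
  refine ⟨fun k => ModuleCat.of R (Unroll.term R A B C m k), fun k => ModuleCat.ofHom
    ((Unroll.total α β γ).restrict (Unroll.total_mem α β γ hA)), fun k w => ⟨fun h => ?_, ?_⟩,
    fun k hk => Unroll.subsingleton_term (Or.inl hk),
    fun k hk => Unroll.subsingleton_term (Or.inr hk), fun j h1 hm =>
      ⟨Unroll.nonempty_equiv_fst h1 hm, Unroll.nonempty_equiv_snd h1 hm,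
        Unroll.nonempty_equiv_thd h1 hm⟩⟩
  · obtain ⟨v, hv, e⟩ := Unroll.exists_total_eq h12 h23 h31 hC hA w.2 (congrArg Subtype.val h)
    exact ⟨⟨v, hv⟩, Subtype.ext e⟩
  · rintro ⟨v, rfl⟩
    exact Subtype.ext (Unroll.total_total h12 h23 h31 v.1)

/-- The long exact cohomology sequence of a short exact sequence in a range of degrees. -/
lemma DiffModule.SES.exists_unroll {A B C : DiffModule R} {f : DiffModule.Hom A B}
    {g : DiffModule.Hom B C} (S : DiffModule.SES f g) {t m : ℤ} (hC : C.Ex t)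
    (hA : A.Ex (t + (m + 1))) :
    ∃ (X : ℤ → ModuleCat.{u} R) (f : ∀ k : ℤ, X k ⟶ X (k + 1)),
      (∀ k : ℤ, Function.Exact (f k) (f (k + 1))) ∧
      (∀ k : ℤ, k ≤ 0 → Subsingleton (X k)) ∧ (∀ k : ℤ, 3 * m < k → Subsingleton (X k)) ∧
      ∀ j : ℤ, 1 ≤ j → j ≤ m → Nonempty ((X (3 * j - 2) : Type u) ≃ₗ[R] A.Coh (t + j)) ∧
        Nonempty ((X (3 * j - 1) : Type u) ≃ₗ[R] B.Coh (t + j)) ∧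
        Nonempty ((X (3 * j) : Type u) ≃ₗ[R] C.Coh (t + j)) := by
  have h : ∀ j : ℤ, t + (j - 1) + 1 = t + j := fun j => by ring
  refine _root_.exists_unroll (A := fun j => A.Coh (t + j)) (B := fun j => B.Coh (t + j))
    (C := fun j => C.Coh (t + j)) (α := fun j => f.mapCoh (t + j)) (β := fun j => g.mapCoh (t + j))
    (γ := fun j => S.delta (h j)) (fun j => S.exact_mid _) (fun j => S.exact_right (h j))
    (fun j => S.exact_left (h j)) ?_ (DiffModule.subsingleton_coh_iff.2 hA)
  rw [add_zero]
  exact DiffModule.subsingleton_coh_iff.2 hC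

end Unroll

/-! ### Duality and quasi-isomorphisms -/

section DualReflects

variable {K R} {𝒜}

lemma IsKLin.exists_ne_zero {N : Type u} [AddCommGroup N] [Module R N] {W : Submodule R N} {x : N}
    (hx : x ∉ W) : ∃ φ : N →+ K, IsKLin R φ ∧ (∀ w ∈ W, φ w = 0) ∧ φ x ≠ 0 := by
  let : Module K (N ⧸ W) := Module.compHom (N ⧸ W) (algebraMap K R)
  have h0 : W.mkQ x ≠ 0 := fun h => hx ((Submodule.Quotient.mk_eq_zero W).1 h)
  obtain ⟨φ, hφ⟩ : ∃ φ : Module.Dual K (N ⧸ W), φ (W.mkQ x) ≠ 0 := by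
    by_contra! h
    exact h0 ((Module.forall_dual_apply_eq_zero_iff K _).1 h)
  refine ⟨φ.toAddMonoidHom.comp W.mkQ.toAddMonoidHom, fun c y => ?_, fun w hw => ?_, hφ⟩
  · change φ (W.mkQ (algebraMap K R c • y)) = c * φ (W.mkQ y)
    rw [map_smul]
    exact φ.map_smul c _
  · change φ (W.mkQ w) = 0
    rw [Submodule.mkQ_apply, (Submodule.Quotient.mk_eq_zero W).2 hw, map_zero]

namespace DiffModule

variable {A B : DiffModule R} [GradedAlgebra 𝒜] {g : DGr 𝒜 A} {g' : DGr 𝒜 B}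

lemma Hom.Graded.cohPairing_mapCoh {f : Hom A B} (hf : f.Graded g g') {k l : ℤ}
    (y : g'.dual.Coh l) (x : A.Coh k) :
    g.cohPairing k l (hf.dual.mapCoh l y) x = g'.cohPairing k l y (f.mapCoh k x) := by
  obtain ⟨φ, rfl⟩ := cls_surjective l y
  obtain ⟨z, rfl⟩ := cls_surjective k x
  rfl

lemma Hom.Graded.mapCoh_π {f : Hom A B} (hf : f.Graded g g') (k : ℤ) (b : ℤ × ℤ) (x : A.Coh k) :
    f.mapCoh k ((g.coh k).π b x) = (g'.coh k).π b (f.mapCoh k x) := by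
  obtain ⟨z, rfl⟩ := cls_surjective k x
  exact congrArg (B.cls k) (Subtype.ext (hf b z))

lemma Hom.Graded.mapCoh_bijective {f : Hom A B} (hf : f.Graded g g') {k l : ℤ} (h : k + l = 0)
    (hd : hf.dual.BijAt l) : Function.Bijective (f.mapCoh k) := by
  constructor
  · rw [← LinearMap.ker_eq_bot, LinearMap.ker_eq_bot']
    refine fun x hx => (g.coh k).eq_zero_of_π fun b => ?_
    by_contra hb
    obtain ⟨φ, hφ, -, hne⟩ := IsKLin.exists_ne_zero (K := K)
      (W := (⊥ : Submodule R (A.Coh k))) hb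
    obtain ⟨y, -, hy⟩ := g.exists_cohPairing h (-b) φ hφ
    obtain ⟨y', rfl⟩ := hd.2.surjective y
    refine hne ?_
    rw [← neg_neg b, ← hy, hf.cohPairing_mapCoh, hx, map_zero]
  · intro x
    by_contra hx
    have hx' : ∃ b, (g'.coh k).π b x ∉ LinearMap.range (f.mapCoh k) := by
      by_contra! hall
      obtain ⟨F, hF⟩ := (g'.coh k).finite x
      exact hx (hF ▸ Submodule.sum_mem (LinearMap.range (f.mapCoh k)) fun b _ => hall b)
    obtain ⟨b, hb⟩ := hx'
    obtain ⟨φ, hφ, hW, hne⟩ := IsKLin.exists_ne_zero (K := K) hb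
    obtain ⟨y, -, hy⟩ := g'.exists_cohPairing h (-b) φ hφ
    have hy0 : y = 0 := by
      refine hd.1.injective ?_
      rw [map_zero]
      refine g.cohPairing_nondeg h _ fun z => ?_
      rw [hf.cohPairing_mapCoh, hy, ← hf.mapCoh_π]
      exact hW _ ⟨_, rfl⟩
    refine hne ?_
    rw [← neg_neg b, ← hy, hy0, map_zero]
    rfl

end DiffModule

end DualReflects

/-! ### The comparison theorem -/

section Comparison

variable {K R} {𝒜}

namespace DiffModule

variable [GradedAlgebra 𝒜] {L : DiffModule R} {ps : List R} (hps : ∀ x ∈ ps, x ∈ 𝒜 (1, 0))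
  (g : DGr 𝒜 L) {t : ℤ}

lemma exists_pow_smul_dual_cech {x : R} (hx : x ∈ ps) {k l : ℤ} (h : k + l = 0)
    (hfin : Module.Finite R ((cech ps L).Coh k)) :
    ∃ n : ℕ, ∀ z ∈ (g.cech ps hps).dual.Z l, ∃ w, x ^ n • z = (g.cech ps hps).dual.d w := by
  obtain ⟨n, hn⟩ := exists_pow_annihilates x (P := (cech ps L).Coh k) fun y => by
    obtain ⟨z, rfl⟩ := cls_surjective k y
    obtain ⟨n, b, hb⟩ := tors_cech hx L z z.2.1
    exact ⟨n, (cls_eq_zero (x ^ n • z)).2 ⟨b, hb⟩⟩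
  refine ⟨n, fun φ hφ => (g.cech ps hps).exists_eq_dual_d h ?_ fun z hz => ?_⟩
  · rw [map_smul, hφ.2]
  · obtain ⟨w, hw⟩ := (cls_eq_zero (x ^ n • (⟨z, hz⟩ : (cech ps L).Z k))).1
      ((map_smul ((cech ps L).cls k) (x ^ n) _).trans (hn _))
    change (φ : (g.cech ps hps).toGr.Dual) (x ^ n • z) = 0
    rw [show x ^ n • z = (cech ps L).d w from hw]
    exact (g.cech ps hps).dual_cocycle_apply_d hφ.1 w

lemma cechFst_cotrunc_qi (hfin : ∀ k, t < k → Module.Finite R ((cech ps L).Coh (-k))) :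
    (cechFst ps ((g.cech ps hps).dual.cotrunc t)).QI :=
  cechFst_qi ps fun _ hx => tors_cotrunc fun k hk =>
    exists_pow_smul_dual_cech hps g hx (neg_add_cancel k) (hfin k hk)

include hps in
lemma cechFst_dual_qi {i₀ : ℤ} (hlow : g.toGr.Low i₀) : (cechFst ps g.dual).QI :=
  cechFst_qi ps fun _ hx => tors_dual_of_low hlow (hps _ hx)

/-- The long exact sequence of a bigraded complex, in terms of its Čech complex. -/
lemma exists_long_exact_sequence [IsNoetherianRing R] {i₀ : ℤ} (hlow : g.toGr.Low i₀)
    (hE : ∀ k < t, (g.cech ps hps).dual.Ex k)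
    (hfin : ∀ k, t < k → Module.Finite R ((cech ps L).Coh (-k))) :
    ∃ (X : ℤ → ModuleCat.{u} R) (f : ∀ k : ℤ, X k ⟶ X (k + 1)),
      (∀ k : ℤ, Function.Exact (f k) (f (k + 1))) ∧
      (∀ k : ℤ, k ≤ 0 → Subsingleton (X k)) ∧
      (∀ k : ℤ, 3 * (ps.length : ℤ) < k → Subsingleton (X k)) ∧
      ∀ j : ℤ, 1 ≤ j → j ≤ ps.length →
        Nonempty ((X (3 * j - 2) : Type u) ≃ₗ[R]
          LC R (Ideal.span {x : R | x ∈ ps}) j ((g.cech ps hps).dual.Coh t)) ∧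
        Nonempty ((X (3 * j - 1) : Type u) ≃ₗ[R] g.dual.Coh (t + j)) ∧
        Nonempty ((X (3 * j) : Type u) ≃ₗ[R] (g.cech ps hps).dual.Coh (t + j)) := by
  set E := (g.cech ps hps).dual with hE'
  obtain ⟨X, f, h1, h2, h3, h4⟩ := ((E.truncSES t).cech ps).exists_unroll (t := t)
    (m := ps.length) (ex_cech_of_le ps (fun l hl => E.ex_cotrunc t hl) t le_rfl)
    (ex_cech_of_lt ps (fun l hl => E.ex_trunc t hl) _ (by omega))
  refine ⟨X, f, h1, h2, h3, fun j hj hjm => ?_⟩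
  obtain ⟨⟨e1⟩, ⟨e2⟩, ⟨e3⟩⟩ := h4 j hj hjm
  obtain ⟨e⟩ := LC_equiv_cech ps rfl (E.Coh t) (rfl : t + j = t + j)
  exact ⟨⟨e1.trans ((cechMap_truncHom_qi hE ps _).equiv.trans e.symm)⟩,
    ⟨e2.trans ((cechMap_dual_cechFst_qi (fun _ h => h) hps g _).equiv.symm.trans
      (cechFst_dual_qi hps g hlow _).equiv)⟩,
    ⟨e3.trans ((cechFst_cotrunc_qi hps g hfin _).equiv.trans
      (E.cotruncMk_bijAt t (by omega)).equiv.symm)⟩⟩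

include hps in
/-- The comparison of a bigraded complex with its Čech complex in low degrees. -/
lemma cechFst_bijective {i₀ : ℤ} (hlow : g.toGr.Low i₀)
    (hfin : ∀ k, t < k → Module.Finite R ((cech ps L).Coh (-k))) {k l : ℤ} (h : k + l = 0)
    (hl : t + ps.length < l) : Function.Bijective ((cechFst ps L).mapCoh k) := by
  refine (graded_cechFst ps hps g).mapCoh_bijective h ?_
  set E := (g.cech ps hps).dual with hE'
  have hA : ∀ l', t + ps.length < l' → (cech ps (E.trunc t)).Ex l' :=
    ex_cech_of_lt ps fun l hl => E.ex_trunc t hl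
  have h1 : (cechMap ps (E.cotruncMk t)).BijAt l :=
    ⟨((E.truncSES t).cech ps).injAt_right (hA l hl),
      ((E.truncSES t).cech ps).surjAt_right rfl (hA _ (by omega))⟩
  have h2 : (cechFst ps E).BijAt l := by
    refine Hom.BijAt.of_comp_left (E.cotruncMk_bijAt t (by omega)) ?_
    rw [← cechFst_naturality]
    exact Hom.BijAt.comp (cechFst_cotrunc_qi hps g hfin l) h1
  refine Hom.BijAt.of_comp_right (cechFst_dual_qi hps g hlow l) ?_
  rw [← cechFst_naturality]
  exact Hom.BijAt.comp h2 (cechMap_dual_cechFst_qi (fun _ h => h) hps g l)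

end DiffModule

end Comparison

/-! ### Standard bigraded algebras -/

section Standard

variable {K R} {𝒜}

lemma IsStandardBigraded.isNoetherianRing [GradedAlgebra 𝒜] (h : IsStandardBigraded K R 𝒜) :
    IsNoetherianRing R := by
  obtain ⟨s, hs⟩ := h.fg10
  obtain ⟨s', hs'⟩ := h.fg01
  have hft : Algebra.FiniteType K R := by
    classical
    refine ⟨⟨s ∪ s', top_le_iff.1 ?_⟩⟩
    rw [← h.adjoin_eq_top]
    refine Algebra.adjoin_le (Set.union_subset ?_ ?_)
    · rw [← hs]
      exact fun x hx => Algebra.span_le_adjoin K _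
        (Submodule.span_mono (by rw [Finset.coe_union]; exact Set.subset_union_left) hx)
    · rw [← hs']
      exact fun x hx => Algebra.span_le_adjoin K _
        (Submodule.span_mono (by rw [Finset.coe_union]; exact Set.subset_union_right) hx)
  exact Algebra.FiniteType.isNoetherianRing K R

lemma IsStandardBigraded.exists_span_idealQ [GradedAlgebra 𝒜] (h : IsStandardBigraded K R 𝒜) :
    ∃ qs : List R, (∀ x ∈ qs, x ∈ 𝒜 (0, 1)) ∧ Ideal.span {x : R | x ∈ qs} = idealQ K R 𝒜 := by
  obtain ⟨s, hs⟩ := h.fg01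
  have hsub : (s : Set R) ⊆ 𝒜 (0, 1) := hs ▸ Submodule.subset_span
  refine ⟨s.toList, fun x hx => hsub (Finset.mem_toList.1 hx), ?_⟩
  have hset : {x : R | x ∈ s.toList} = s := Set.ext fun x => Finset.mem_toList
  rw [hset, idealQ]
  refine le_antisymm (Ideal.span_mono hsub) (Ideal.span_le.2 fun x hx => ?_)
  rw [← hs] at hx
  exact Submodule.span_subset_span K R _ hx

lemma MinimallyGeneratedBy.exists_span_idealP {m : ℕ} (h : MinimallyGeneratedBy K R 𝒜 m) :
    ∃ ps : List R, (∀ x ∈ ps, x ∈ 𝒜 (1, 0)) ∧ Ideal.span {x : R | x ∈ ps} = idealP K R 𝒜 ∧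
      ps.length = m := by
  obtain ⟨s, hs, hP, hm⟩ := h.1
  have hset : {x : R | x ∈ s.toList} = s := Set.ext fun x => Finset.mem_toList
  exact ⟨s.toList, fun x hx => hs (Finset.mem_toList.1 hx), by rw [hset, hP],
    by rw [Finset.length_toList, hm]⟩

lemma IsFiniteLength.module_finite {N : Type u} [AddCommGroup N] [Module R N]
    (h : IsFiniteLength R N) : Module.Finite R N := by
  have := (isFiniteLength_iff_isNoetherian_isArtinian.1 h).1
  infer_instance

end Standard

/-- **Proposition 2.6.**  Let `R` be a standard bigraded `K`-algebra with irrelevant bigraded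
ideals `P` and `Q`, `P` minimally generated by `m` homogeneous elements, and let `M` be a
finitely generated bigraded generalized Cohen-Macaulay `R`-module of dimension `s` (i.e.
`H^i_{R₊}(M)` has finite length for `i ≠ s`).  Then there is a long exact sequence of bigraded
`R`-modules
`0 → H^1_P(H^s_{R₊}(M)^∨) → H^{s-1}_Q(M)^∨ → H^{s-1}_{R₊}(M)^∨ → H^2_P(H^s_{R₊}(M)^∨) →
H^{s-2}_Q(M)^∨ → H^{s-2}_{R₊}(M)^∨ → ⋯ → H^{s-m}_Q(M)^∨ → H^{s-m}_{R₊}(M)^∨ → 0`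
(formalized as an exact sequence `X` indexed by `ℤ`, trivial outside `1 ≤ k ≤ 3m`, with
`X_{3j-2} ≅ H^j_P(H^s_{R₊}(M)^∨)`, `X_{3j-1} ≅ H^{s-j}_Q(M)^∨`, `X_{3j} ≅ H^{s-j}_{R₊}(M)^∨`
for `1 ≤ j ≤ m`); moreover `H^i_{R₊}(M) ≅ H^i_Q(M)` for all `i < s - m`. -/
theorem generalized_CM_long_exact_sequence
    (K R : Type u) [Field K] [CommRing R] [Algebra K R]
    (𝒜 : ℕ × ℕ → Submodule K R) [GradedAlgebra 𝒜]
    (hstd : IsStandardBigraded K R 𝒜)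
    (M : Type u) [AddCommGroup M] [Module R M] [Module.Finite R M]
    (bgM : Bigrading K R 𝒜 M)
    (m : ℕ) (hm : MinimallyGeneratedBy K R 𝒜 m)
    (s : ℕ)
    (hs : Nontrivial (LC R (idealRPlus K R 𝒜) (s : ℤ) M))
    (hs' : ∀ i : ℤ, (s : ℤ) < i → Subsingleton (LC R (idealRPlus K R 𝒜) i M))
    (hgCM : ∀ i : ℤ, i ≠ (s : ℤ) → IsFiniteLength R ↥(LC R (idealRPlus K R 𝒜) i M)) :
    (∃ (DN : DualData K R 𝒜 ↥(LC R (idealRPlus K R 𝒜) (s : ℤ) M))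
       (DQ : ∀ i : ℤ, DualData K R 𝒜 ↥(LC R (idealQ K R 𝒜) i M))
       (DRp : ∀ i : ℤ, DualData K R 𝒜 ↥(LC R (idealRPlus K R 𝒜) i M))
       (X : ℤ → ModuleCat.{u} R) (f : ∀ k : ℤ, X k ⟶ X (k + 1)),
       (∀ k : ℤ, Function.Exact (f k) (f (k + 1))) ∧
       (∀ k : ℤ, k ≤ 0 → Subsingleton (X k)) ∧
       (∀ k : ℤ, 3 * (m : ℤ) < k → Subsingleton (X k)) ∧
       (∀ j : ℤ, 1 ≤ j → j ≤ (m : ℤ) →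
         Nonempty ((X (3 * j - 2) : Type u) ≃ₗ[R] ↥(LC R (idealP K R 𝒜) j DN.D)) ∧
         Nonempty ((X (3 * j - 1) : Type u) ≃ₗ[R] (DQ ((s : ℤ) - j)).D) ∧
         Nonempty ((X (3 * j) : Type u) ≃ₗ[R] (DRp ((s : ℤ) - j)).D))) ∧
    (∀ i : ℤ, i < (s : ℤ) - (m : ℤ) →
      Nonempty (↥(LC R (idealRPlus K R 𝒜) i M) ≃ₗ[R] ↥(LC R (idealQ K R 𝒜) i M))) := by
  have hR : IsNoetherianRing R := hstd.isNoetherianRing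
  obtain ⟨ps, hps, hP, rfl⟩ := hm.exists_span_idealP
  obtain ⟨qs, hqs, hQ⟩ := hstd.exists_span_idealQ
  have hRP : Ideal.span {x : R | x ∈ qs ++ ps} = idealRPlus K R 𝒜 := by
    rw [idealRPlus, ← hP, ← hQ, ← Ideal.span_union, Set.union_comm]
    exact congrArg Ideal.span (Set.ext fun x => List.mem_append)
  obtain ⟨i₀, hlow⟩ := DiffModule.exists_low bgM.toGr
  let L : DiffModule R := DiffModule.cech qs (DiffModule.single M 0)
  let gL : DiffModule.DGr 𝒜 L := (DiffModule.DGr.single bgM.toGr 0).cech qs hqs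
  have hL : gL.toGr.Low i₀ :=
    Gr.Low.cech qs hqs (g := DiffModule.DGr.single bgM.toGr 0) hlow
  have eQ : ∀ i : ℤ, Nonempty (LC R (idealQ K R 𝒜) i M ≃ₗ[R] L.Coh i) := fun i =>
    LC_equiv_cech qs hQ M (zero_add i)
  have eR : ∀ i : ℤ, Nonempty (LC R (idealRPlus K R 𝒜) i M ≃ₗ[R] (DiffModule.cech ps L).Coh i) :=
    fun i => by
      have h := LC_equiv_cech (qs ++ ps) hRP M (zero_add i)
      rwa [DiffModule.cech_append] at h
  have hfin : ∀ k : ℤ, -(s : ℤ) < k → Module.Finite R ((DiffModule.cech ps L).Coh (-k)) :=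
    fun k hk => by
      have := (hgCM (-k) (by omega)).module_finite
      exact Module.Finite.equiv (eR (-k)).some
  refine ⟨⟨(gL.cech ps hps).dualData (add_neg_cancel _) (eR s).some,
    fun i => gL.dualData (add_neg_cancel i) (eQ i).some,
    fun i => (gL.cech ps hps).dualData (add_neg_cancel i) (eR i).some, ?_⟩, fun i hi => ?_⟩
  · have hE : ∀ k < -(s : ℤ), (gL.cech ps hps).dual.Ex k := fun k hk => by
      refine DiffModule.DGr.ex_dual (neg_add_cancel k) (DiffModule.subsingleton_coh_iff.1 ?_)
      have := hs' (-k) (by omega)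
      exact (eR (-k)).some.symm.toEquiv.subsingleton
    obtain ⟨X, f, h1, h2, h3, h4⟩ := DiffModule.exists_long_exact_sequence hps gL hL hE hfin
    refine ⟨X, f, h1, h2, h3, fun j hj hjm => ?_⟩
    have h := h4 j hj hjm
    rw [hP, show -(s : ℤ) + j = -((s : ℤ) - j) by ring] at h
    exact h
  · have h := DiffModule.cechFst_bijective hps gL hL hfin (add_neg_cancel i) (by omega)
    exact ⟨(eR i).some.trans ((LinearEquiv.ofBijective _ h).trans (eQ i).some.symm)⟩
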